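/- arXiv:1401.0705 — 4 statements merged into one kernel-verified Lean document; each statement's English description precedes it below -/
import Mathlib

section
/- There is no algorithm (no total computable function, for any fixed effective encoding of instances by natural numbers) that, given a 2-tape automaton with 3 states over a finite alphabet A = A₁ × A₂ together with a state q of it, decides whether q is universal, i.e., whether every configuration in A^ℕ is q-accepted. -/
/-- `ConcatEq w s` : the infinite concatenation `w 0 ++ w 1 ++ ⋯` equals the
infinite sequence `s`. -/
def ConcatEq {α : Type*} (w : ℕ → List α) (s : ℕ → α) : Prop :=
  ∀ (n : ℕ) (j : Fin (w n).length),
    s (((Finset.range n).sum fun i => (w i).length) + (j : ℕ)) = (w n).get j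

/-- A transition of a 2-tape automaton with 3 states, letters encoded as naturals:
(source state, target state, word on tape 1, word on tape 2). -/
abbrev Trans2 : Type := Fin 3 × Fin 3 × List ℕ × List ℕ

/-- The configuration `c` is `q`-accepted by the automaton with transition list `T`:
there is an infinite run starting at `q` whose tape words concatenate to the tapes of `c`. -/
def Accepts2 (T : List Trans2) (q : Fin 3) (c : ℕ → ℕ × ℕ) : Prop :=
  ∃ t : ℕ → Trans2,
    (∀ n, t n ∈ T) ∧ (t 0).1 = q ∧ (∀ n, (t n).2.1 = (t (n + 1)).1) ∧
    ConcatEq (fun n => (t n).2.2.1) (fun i => (c i).1) ∧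
    ConcatEq (fun n => (t n).2.2.2) (fun i => (c i).2)

/-- Well-formed 2-tape automaton over alphabet `A₁ × A₂` with `A₁ = {0,…,n₁-1}`,
`A₂ = {0,…,n₂-1}`: nonempty alphabets, and every transition carries nonempty words
over the respective alphabets. -/
def AutWF (n₁ n₂ : ℕ) (T : List Trans2) : Prop :=
  1 ≤ n₁ ∧ 1 ≤ n₂ ∧
  ∀ t ∈ T, t.2.2.1 ≠ [] ∧ t.2.2.2 ≠ [] ∧
    (∀ a ∈ t.2.2.1, a < n₁) ∧ (∀ a ∈ t.2.2.2, a < n₂)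

/-- State `q` is universal: every configuration over the alphabet is `q`-accepted. -/
def Universal (n₁ n₂ : ℕ) (T : List Trans2) (q : Fin 3) : Prop :=
  ∀ c : ℕ → ℕ × ℕ, (∀ i, (c i).1 < n₁ ∧ (c i).2 < n₂) → Accepts2 T q c

/-- The factor of length `n` of the sequence `s` starting at position `i`. -/
def slice (s : ℕ → ℕ) (i n : ℕ) : List ℕ :=
  (List.range' i n).map s

@[simp] theorem slice_zero (s : ℕ → ℕ) (i : ℕ) : slice s i 0 = [] := rfl

@[simp] theorem slice_succ (s : ℕ → ℕ) (i n : ℕ) :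
    slice s i (n + 1) = s i :: slice s (i + 1) n := rfl

@[simp] theorem length_slice (s : ℕ → ℕ) (i n : ℕ) : (slice s i n).length = n := by
  simp [slice]

theorem mem_slice {s : ℕ → ℕ} {i n a : ℕ} : a ∈ slice s i n ↔ ∃ k < n, s (i + k) = a := by
  simp only [slice, List.mem_map, List.mem_range'_1]
  constructor
  · rintro ⟨j, ⟨h1, h2⟩, rfl⟩
    exact ⟨j - i, by omega, by congr 1; omega⟩
  · rintro ⟨k, hk, rfl⟩
    exact ⟨i + k, by omega, rfl⟩

theorem slice_eq_iff {s : ℕ → ℕ} {i : ℕ} {u : List ℕ} :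
    slice s i u.length = u ↔ ∀ j : Fin u.length, s (i + j) = u.get j := by
  constructor
  · intro h j
    have h2 : (slice s i u.length)[(j : ℕ)]? = u[(j : ℕ)]? := by rw [h]
    simpa [slice] using h2
  · intro h
    apply List.ext_getElem (by simp)
    intro n h1 h2
    simpa [slice] using h ⟨n, h2⟩

theorem slice_inj {s s' : ℕ → ℕ} {i n : ℕ} (h : slice s i n = slice s' i n) {k : ℕ} (hk : k < n) :
    s (i + k) = s' (i + k) := by
  have h2 : (slice s i n)[k]? = (slice s' i n)[k]? := by rw [h]
  simpa [slice, hk] using h2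

/-- A single move of a run, acting on triples (state, position on tape 1, position on tape 2). -/
def RunStep (T : List Trans2) (c : ℕ → ℕ × ℕ) (σ τ : Fin 3 × ℕ × ℕ) : Prop :=
  ∃ u v, (σ.1, τ.1, u, v) ∈ T ∧
    slice (fun i => (c i).1) σ.2.1 u.length = u ∧ slice (fun i => (c i).2) σ.2.2 v.length = v ∧
    τ.2.1 = σ.2.1 + u.length ∧ τ.2.2 = σ.2.2 + v.length

theorem accepts2_iff {T : List Trans2} {q : Fin 3} {c : ℕ → ℕ × ℕ} :
    Accepts2 T q c ↔
      ∃ σ : ℕ → Fin 3 × ℕ × ℕ, σ 0 = (q, 0, 0) ∧ ∀ n, RunStep T c (σ n) (σ (n + 1)) := by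
  constructor
  · rintro ⟨t, hT, h0, hs, h1, h2⟩
    refine ⟨fun n => ((t n).1, (Finset.range n).sum fun i => (t i).2.2.1.length,
      (Finset.range n).sum fun i => (t i).2.2.2.length), by simp [h0], fun n => ?_⟩
    refine ⟨(t n).2.2.1, (t n).2.2.2, ?_, slice_eq_iff.2 (h1 n), slice_eq_iff.2 (h2 n),
      Finset.sum_range_succ _ _, Finset.sum_range_succ _ _⟩
    change ((t n).1, (t (n + 1)).1, (t n).2.2.1, (t n).2.2.2) ∈ T
    rw [← hs]
    exact hT n
  · rintro ⟨σ, h0, hσ⟩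
    choose u v hT hu hv h1 h2 using hσ
    have e1 : ∀ n, (σ n).2.1 = (Finset.range n).sum fun i => (u i).length := by
      intro n
      induction n with
      | zero => simp [h0]
      | succ n ih => rw [Finset.sum_range_succ, ← ih, h1]
    have e2 : ∀ n, (σ n).2.2 = (Finset.range n).sum fun i => (v i).length := by
      intro n
      induction n with
      | zero => simp [h0]
      | succ n ih => rw [Finset.sum_range_succ, ← ih, h2]
    refine ⟨fun n => ((σ n).1, (σ (n + 1)).1, u n, v n), hT, by simp [h0], fun n => rfl, ?_, ?_⟩
    · intro n
      have := slice_eq_iff.1 (hu n)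
      rwa [e1] at this
    · intro n
      have := slice_eq_iff.1 (hv n)
      rwa [e2] at this

/-- Shortest words over `{0, …, m - 1}` that are not compatible with the word `w`. -/
def mismatches (m : ℕ) (w : List ℕ) : List (List ℕ) :=
  w.foldr (fun a E => ((List.range m).filter (· ≠ a)).map (fun b => [b]) ++ E.map (a :: ·)) []

theorem mismatches_cons (m a : ℕ) (w : List ℕ) : mismatches m (a :: w) =
    ((List.range m).filter (· ≠ a)).map (fun b => [b]) ++ (mismatches m w).map (a :: ·) := rfl

theorem exists_mismatch {m : ℕ} {w : List ℕ} {s : ℕ → ℕ} (hs : ∀ i, s i < m) {i : ℕ}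
    (h : slice s i w.length ≠ w) : ∃ v ∈ mismatches m w, slice s i v.length = v := by
  induction w generalizing i with
  | nil => simp at h
  | cons a w ih =>
    by_cases ha : s i = a
    · have : slice s (i + 1) w.length ≠ w := by
        intro h2
        exact h (by simp [ha, h2])
      obtain ⟨v, hv, hv2⟩ := ih this
      exact ⟨a :: v, by simp [mismatches_cons, hv], by simp [ha, hv2]⟩
    · exact ⟨[s i], by simp [mismatches_cons, hs, ha], by simp⟩

theorem slice_ne_of_mem_mismatches {m : ℕ} {w : List ℕ} {s : ℕ → ℕ} {i : ℕ}
    (h : slice s i w.length = w) {v : List ℕ} (hv : v ∈ mismatches m w) :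
    slice s i v.length ≠ v := by
  induction w generalizing i v with
  | nil => simp [mismatches] at hv
  | cons a w ih =>
    simp only [List.length_cons, slice_succ, List.cons.injEq] at h
    simp only [mismatches_cons, List.mem_append, List.mem_map, List.mem_filter] at hv
    rcases hv with ⟨b, hb, rfl⟩ | ⟨v, hv, rfl⟩
    · simp only [List.length_singleton, slice_succ, slice_zero, h.1]
      intro h2
      simp at h2
      simp [h2] at hb
    · simp [ih h.2 hv]

theorem mem_mismatches_bound {m : ℕ} {w : List ℕ} (hw : ∀ a ∈ w, a < m) {v : List ℕ}
    (hv : v ∈ mismatches m w) : v ≠ [] ∧ ∀ a ∈ v, a < m := by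
  induction w generalizing v with
  | nil => simp [mismatches] at hv
  | cons a w ih =>
    simp only [mismatches_cons, List.mem_append, List.mem_map, List.mem_filter] at hv
    rcases hv with ⟨b, hb, rfl⟩ | ⟨v, hv, rfl⟩
    · simpa using hb.1
    · have := ih (fun a ha => hw a (by simp [ha])) hv
      simp only [ne_eq, reduceCtorEq, not_false_eq_true, List.mem_cons, forall_eq_or_imp, true_and]
      exact ⟨hw a (by simp), this.2⟩

/-- The transitions of the automaton that do not depend on the initial word. Letters of the
checked sequence are the numbers below `m`; tape 1 holds the sequence with each letter preceded by
the separator `m`, tape 2 holds the sequence itself. State `1` carries out one of two comparisons,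
depending on whether tape 1 is read from a separator on (equality of the two tapes) or from a letter
on (consistency with the production rule `G`). State `2` accepts everything. -/
inductive Rule (m H : ℕ) (ℓ : ℕ → ℕ) (G : ℕ → ℕ → ℕ → List ℕ) : Trans2 → Prop
  | free {a b : ℕ} : a ≤ m → b < m → Rule m H ℓ G (2, 2, [a], [b])
  | start {a b : ℕ} : a < m → b < m → Rule m H ℓ G (0, 2, [a], [b])
  | copy {s : Fin 3} {a : ℕ} : s ≠ 2 → a < m → a ≠ H → Rule m H ℓ G (s, 1, [m, a], [a])
  | copyErr {s : Fin 3} {a b : ℕ} : s ≠ 2 → a ≤ m → b < m → a ≠ b →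
      Rule m H ℓ G (s, 2, [m, a], [b])
  | sepErr {s : Fin 3} {a a' b : ℕ} : s ≠ 2 → a ≤ m → a' < m → b < m →
      Rule m H ℓ G (s, 2, [m, a, a'], [b])
  | skip {a : ℕ} {v : List ℕ} : a < m → v.length = ℓ a → (∀ b ∈ v, b < m) → H ∉ v →
      Rule m H ℓ G (1, 1, [a, m], v)
  | prodErr {a b d : ℕ} {v : List ℕ} : a < m → b < m → d < m → v.length = ℓ a →
      (∀ b ∈ v, b < m) → v ≠ G a b d → Rule m H ℓ G (1, 2, [a, m, b, m, d], v)

theorem finite_bounded_words (m L : ℕ) : {u : List ℕ | u.length ≤ L ∧ ∀ a ∈ u, a ≤ m}.Finite := by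
  refine ((List.finite_length_le (Fin (m + 1)) L).image (List.map Fin.val)).subset ?_
  rintro u ⟨h1, h2⟩
  refine ⟨u.map (fun a => Fin.ofNat (m + 1) a), by simpa using h1, ?_⟩
  rw [List.map_map]
  conv_rhs => rw [← List.map_id u]
  apply List.map_congr_left
  intro a ha
  simp [Nat.mod_eq_of_lt (Nat.lt_succ_of_le (h2 a ha))]

theorem rule_finite (m H : ℕ) (ℓ : ℕ → ℕ) (G : ℕ → ℕ → ℕ → List ℕ) :
    {t | Rule m H ℓ G t}.Finite := by
  obtain ⟨L, hL⟩ : ∃ L, ∀ a < m, ℓ a ≤ L :=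
    ⟨(Finset.range m).sup ℓ, fun a ha => Finset.le_sup (Finset.mem_range.2 ha)⟩
  have hW := finite_bounded_words m (L + 5)
  refine ((Set.finite_univ (α := Fin 3)).prod
    ((Set.finite_univ (α := Fin 3)).prod (hW.prod hW))).subset ?_
  rintro t ht
  simp only [Set.mem_prod, Set.mem_univ, true_and, Set.mem_ofPred_eq]
  cases ht
  case skip a v ha hv hb hH =>
    have := hL a ha
    simp only [hv, List.length_cons, List.length_nil, List.mem_cons, List.not_mem_nil]
    refine ⟨⟨by omega, ?_⟩, by omega, fun b h => (hb b h).le⟩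
    rintro b (rfl | rfl | h) <;> first | omega | contradiction
  case prodErr a b d v ha hb hd hv hvm hG =>
    have := hL a ha
    simp only [hv, List.length_cons, List.length_nil, List.mem_cons, List.not_mem_nil]
    refine ⟨⟨by omega, ?_⟩, by omega, fun b h => (hvm b h).le⟩
    rintro b (rfl | rfl | rfl | rfl | rfl | h) <;> first | omega | contradiction
  all_goals
    simp only [List.length_cons, List.length_nil, List.mem_cons, List.not_mem_nil, or_false,
      forall_eq_or_imp, forall_eq]
    omega

/-- The automaton refuting histories that start with the word `w`. -/
noncomputable def historyAutomaton (m H : ℕ) (ℓ : ℕ → ℕ) (G : ℕ → ℕ → ℕ → List ℕ)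
    (w : List ℕ) : List Trans2 :=
  (rule_finite m H ℓ G).toFinset.toList ++
    ((0, 1, [m], w) :: (mismatches m w).map (fun v => (0, 2, [m], v)))

theorem mem_historyAutomaton {m H : ℕ} {ℓ : ℕ → ℕ} {G : ℕ → ℕ → ℕ → List ℕ} {w : List ℕ}
    {t : Trans2} : t ∈ historyAutomaton m H ℓ G w ↔
      Rule m H ℓ G t ∨ t = (0, 1, [m], w) ∨ ∃ v ∈ mismatches m w, t = (0, 2, [m], v) := by
  simp [historyAutomaton, eq_comm]

theorem historyAutomaton_wf {m H : ℕ} {ℓ : ℕ → ℕ} {G : ℕ → ℕ → ℕ → List ℕ} {w : List ℕ}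
    (hm : 1 ≤ m) (hℓ : ∀ a, 1 ≤ ℓ a) (hw : w ≠ []) (hwm : ∀ a ∈ w, a < m) :
    AutWF (m + 1) m (historyAutomaton m H ℓ G w) := by
  refine ⟨by omega, hm, fun t ht => ?_⟩
  rcases mem_historyAutomaton.1 ht with h | rfl | ⟨v, hv, rfl⟩
  · cases h
    case skip a v ha hv hb hH =>
      have := hℓ a
      refine ⟨by simp, ?_, ?_, hb⟩
      · rintro rfl
        simp at hv
        omega
      · simp only [List.mem_cons, List.not_mem_nil]
        rintro b (rfl | rfl | h) <;> first | omega | contradiction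
    case prodErr a b d v ha hb hd hv hvm hG =>
      have := hℓ a
      refine ⟨by simp, ?_, ?_, hvm⟩
      · rintro rfl
        simp at hv
        omega
      · simp only [List.mem_cons, List.not_mem_nil]
        rintro b (rfl | rfl | rfl | rfl | rfl | h) <;> first | omega | contradiction
    all_goals
      simp only [List.mem_cons, List.not_mem_nil, or_false, forall_eq_or_imp, forall_eq, ne_eq,
        reduceCtorEq, not_false_eq_true, true_and]
      omega
  · exact ⟨by simp, hw, by simp, hwm⟩
  · have := mem_mismatches_bound hwm hv
    exact ⟨by simp, this.1, by simp, this.2⟩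

/-- The sequence `x` over `{0, …, m - 1}` is generated from its prefix of length `J 0` by the
production rule `G`: the letter at position `i` produces the factor at position `J i`, of length
`ℓ (x i)`, with a lookahead of two letters. The prefix does not contain the letter `H`. -/
structure IsHistory (m H : ℕ) (ℓ : ℕ → ℕ) (G : ℕ → ℕ → ℕ → List ℕ) (x J : ℕ → ℕ) : Prop where
  lt : ∀ i, x i < m
  len_pos : ∀ a, 1 ≤ ℓ a
  three_le : 3 ≤ J 0
  succ : ∀ i, J (i + 1) = J i + ℓ (x i)
  produce : ∀ i, slice x (J i) (ℓ (x i)) = G (x i) (x (i + 1)) (x (i + 2))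
  init : ∀ k < J 0, x k ≠ H

theorem IsHistory.add_three_le {m H : ℕ} {ℓ : ℕ → ℕ} {G : ℕ → ℕ → ℕ → List ℕ} {x J : ℕ → ℕ}
    (h : IsHistory m H ℓ G x J) (i : ℕ) : i + 3 ≤ J i := by
  induction i with
  | zero => simpa using h.three_le
  | succ i ih =>
    have := h.len_pos (x i)
    rw [h.succ]
    omega

theorem IsHistory.not_universal {m H : ℕ} {ℓ : ℕ → ℕ} {G : ℕ → ℕ → ℕ → List ℕ} {x J : ℕ → ℕ}
    (h : IsHistory m H ℓ G x J) {K : ℕ} (hK : x K = H) :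
    ¬ Universal (m + 1) m (historyAutomaton m H ℓ G (slice x 0 (J 0))) 0 := by
  intro hU
  let c : ℕ → ℕ × ℕ := fun i => (if i % 2 = 0 then m else x (i / 2), x i)
  have hc : ∀ i, (c i).1 < m + 1 ∧ (c i).2 < m := by
    intro i
    refine ⟨?_, h.lt i⟩
    have := h.lt (i / 2)
    simp only [c]
    split_ifs <;> omega
  have ce : ∀ k, (c (2 * k)).1 = m := fun k => by simp [c]
  have co : ∀ k, (c (2 * k + 1)).1 = x k := fun k => by
    simp [c, Nat.add_mod, show (2 * k + 1) / 2 = k by omega]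
  have c2 : (fun i => (c i).2) = x := rfl
  obtain ⟨σ, h0, hσ⟩ := accepts2_iff.1 (hU c hc)
  generalize hT : historyAutomaton m H ℓ G (slice x 0 (J 0)) = T at hσ
  let Inv : Fin 3 × ℕ × ℕ → Prop := fun σ => σ = (0, 0, 0) ∨
    (∃ k, σ = (1, 2 * k, k) ∧ ∀ k' < k, x k' ≠ H) ∨
    (∃ e, σ = (1, 2 * e + 1, J e) ∧ ∀ k' < J e, x k' ≠ H)
  have hcopy : ∀ (s : Fin 3) (k : ℕ) (u v : List ℕ) (τ : Fin 3 × ℕ × ℕ),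
      Rule m H ℓ G (s, τ.1, u, v) → s ≠ 2 → slice (fun i => (c i).1) (2 * k) u.length = u →
      slice x k v.length = v → τ.2.1 = 2 * k + u.length → τ.2.2 = k + v.length →
      (∀ k' < k, x k' ≠ H) → Inv τ := by
    rintro s k u v ⟨s', i, j⟩ hr hs hu hv hi hj hk
    have hxk := h.lt k
    have e1 := ce k
    have e2 := co k
    have e3 := ce (k + 1)
    rw [show 2 * (k + 1) = 2 * k + 1 + 1 by ring] at e3
    cases hr <;> simp [e1, e2, e3] at hu hv hi hj
    case free => simp at hs
    case start => omega
    case copy a _ ha _ =>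
      subst hi hj
      right; left
      refine ⟨k + 1, by simp [mul_add], fun k' hk' => ?_⟩
      rcases Nat.lt_succ_iff_lt_or_eq.1 hk' with h1 | rfl
      · exact hk _ h1
      · rwa [hv]
    all_goals omega
  have hstep : ∀ σ τ, Inv σ → RunStep T c σ τ → Inv τ := by
    rintro σ ⟨s', i, j⟩ hI ⟨u, v, hm, hu, hv, hi, hj⟩
    rw [c2] at hv
    rw [← hT, mem_historyAutomaton] at hm
    rcases hI with rfl | ⟨k, rfl, hk⟩ | ⟨e, rfl, he⟩
    · rcases hm with hm | hm | ⟨v', hv', hm⟩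
      · exact hcopy 0 0 u v _ hm (by decide) hu hv hi hj (by simp)
      · simp only [Prod.mk.injEq] at hm
        obtain ⟨-, rfl, rfl, rfl⟩ := hm
        right; right
        simp only [List.length_singleton, length_slice, zero_add] at hi hj
        exact ⟨0, by simp [hi, hj], h.init⟩
      · simp only [Prod.mk.injEq] at hm
        obtain ⟨-, rfl, rfl, rfl⟩ := hm
        exact absurd hv (slice_ne_of_mem_mismatches (by simp) hv')
    · rcases hm with hm | hm | ⟨v', hv', hm⟩
      · exact hcopy 1 k u v _ hm (by decide) hu hv hi hj hk
      · simp at hm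
      · simp at hm
    · rcases hm with hm | hm | ⟨v', hv', hm⟩
      · have e1 := co e
        have e2 := ce (e + 1)
        have e3 := co (e + 1)
        have e4 := ce (e + 2)
        have e5 := co (e + 2)
        have hxe := h.lt e
        rw [show 2 * (e + 1) = 2 * e + 1 + 1 by ring] at e2 e3
        rw [show 2 * (e + 2) = 2 * e + 1 + 1 + 1 + 1 by ring] at e4 e5
        cases hm
        case skip a ha hl hb hH =>
          simp [e1, e2] at hu hi hj
          subst hu
          right; right
          refine ⟨e + 1, by simp [hi, hj, h.succ, hl, mul_add], fun k' hk' => ?_⟩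
          by_cases h1 : k' < J e
          · exact he _ h1
          · rintro rfl
            apply hH
            rw [← hv]
            rw [h.succ] at hk'
            exact mem_slice.2 ⟨k' - J e, by omega, by congr 1; dsimp only; omega⟩
        case prodErr a b d ha hb hd hl hvm hG =>
          simp [e1, e2, e3, e4, e5] at hu
          obtain ⟨rfl, rfl, rfl⟩ := hu
          have := h.produce e
          rw [hl] at hv
          rw [hv] at this
          contradiction
        all_goals
          simp [e1, e2, e3] at hu
          try omega
      · simp at hm
      · simp at hm
  have hInv : ∀ n, Inv (σ n) ∧ n ≤ (σ n).2.2 := by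
    intro n
    induction n with
    | zero => exact ⟨by rw [h0]; left; rfl, by simp⟩
    | succ n ih =>
      refine ⟨hstep _ _ ih.1 (hσ n), ?_⟩
      obtain ⟨u, v, hm, -, -, -, hj⟩ := hσ n
      have hwf : AutWF (m + 1) m T := by
        rw [← hT]
        refine historyAutomaton_wf (by have := h.lt 0; omega) h.len_pos ?_ ?_
        · intro h2
          have h3 := congrArg List.length h2
          have := h.three_le
          simp at h3
          omega
        · intro a ha
          obtain ⟨k, -, rfl⟩ := mem_slice.1 ha
          exact h.lt _
      have h2 : 0 < v.length := List.length_pos_iff.2 (hwf.2.2 _ hm).2.1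
      omega
  obtain ⟨h1, h2⟩ := hInv (K + 1)
  rcases h1 with h1 | ⟨k, h1, hk⟩ | ⟨e, h1, he⟩
  · rw [h1] at h2; simp at h2
  · rw [h1] at h2; exact hk K h2 hK
  · rw [h1] at h2; exact he K h2 hK

theorem IsHistory.universal {m H : ℕ} {ℓ : ℕ → ℕ} {G : ℕ → ℕ → ℕ → List ℕ} {x J : ℕ → ℕ}
    (h : IsHistory m H ℓ G x J) (hH : ∀ k, x k ≠ H) :
    Universal (m + 1) m (historyAutomaton m H ℓ G (slice x 0 (J 0))) 0 := by
  intro c hc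
  by_contra hn
  generalize hT : historyAutomaton m H ℓ G (slice x 0 (J 0)) = T at hn
  have mem_rule : ∀ {t}, Rule m H ℓ G t → t ∈ T := fun ht => by
    rw [← hT]; exact mem_historyAutomaton.2 (Or.inl ht)
  let W : Fin 3 × ℕ × ℕ → Prop := fun σ =>
    ∃ ρ : ℕ → Fin 3 × ℕ × ℕ, ρ 0 = σ ∧ ∀ n, RunStep T c (ρ n) (ρ (n + 1))
  have hW0 : ¬ W (0, 0, 0) := fun hW => hn (accepts2_iff.2 hW)
  have hstep : ∀ {σ} τ, ¬ W σ → RunStep T c σ τ → ¬ W τ := by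
    rintro σ τ hσ hr ⟨ρ, h0, hρ⟩
    refine hσ ⟨fun n => Nat.casesOn n σ ρ, rfl, fun n => ?_⟩
    cases n with
    | zero => simpa [h0] using hr
    | succ n => exact hρ n
  set a1 : ℕ → ℕ := fun i => (c i).1 with ha1
  set a2 : ℕ → ℕ := fun i => (c i).2 with ha2
  have b1 : ∀ i, a1 i ≤ m := fun i => Nat.lt_succ_iff.1 (hc i).1
  have b2 : ∀ i, a2 i < m := fun i => (hc i).2
  have hfree : ∀ i j, W (2, i, j) := fun i j =>
    ⟨fun n => (2, i + n, j + n), rfl, fun n => ⟨[a1 (i + n)], [a2 (j + n)],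
      mem_rule (.free (b1 _) (b2 _)), rfl, rfl, rfl, rfl⟩⟩
  have noErr : ∀ {s i j} (u v : List ℕ), ¬ W (s, i, j) → (s, 2, u, v) ∈ T →
      slice a1 i u.length = u → slice a2 j v.length = v → False := by
    intro s i j u v hW hm hu hv
    exact hstep (2, i + u.length, j + v.length) hW ⟨u, v, hm, hu, hv, rfl, rfl⟩ (hfree _ _)
  have hsep : a1 0 = m := by
    by_contra hne
    exact noErr [a1 0] [a2 0] hW0 (mem_rule (.start (lt_of_le_of_ne (b1 0) hne) (b2 0))) rfl rfl
  have hw : slice a2 0 (J 0) = slice x 0 (J 0) := by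
    by_contra hne
    obtain ⟨v, hv, hv2⟩ := exists_mismatch (w := slice x 0 (J 0)) b2 (i := 0) (by simpa using hne)
    refine noErr [m] v hW0 ?_ (by simp [hsep]) hv2
    rw [← hT]
    exact mem_historyAutomaton.2 (Or.inr (Or.inr ⟨v, hv, rfl⟩))
  have hU0 : ¬ W (1, 1, J 0) := by
    refine hstep _ hW0 ⟨[m], slice x 0 (J 0), ?_, by simpa using hsep, by simpa using hw, rfl,
      by simp⟩
    rw [← hT]
    exact mem_historyAutomaton.2 (Or.inr (Or.inl rfl))
  let P : ℕ → Prop := fun k => (∃ s, s ≠ 2 ∧ ¬ W (s, 2 * k, k)) ∧ a1 (2 * k) = m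
  have hP0 : P 0 := ⟨⟨0, by decide, hW0⟩, hsep⟩
  have hE : ∀ k, P k → a1 (2 * k + 1) = a2 k ∧ (a2 k ≠ H → P (k + 1)) := by
    rintro k ⟨⟨s, hs, hk⟩, hm⟩
    have e1 : a1 (2 * k + 1) = a2 k := by
      by_contra hne
      exact noErr [m, a1 (2 * k + 1)] [a2 k] hk (mem_rule (.copyErr hs (b1 _) (b2 _) hne))
        (by simp [hm]) (by simp)
    have e2 : a1 (2 * k + 1 + 1) = m := by
      by_contra hne
      exact noErr [m, a1 (2 * k + 1), a1 (2 * k + 1 + 1)] [a2 k] hk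
        (mem_rule (.sepErr hs (b1 _) (lt_of_le_of_ne (b1 _) hne) (b2 _))) (by simp [hm]) (by simp)
    refine ⟨e1, fun hne => ⟨⟨1, by decide, ?_⟩, e2⟩⟩
    exact hstep _ hk ⟨[m, a2 k], [a2 k], mem_rule (.copy hs (b2 _) hne), by simp [← ha1, hm, e1],
      by simp [ha2], rfl, rfl⟩
  have hPJ : ∀ K, (∀ k < K, a2 k = x k) → ∀ k ≤ K, P k := by
    intro K hK k
    induction k with
    | zero => exact fun _ => hP0
    | succ k ih =>
      intro hk
      exact (hE k (ih (by omega))).2 (by rw [hK k (by omega)]; exact hH k)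
  have hQ : ∀ i, (∀ k < J i, a2 k = x k) → ¬ W (1, 2 * i + 1, J i) →
      slice a2 (J i) (ℓ (x i)) = slice x (J i) (ℓ (x i)) ∧
      RunStep T c (1, 2 * i + 1, J i) (1, 2 * (i + 1) + 1, J (i + 1)) := by
    intro i hi hWi
    have h3 := h.add_three_le i
    have hp := hPJ _ hi
    have f : ∀ k < J i, a1 (2 * k + 1) = x k := fun k hk => by
      rw [(hE k (hp k hk.le)).1, hi k hk]
    have f1 := f i (by omega)
    have f2 := (hp (i + 1) (by omega)).2
    have f3 := f (i + 1) (by omega)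
    have f4 := (hp (i + 2) (by omega)).2
    have f5 := f (i + 2) (by omega)
    rw [show 2 * (i + 1) = 2 * i + 1 + 1 by ring] at f2 f3
    rw [show 2 * (i + 2) = 2 * i + 1 + 1 + 1 + 1 by ring] at f4 f5
    have hmem : ∀ b ∈ slice a2 (J i) (ℓ (x i)), b < m := by
      intro b hb
      obtain ⟨k, -, rfl⟩ := mem_slice.1 hb
      exact b2 _
    have heq : slice a2 (J i) (ℓ (x i)) = slice x (J i) (ℓ (x i)) := by
      by_contra hne
      rw [h.produce] at hne
      exact noErr _ _ hWi (mem_rule (.prodErr (h.lt i) (h.lt (i + 1)) (h.lt (i + 2)) (by simp)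
        hmem hne)) (by simp [f1, f2, f3, f4, f5]) (by simp)
    refine ⟨heq, [x i, m], _, mem_rule (.skip (h.lt i) (by simp) hmem ?_), ?_, ?_, ?_, ?_⟩
    · rw [heq]
      intro hb
      obtain ⟨k, -, hk⟩ := mem_slice.1 hb
      exact hH _ hk
    · simp [← ha1, f1, f2]
    · simp [← ha2]
    · simp [mul_add, add_right_comm]
    · simp [h.succ]
  have hall : ∀ i, (∀ k < J i, a2 k = x k) ∧ ¬ W (1, 2 * i + 1, J i) := by
    intro i
    induction i with
    | zero => exact ⟨fun k hk => by simpa using slice_inj hw hk, hU0⟩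
    | succ i ih =>
      obtain ⟨h1, h2⟩ := hQ i ih.1 ih.2
      refine ⟨fun k hk => ?_, hstep _ ih.2 h2⟩
      by_cases hk2 : k < J i
      · exact ih.1 k hk2
      · rw [h.succ] at hk
        have := slice_inj h1 (k := k - J i) (by omega)
        rwa [show J i + (k - J i) = k by omega] at this
  exact hU0 ⟨fun n => (1, 2 * n + 1, J n), rfl, fun n => (hQ n (hall n).1 (hall n).2).2⟩

theorem IsHistory.universal_iff {m H : ℕ} {ℓ : ℕ → ℕ} {G : ℕ → ℕ → ℕ → List ℕ} {x J : ℕ → ℕ}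
    (h : IsHistory m H ℓ G x J) :
    Universal (m + 1) m (historyAutomaton m H ℓ G (slice x 0 (J 0))) 0 ↔ ∀ k, x k ≠ H :=
  ⟨fun hU _ hk => h.not_universal hk hU, h.universal⟩

/-- Position `i` of the history of a cellular automaton started on `n` cells, as a pair
(block number, offset in the block): block `t` has length `n + 2 * t + 1`. -/
def blockPos (n : ℕ) : ℕ → ℕ × ℕ
  | 0 => (0, 0)
  | i + 1 => if (blockPos n i).2 < n + 2 * (blockPos n i).1
      then ((blockPos n i).1, (blockPos n i).2 + 1) else ((blockPos n i).1 + 1, 0)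

theorem blockPos_succ_of_lt {n i t k : ℕ} (h : blockPos n i = (t, k)) (hk : k < n + 2 * t) :
    blockPos n (i + 1) = (t, k + 1) := by
  simp [blockPos, h, hk]

theorem blockPos_succ_of_eq {n i t : ℕ} (h : blockPos n i = (t, n + 2 * t)) :
    blockPos n (i + 1) = (t + 1, 0) := by
  simp [blockPos, h]

theorem blockPos_snd_le (n i : ℕ) : (blockPos n i).2 ≤ n + 2 * (blockPos n i).1 := by
  cases i with
  | zero => simp [blockPos]
  | succ i =>
    rw [blockPos]
    split <;> dsimp only <;> omega

theorem blockPos_add {n i t k : ℕ} (h : blockPos n i = (t, k)) {j : ℕ} (hj : k + j ≤ n + 2 * t) :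
    blockPos n (i + j) = (t, k + j) := by
  induction j with
  | zero => exact h
  | succ j ih =>
    exact blockPos_succ_of_lt (k := k + j) (ih (by omega)) (by omega)

theorem blockPos_below {n i t k : ℕ} (h : blockPos n i = (t, k)) :
    blockPos n (i + n + 2 * t + 1) = (t + 1, k) := by
  induction i generalizing t k with
  | zero =>
    obtain ⟨rfl, rfl⟩ := Prod.mk.inj h
    have := blockPos_add (n := n) (i := 0) (j := n) rfl (by omega)
    simpa using blockPos_succ_of_eq (t := 0) (by simpa using this)
  | succ i ih =>
    obtain ⟨⟨t', k'⟩, h'⟩ : ∃ p, blockPos n i = p := ⟨_, rfl⟩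
    have hle := blockPos_snd_le n i
    rw [h'] at hle
    dsimp only at hle
    have hi := ih h'
    rcases hle.lt_or_eq with hlt | rfl
    · obtain ⟨rfl, rfl⟩ := Prod.mk.inj ((blockPos_succ_of_lt h' hlt).symm.trans h)
      have := blockPos_succ_of_lt hi (by omega)
      rwa [show i + n + 2 * t' + 1 + 1 = i + 1 + n + 2 * t' + 1 by ring] at this
    · obtain ⟨rfl, rfl⟩ := Prod.mk.inj ((blockPos_succ_of_eq h').symm.trans h)
      have h2 := blockPos_add hi (j := 2) (by omega)
      have := blockPos_succ_of_eq (by rw [h2]; congr 1)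
      rwa [show i + n + 2 * t' + 1 + 2 + 1 = i + 1 + n + 2 * (t' + 1) + 1 by ring] at this

theorem exists_blockPos {n t k : ℕ} (hk : k ≤ n + 2 * t) : ∃ i, blockPos n i = (t, k) := by
  have h : ∀ t, ∃ i, blockPos n i = (t, 0) := by
    intro t
    induction t with
    | zero => exact ⟨0, rfl⟩
    | succ t ih =>
      obtain ⟨i, hi⟩ := ih
      exact ⟨_, blockPos_below hi⟩
  obtain ⟨i, hi⟩ := h t
  exact ⟨i + k, by simpa using blockPos_add hi (j := k) (by omega)⟩

/-- The length of the word produced by a letter: the separator `0` of consecutive blocks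
lengthens the next block by two cells. -/
def prodLength (a : ℕ) : ℕ := if a = 0 then 3 else 1

section CellularAutomaton

variable {C : Type*}

/-- The cell represented by a letter. -/
def decodeLetter (blank : C) (dec : ℕ → C) (a : ℕ) : C := if a = 0 then blank else dec (a - 1)

/-- The word produced by the letter `a` followed by `b` and `c`, for a cellular automaton with local
rule `N`. -/
def production (N : C → C → C → C) (blank : C) (enc : C → ℕ) (dec : ℕ → C) (a b c : ℕ) : List ℕ :=
  let δ := decodeLetter blank dec
  if a = 0 then [0, enc (N blank blank (δ b)) + 1, enc (N blank (δ b) (δ c)) + 1]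
  else if b = 0 then [enc (N (δ a) blank blank) + 1]
  else [enc (N (δ a) (δ b) (δ c)) + 1]

/-- The letter at offset `k` of block `t` of the history of `F`. -/
def blockLetter (enc : C → ℕ) (F : ℕ → ℤ → C) (t k : ℕ) : ℕ :=
  if k = 0 then 0 else enc (F t (k - 1 - t)) + 1

theorem blank_of_outside {N : C → C → C → C} {blank : C} {F : ℕ → ℤ → C} {n : ℕ}
    (hN : N blank blank blank = blank)
    (hF : ∀ t z, F (t + 1) z = N (F t (z - 1)) (F t z) (F t (z + 1)))
    (h0 : ∀ z : ℤ, z < 0 ∨ n ≤ z → F 0 z = blank) (t : ℕ) (z : ℤ) (hz : z < -t ∨ n + t ≤ z) :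
    F t z = blank := by
  induction t generalizing z with
  | zero => exact h0 z (by simpa using hz)
  | succ t ih =>
    push_cast at hz
    rw [hF, ih _ (by omega), ih _ (by omega), ih _ (by omega), hN]

theorem isHistory_of_cellularAutomaton {N : C → C → C → C} {blank halt : C} {enc : C → ℕ}
    {dec : ℕ → C} {b n : ℕ} {F : ℕ → ℤ → C} (hN : N blank blank blank = blank)
    (hF : ∀ t z, F (t + 1) z = N (F t (z - 1)) (F t z) (F t (z + 1)))
    (h0 : ∀ z : ℤ, z < 0 ∨ n ≤ z → F 0 z = blank) (hn : 2 ≤ n)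
    (hdec : ∀ t z, dec (enc (F t z)) = F t z) (hhalt : dec (enc halt) = halt)
    (hb : ∀ t z, enc (F t z) < b) (hinit : ∀ z, F 0 z ≠ halt) :
    IsHistory (b + 1) (enc halt + 1) prodLength (production N blank enc dec)
      (fun i => blockLetter enc F (blockPos n i).1 (blockPos n i).2)
      (fun i => i + n + 2 * (blockPos n i).1 + 1 + if (blockPos n i).2 = 0 then 0 else 2) := by
  have hout := blank_of_outside hN hF h0
  have hδ : ∀ t k z, k ≤ n + 2 * t → (z : ℤ) = k - 1 - t →
      decodeLetter blank dec (blockLetter enc F t k) = F t z := by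
    intro t k z hk hz
    by_cases h : k = 0
    · subst h
      simp only [blockLetter, decodeLetter, if_true]
      exact (hout t z (by left; omega)).symm
    · simp [blockLetter, decodeLetter, h, hdec, hz]
  have hzero : ∀ t k, blockLetter enc F t k = 0 ↔ k = 0 := by
    intro t k
    unfold blockLetter
    split <;> simp_all
  have hblock : ∀ (t k : ℕ) z, k ≠ 0 → (z : ℤ) = k - 1 - t →
      blockLetter enc F t k = enc (F t z) + 1 := by
    intro t k z hk hz
    simp [blockLetter, hk, hz]
  refine ⟨fun i => ?_, fun a => ?_, ?_, fun i => ?_, fun i => ?_, fun k hk => ?_⟩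
  · dsimp only [blockLetter]
    have := hb (blockPos n i).1 ((blockPos n i).2 - 1 - (blockPos n i).1)
    split <;> omega
  · unfold prodLength
    split <;> omega
  · simp [blockPos]
    omega
  · obtain ⟨⟨t, k⟩, h⟩ : ∃ p, blockPos n i = p := ⟨_, rfl⟩
    have hle := blockPos_snd_le n i
    rw [h] at hle
    dsimp only at hle
    simp only [h, prodLength, hzero]
    rcases hle.lt_or_eq with hlt | rfl
    · rw [blockPos_succ_of_lt h hlt]
      by_cases hk : k = 0 <;> simp [hk] <;> omega
    · rw [blockPos_succ_of_eq h]
      have hk : n + 2 * t ≠ 0 := by omega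
      simp only [hk, if_true, if_false]
      omega
  · obtain ⟨⟨t, k⟩, h⟩ : ∃ p, blockPos n i = p := ⟨_, rfl⟩
    have hle := blockPos_snd_le n i
    rw [h] at hle
    dsimp only at hle
    have hbel := blockPos_below h
    simp only [h, prodLength, hzero, production]
    by_cases hk : k = 0
    · subst hk
      have p1 := blockPos_add h (j := 1) (by omega)
      have p2 := blockPos_add h (j := 2) (by omega)
      have q1 := blockPos_add hbel (j := 1) (by omega)
      have q2 : blockPos n (i + n + 2 * t + 1 + 1 + 1) = (t + 1, 0 + 2) :=
        blockPos_add hbel (j := 2) (by omega)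
      simp only [if_true, slice_succ, slice_zero, add_zero, hbel, q1, q2, p1, p2, zero_add]
      rw [hδ t 1 (-t) (by omega) (by simp), hδ t 2 (-t + 1) (by omega) (by push_cast; ring),
        hblock (t + 1) 1 (-t - 1) (by omega) (by push_cast; ring),
        hblock (t + 1) 2 (-t) (by omega) (by push_cast; ring), hF, hF]
      rw [hout t (-t - 1 - 1) (by left; omega), hout t (-t - 1) (by left; omega), sub_add_cancel]
      simp [blockLetter]
    · have q2 := blockPos_add hbel (j := 2) (by omega)
      simp only [hk, if_false, slice_succ, slice_zero, q2]
      rw [hblock (t + 1) (k + 2) (k - 1 - t + 1) (by omega) (by push_cast; ring), hF,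
        hδ t k (k - 1 - t) hle rfl]
      rcases hle.lt_or_eq with hlt | rfl
      · have p1 := blockPos_succ_of_lt h hlt
        rw [p1, if_neg (by omega), hδ t (k + 1) (k - 1 - t + 1) (by omega) (by push_cast; ring)]
        have e : decodeLetter blank dec (blockLetter enc F (blockPos n (i + 2)).1
            (blockPos n (i + 2)).2) = F t (k - 1 - t + 1 + 1) := by
          rcases (Nat.succ_le_of_lt hlt).lt_or_eq with hlt2 | h2
          · rw [show i + 2 = i + 1 + 1 from rfl, blockPos_succ_of_lt p1 hlt2]
            exact hδ _ _ _ hlt2 (by push_cast; ring)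
          · have p2 : blockPos n (i + 2) = (t + 1, 0) :=
              blockPos_succ_of_eq (by rw [p1]; exact congrArg _ h2)
            rw [p2, hout t _ (by right; omega)]
            simp [blockLetter, decodeLetter]
        rw [e, add_sub_cancel_right]
      · rw [blockPos_succ_of_eq h, if_pos rfl, add_sub_cancel_right,
          hout t (((n + 2 * t : ℕ) : ℤ) - 1 - t + 1) (by right; push_cast; omega),
          hout t (((n + 2 * t : ℕ) : ℤ) - 1 - t + 1 + 1) (by right; push_cast; omega)]
  · have : k ≤ n := by
      simp [blockPos] at hk
      omega
    have hp := blockPos_add (n := n) (i := 0) (j := k) rfl (by omega)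
    simp only [zero_add] at hp
    simp only [hp, blockLetter]
    split
    · omega
    · intro h
      apply hinit (k - 1 - (0 : ℕ))
      rw [← hdec, Nat.succ_injective h, hhalt]

theorem historyAutomaton_of_cellularAutomaton {N : C → C → C → C} {blank halt : C} {enc : C → ℕ}
    {dec : ℕ → C} {b n : ℕ} {F : ℕ → ℤ → C} (hN : N blank blank blank = blank)
    (hF : ∀ t z, F (t + 1) z = N (F t (z - 1)) (F t z) (F t (z + 1)))
    (h0 : ∀ z : ℤ, z < 0 ∨ n ≤ z → F 0 z = blank) (hn : 2 ≤ n)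
    (hdec : ∀ t z, dec (enc (F t z)) = F t z) (hhalt : dec (enc halt) = halt)
    (hb : ∀ t z, enc (F t z) < b) (hinit : ∀ z, F 0 z ≠ halt) (hbh : blank ≠ halt) :
    let T := historyAutomaton (b + 1) (enc halt + 1) prodLength (production N blank enc dec)
      (0 :: (List.range n).map (fun k : ℕ => enc (F 0 k) + 1))
    AutWF (b + 1 + 1) (b + 1) T ∧
      (Universal (b + 1 + 1) (b + 1) T 0 ↔ ∀ t z, F t z ≠ halt) := by
  have hh := isHistory_of_cellularAutomaton hN hF h0 hn hdec hhalt hb hinit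
  have h := hh.universal_iff
  have e : slice (fun i => blockLetter enc F (blockPos n i).1 (blockPos n i).2) 0 (n + 1) =
      0 :: (List.range n).map (fun k : ℕ => enc (F 0 k) + 1) := by
    rw [slice_succ]
    refine congrArg₂ List.cons (by simp [blockPos, blockLetter]) ?_
    rw [slice, List.range'_eq_map_range, List.map_map]
    apply List.map_congr_left
    intro k hk
    have hp := blockPos_add (n := n) (i := 0) (j := 1 + k) rfl
      (by have := List.mem_range.1 hk; omega)
    simp only [zero_add] at hp
    simp [hp, blockLetter]
  simp only [blockPos, zero_add, mul_zero, add_zero, if_true] at h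
  rw [← e]
  intro T
  rw [h]
  refine ⟨historyAutomaton_wf (by omega) hh.len_pos (by simp) ?_, ?_, ?_⟩
  · intro a ha
    obtain ⟨k, -, rfl⟩ := mem_slice.1 ha
    exact hh.lt _
  · intro hx t z hz
    have hz2 : -(t : ℤ) ≤ z ∧ z < n + t := by
      by_contra hcon
      exact hbh ((blank_of_outside hN hF h0 t z (by omega)).symm.trans hz)
    obtain ⟨i, hi⟩ := exists_blockPos (n := n) (t := t) (k := (z + t + 1).toNat) (by omega)
    apply hx i
    have h1 : (z + t + 1).toNat ≠ 0 := by omega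
    have h2 : (((z + t + 1).toNat : ℕ) : ℤ) - 1 - t = z := by omega
    simp only [hi, blockLetter, h1, h2, hz, if_false]
  · intro hx k hk
    dsimp only [blockLetter] at hk
    split at hk
    · omega
    · refine hx (blockPos n k).1 ((blockPos n k).2 - 1 - (blockPos n k).1) ?_
      rw [← hdec, Nat.succ_injective hk, hhalt]

end CellularAutomaton

section TuringMachine

open Turing

variable {Γ Λ : Type} [Inhabited Λ]

/-- The state of the head entering a cell from a neighbour, which the head leaves in
direction `d`. -/
def arriving (M : TM0.Machine Γ Λ) (d : Dir) : Option (Γ × Option Λ) → Option Λ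
  | some (γ, some q) =>
    match M q γ with
    | some (q', .move d') => if d' = d then some q' else none
    | _ => none
  | _ => none

/-- The local rule of the cellular automaton simulating a Turing machine. A cell consists of a tape
symbol and, at the head, a state. The additional cell `none` appears when the machine halts. -/
def machineRule (M : TM0.Machine Γ Λ) (l c r : Option (Γ × Option Λ)) :
    Option (Γ × Option Λ) :=
  match c with
  | none => none
  | some (γ, some q) =>
    match M q γ with
    | none => none
    | some (q', .write γ') => some (γ', some q')
    | some (_, .move _) => some (γ, none)
  | some (γ, none) => some (γ, (arriving M .right l).or (arriving M .left r))

/-- The space-time diagram of a cellular automaton. -/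
def spaceTime {C : Type*} (N : C → C → C → C) (F : ℤ → C) : ℕ → ℤ → C
  | 0 => F
  | t + 1 => fun z => N (spaceTime N F t (z - 1)) (spaceTime N F t z) (spaceTime N F t (z + 1))

theorem spaceTime_succ {C : Type*} (N : C → C → C → C) (F : ℤ → C) (t : ℕ) (z : ℤ) :
    spaceTime N F (t + 1) z =
      N (spaceTime N F t (z - 1)) (spaceTime N F t z) (spaceTime N F t (z + 1)) := rfl

theorem spaceTime_mem {C : Type*} {N : C → C → C → C} {F : ℤ → C} {s : Set C}
    (hN : ∀ l ∈ s, ∀ c ∈ s, ∀ r ∈ s, N l c r ∈ s) (hF : ∀ z, F z ∈ s) (t : ℕ) (z : ℤ) :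
    spaceTime N F t z ∈ s := by
  induction t generalizing z with
  | zero => exact hF z
  | succ t ih => exact hN _ (ih _) _ (ih _) _ (ih _)

/-- The cells whose state, if any, belongs to `S`. -/
def supportedCells (Γ : Type) (S : Set Λ) : Set (Option (Γ × Option Λ)) :=
  {c | ∀ γ q, c = some (γ, some q) → q ∈ S}

theorem supportedCells_finite [Finite Γ] {S : Set Λ} (hS : S.Finite) :
    (supportedCells Γ S).Finite := by
  refine ((((Set.finite_univ (α := Γ)).prod ((hS.image some).insert none)).image
    some).insert none).subset ?_
  rintro (_ | ⟨γ, _ | q⟩) h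
  · simp
  · simp
  · simpa using h γ q rfl

theorem machineRule_mem_supportedCells {M : TM0.Machine Γ Λ} {S : Set Λ} (hS : TM0.Supports M S)
    {l c r : Option (Γ × Option Λ)} (hl : l ∈ supportedCells Γ S) (hc : c ∈ supportedCells Γ S)
    (hr : r ∈ supportedCells Γ S) : machineRule M l c r ∈ supportedCells Γ S := by
  have harr : ∀ {c d q}, c ∈ supportedCells Γ S → arriving M d c = some q → q ∈ S := by
    rintro (_ | ⟨γ, _ | q₀⟩) d q hc hq
    · simp [arriving] at hq
    · simp [arriving] at hq
    · have h0 := hc γ q₀ rfl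
      rcases hM : M q₀ γ with _ | ⟨q', d' | γ'⟩ <;> simp [arriving, hM] at hq
      obtain ⟨-, rfl⟩ := hq
      exact hS.2 hM h0
  intro γ q h
  rcases c with _ | ⟨γ₀, _ | q₀⟩
  · simp [machineRule] at h
  · simp only [machineRule, Option.some.injEq, Prod.mk.injEq, Option.or_eq_some_iff] at h
    rcases h.2 with h | h
    · exact harr hl h
    · exact harr hr h.2
  · have h0 := hc γ₀ q₀ rfl
    rcases hM : M q₀ γ₀ with _ | ⟨q', d' | γ'⟩ <;> simp [machineRule, hM] at h
    obtain ⟨-, rfl⟩ := h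
    exact hS.2 hM h0

variable [Inhabited Γ]

/-- The cells describing a configuration of a Turing machine with the head at `p`. -/
def machineCells (c : TM0.Cfg Γ Λ) (p z : ℤ) : Option (Γ × Option Λ) :=
  some (c.Tape.nth (z - p), if z = p then some c.q else none)

theorem machineRule_of_step_eq_some {M : TM0.Machine Γ Λ} {c c' : TM0.Cfg Γ Λ}
    (h : TM0.step M c = some c') (p : ℤ) : ∃ p', ∀ z,
      machineRule M (machineCells c p (z - 1)) (machineCells c p z) (machineCells c p (z + 1)) =
        machineCells c' p' z := by
  obtain ⟨q, T⟩ := c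
  simp only [TM0.step, Option.map_eq_some_iff] at h
  obtain ⟨⟨q', a⟩, hM, rfl⟩ := h
  have harr : ∀ d z, arriving M d (machineCells ⟨q, T⟩ p z) = if z = p then
      (match a with
        | .move d' => if d' = d then some q' else none
        | .write _ => none) else none := by
    intro d z
    by_cases hz : z = p
    · subst hz
      simp only [arriving, machineCells, sub_self, Tape.nth_zero, if_true, hM]
      cases a <;> rfl
    · simp [arriving, machineCells, hz]
  have hrule : ∀ l r z, machineRule M l (machineCells ⟨q, T⟩ p z) r = if z = p then
      (match a with
        | .move _ => some (T.head, none)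
        | .write γ => some (γ, some q'))
      else some (T.nth (z - p), (arriving M .right l).or (arriving M .left r)) := by
    intro l r z
    by_cases hz : z = p
    · subst hz
      simp only [machineRule, machineCells, sub_self, Tape.nth_zero, if_true, hM]
      cases a <;> rfl
    · simp [machineRule, machineCells, hz]
  have e1 : ∀ z : ℤ, z - 1 = p ↔ z = p + 1 := fun z => by omega
  have e2 : ∀ z : ℤ, z + 1 = p ↔ z = p - 1 := fun z => by omega
  simp only [hrule, harr, e1, e2]
  rcases a with (_ | _) | γ
  · refine ⟨p - 1, fun z => ?_⟩
    have e3 : z - (p - 1) - 1 = z - p := by ring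
    simp only [machineCells, Tape.move_left_nth, e3]
    by_cases h1 : z = p <;> simp [h1]
    omega
  · refine ⟨p + 1, fun z => ?_⟩
    have e3 : z - (p + 1) + 1 = z - p := by ring
    simp only [machineCells, Tape.move_right_nth, e3]
    by_cases h1 : z = p <;> simp [h1]
  · refine ⟨p, fun z => ?_⟩
    simp only [machineCells, Tape.write_nth, sub_eq_zero]
    by_cases h1 : z = p <;> simp [h1]

theorem machineRule_of_step_eq_none {M : TM0.Machine Γ Λ} {c : TM0.Cfg Γ Λ}
    (h : TM0.step M c = none) (l r : Option (Γ × Option Λ)) (p : ℤ) :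
    machineRule M l (machineCells c p p) r = none := by
  obtain ⟨q, T⟩ := c
  simp only [TM0.step, Option.map_eq_none_iff] at h
  simp [machineRule, machineCells, h]

theorem eval_dom_iff_exists_spaceTime (M : TM0.Machine Γ Λ) (l : List Γ) :
    (TM0.eval M l).Dom ↔ ∃ t z,
      spaceTime (machineRule M) (machineCells (TM0.init l : TM0.Cfg Γ Λ) 0) t z = none := by
  have hdom : (TM0.eval M l).Dom ↔ ∃ c, c ∈ StateTransition.eval (TM0.step M) (TM0.init l) := by
    rw [← Part.dom_iff_mem]
    rfl
  simp only [hdom, StateTransition.mem_eval]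
  constructor
  · rintro ⟨c, hc, hn⟩
    have key : ∃ t p, ∀ z, spaceTime (machineRule M)
        (machineCells (TM0.init l : TM0.Cfg Γ Λ) 0) t z = machineCells c p z := by
      clear hn
      induction hc with
      | refl => exact ⟨0, 0, fun _ => rfl⟩
      | tail _ hbc ih =>
        obtain ⟨t, p, h⟩ := ih
        obtain ⟨p', h'⟩ := machineRule_of_step_eq_some hbc p
        exact ⟨t + 1, p', fun z => by rw [spaceTime_succ, h, h, h, h']⟩
    obtain ⟨t, p, h⟩ := key
    exact ⟨t + 1, p, by rw [spaceTime_succ, h, h, h, machineRule_of_step_eq_none hn]⟩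
  · rintro ⟨t, z, htz⟩
    by_contra! hcon
    have key : ∀ t, ∃ c p, StateTransition.Reaches (TM0.step M) (TM0.init l) c ∧
        ∀ z, spaceTime (machineRule M)
          (machineCells (TM0.init l : TM0.Cfg Γ Λ) 0) t z = machineCells c p z := by
      intro t
      induction t with
      | zero => exact ⟨_, 0, .refl, fun _ => rfl⟩
      | succ t ih =>
        obtain ⟨c, p, hr, h⟩ := ih
        obtain ⟨c', hc'⟩ := Option.ne_none_iff_exists'.1 (hcon c hr)
        obtain ⟨p', h'⟩ := machineRule_of_step_eq_some hc' p
        exact ⟨c', p', hr.tail hc', fun z => by rw [spaceTime_succ, h, h, h, h']⟩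
    obtain ⟨c, p, -, h⟩ := key t
    rw [h] at htz
    exact absurd htz (by simp [machineCells])

theorem machineCells_init_natCast (l : List Γ) (k : ℕ) :
    machineCells (TM0.init l : TM0.Cfg Γ Λ) 0 k =
      some (l.getI k, if k = 0 then some default else none) := by
  simp [machineCells, TM0.init, Tape.mk₁, Tape.mk₂, Tape.mk'_nth_nat]

theorem machineCells_init_of_neg (l : List Γ) {z : ℤ} (hz : z < 0) :
    machineCells (TM0.init l : TM0.Cfg Γ Λ) 0 z = some (default, none) := by
  obtain ⟨k, rfl⟩ := Int.eq_negSucc_of_lt_zero hz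
  have h : (Tape.mk₁ l).nth (Int.negSucc k) = default := by
    change (Tape.mk₁ l).left.nth k = default
    simp [Tape.mk₁, Tape.mk₂]
  simp [machineCells, TM0.init, h]

/-- Nonhalting of a Turing machine, expressed through the universality of a state of an automaton
that depends on the input in a simple way. -/
theorem exists_historyAutomaton [Finite Γ] {M : TM0.Machine Γ Λ} {S : Set Λ} (hS : S.Finite)
    (hM : TM0.Supports M S) :
    ∃ (m H : ℕ) (G : ℕ → ℕ → ℕ → List ℕ) (α φ : Γ → ℕ), ∀ κ l,
      let T := historyAutomaton m H prodLength G (0 :: α κ :: (l ++ [default]).map φ)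
      AutWF (m + 1) m T ∧ (Universal (m + 1) m T 0 ↔ ¬ (TM0.eval M (κ :: l)).Dom) := by
  have hfin := supportedCells_finite (Γ := Γ) hS
  obtain ⟨enc, henc⟩ := Set.countable_iff_exists_injOn.1 hfin.countable
  obtain ⟨b, hb⟩ : ∃ b, ∀ c ∈ supportedCells Γ S, enc c < b := by
    obtain ⟨b, hb⟩ := (hfin.image enc).bddAbove
    exact ⟨b + 1, fun c hc => Nat.lt_succ_of_le (hb ⟨c, hc, rfl⟩)⟩
  have hdec : ∀ c ∈ supportedCells Γ S,
      Function.invFunOn enc (supportedCells Γ S) (enc c) = c :=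
    fun c hc => henc.leftInvOn_invFunOn hc
  refine ⟨b + 1, enc none + 1,
    production (machineRule M) (some (default, none)) enc
      (Function.invFunOn enc (supportedCells Γ S)),
    fun γ => enc (some (γ, some default)) + 1, fun γ => enc (some (γ, none)) + 1, fun κ l => ?_⟩
  set F := spaceTime (machineRule M) (machineCells (TM0.init (κ :: l) : TM0.Cfg Γ Λ) 0)
  have hmem : ∀ t z, F t z ∈ supportedCells Γ S :=
    spaceTime_mem (fun l hl c hc r hr => machineRule_mem_supportedCells hM hl hc hr) (by
      intro z γ q hz
      simp only [machineCells, Option.some.injEq, Prod.mk.injEq] at hz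
      obtain ⟨-, hz⟩ := hz
      split at hz <;> simp at hz
      exact hz ▸ hM.1)
  have h := historyAutomaton_of_cellularAutomaton (N := machineRule M) (F := F)
    (blank := some (default, none)) (halt := none) (enc := enc)
    (dec := Function.invFunOn enc (supportedCells Γ S)) (b := b) (n := l.length + 2)
    rfl (fun _ _ => rfl) ?_ (by omega) (fun t z => hdec _ (hmem t z))
    (hdec _ (by simp [supportedCells])) (fun t z => hb _ (hmem t z))
    (fun z => by simp [F, spaceTime, machineCells]) (by simp)
  · have e : (List.range (l.length + 2)).map (fun k : ℕ => enc (F 0 k) + 1) =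
        (enc (some (κ, some default)) + 1) ::
          (l ++ [default]).map fun γ => enc (some (γ, none)) + 1 := by
      apply List.ext_getElem
      · simp
      · intro k h1 h2
        simp only [List.getElem_map, List.getElem_range, F, spaceTime, machineCells_init_natCast]
        rcases k with _ | k
        · simp
        · have hk : k ≤ l.length := by simpa using h1
          rcases hk.lt_or_eq with hk | rfl
          · simp [List.getI_eq_getElem, hk]
          · simp [List.getI_eq_default]
    rw [e] at h
    refine ⟨h.1, h.2.trans ?_⟩
    rw [eval_dom_iff_exists_spaceTime]
    push Not
    rfl
  · intro z hz
    rcases hz with hz | hz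
    · exact machineCells_init_of_neg _ hz
    · lift z to ℕ using by omega
      change machineCells _ _ _ = _
      rw [machineCells_init_natCast, List.getI_eq_default _ (by simp; omega), if_neg (by omega)]

end TuringMachine

section Reduction

open Turing

theorem trNat_eq_digits (n : ℕ) : PartrecToTM2.trNat n = (Nat.digits 2 n).map
    (fun d => if d = 0 then PartrecToTM2.Γ'.bit0 else PartrecToTM2.Γ'.bit1) := by
  induction n using Nat.strong_induction_on with
  | _ n ih =>
  rcases Nat.eq_zero_or_pos n with rfl | hn
  · simp
  rw [Nat.digits_def' one_lt_two hn, List.map_cons, ← ih _ (Nat.div_lt_self hn one_lt_two)]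
  have key : ∀ (b : Bool) (m : ℕ), 0 < Nat.bit b m → PartrecToTM2.trNat (Nat.bit b m) =
      (if b then PartrecToTM2.Γ'.bit1 else PartrecToTM2.Γ'.bit0) :: PartrecToTM2.trNat m := by
    intro b m h
    unfold PartrecToTM2.trNat
    rw [← Num.ofNat'_eq, ← Num.ofNat'_eq, Num.ofNat'_bit]
    cases b <;> cases hm : Num.ofNat' m
    · rw [Num.ofNat'_eq] at hm
      have : m = 0 := by
        have := congrArg (fun x : Num => (x : ℕ)) hm
        simpa using this
      simp [this] at h
    all_goals simp [PartrecToTM2.trNum, PartrecToTM2.trPosNum, Num.bit0, Num.bit1]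
  have h2 := key (n.bodd) (n.div2) (by rwa [Nat.bit_bodd_div2])
  rw [Nat.bit_bodd_div2] at h2
  rw [h2, Nat.div2_val, Nat.mod_two_of_bodd]
  cases n.bodd <;> simp

theorem digits_two_primrec : Primrec (Nat.digits 2) := by
  have := Primrec.nat_strong_rec (α := Unit) (fun _ n => Nat.digits 2 n)
    (g := fun _ l => if l.length = 0 then some [] else
      (l[l.length / 2]?).map (fun t => (l.length % 2) :: t)) ?_ ?_
  · exact this.comp (Primrec.const ()) Primrec.id
  · have hl : Primrec fun p : Unit × List (List ℕ) => p.2.length :=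
      Primrec.list_length.comp Primrec.snd
    refine Primrec.ite (PrimrecRel.comp Primrec.eq hl (Primrec.const 0)) (Primrec.const _) ?_
    refine Primrec.option_map (Primrec.list_getElem?.comp Primrec.snd
      (Primrec.nat_div.comp hl (Primrec.const 2))) ?_
    exact Primrec.list_cons.comp
      (Primrec.nat_mod.comp (hl.comp Primrec.fst) (Primrec.const 2)) Primrec.snd
  · intro _ n
    rcases Nat.eq_zero_or_pos n with rfl | hn
    · simp
    · have : n / 2 < n := Nat.div_lt_self hn one_lt_two
      simp [hn.ne', this, Nat.digits_def' one_lt_two hn]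

/-- Every partial recursive function is the halting problem of a one-tape Turing machine with
finitely many states, started on the binary representation of the input. -/
theorem exists_machine (f : ℕ →. ℕ) (hf : Partrec f) :
    ∃ (Γ Λ : Type) (_ : Inhabited Γ) (_ : Inhabited Λ) (_ : Finite Γ)
      (M : TM0.Machine Γ Λ) (S : Set Λ) (κ : Γ) (φ : ℕ → Γ),
      S.Finite ∧ TM0.Supports M S ∧
      ∀ n, (TM0.eval M (κ :: (Nat.digits 2 n).reverse.map φ)).Dom ↔ (f n).Dom := by
  obtain ⟨c, hc⟩ := ToPartrec.Code.exists_code (Nat.Partrec'.part_iff₁.2 hf)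
  let k := PartrecToTM2.Cont'.halt
  let i1 : Inhabited PartrecToTM2.Λ' := ⟨PartrecToTM2.trNormal c k⟩
  have hs := PartrecToTM2.tr_supports c k
  have hs1 := TM2to1.tr_supports PartrecToTM2.tr hs
  have hs2 := TM1to0.tr_supports _ hs1
  let e : PartrecToTM2.K' → Option PartrecToTM2.Γ' := fun _ => none
  let ψ : ℕ → PartrecToTM2.Γ' :=
    fun d => if d = 0 then PartrecToTM2.Γ'.bit0 else PartrecToTM2.Γ'.bit1
  refine ⟨_, _, inferInstance, inferInstance, ?_, _, _,
    (true, Function.update e .main (some .cons)),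
    (fun d => (false, Function.update e .main (some (ψ d)))), Finset.finite_toSet _, hs2, ?_⟩
  · have : Finite PartrecToTM2.K' :=
      Finite.of_injective (β := Fin 4) (fun k => match k with
        | .main => 0 | .rev => 1 | .aux => 2 | .stack => 3) (by
        intro a b h; cases a <;> cases b <;> simp_all)
    infer_instance
  intro n
  refine (iff_of_eq (congrArg Part.Dom (TM1to0.tr_eval (TM2to1.tr PartrecToTM2.tr) _))).trans ?_
  have h1 := TM2to1.tr_eval_dom (K := PartrecToTM2.K') PartrecToTM2.tr .main
    (PartrecToTM2.trList [n])
  have h2 := PartrecToTM2.tr_eval c [n]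
  have h3 := hc ⟨[n], rfl⟩
  have h4 : (TM2.eval PartrecToTM2.tr .main (PartrecToTM2.trList [n])).Dom ↔ (f n).Dom := by
    have h5 : TM2.init (K := PartrecToTM2.K') (Γ := fun _ => PartrecToTM2.Γ') (Λ := PartrecToTM2.Λ')
        (σ := Option PartrecToTM2.Γ') .main (PartrecToTM2.trList [n]) = PartrecToTM2.init c [n] := by
      unfold TM2.init PartrecToTM2.init
      congr 1
      funext k; cases k <;> rfl
    have h6 : (TM2.eval PartrecToTM2.tr .main (PartrecToTM2.trList [n])).Dom ↔
        (StateTransition.eval (TM2.step PartrecToTM2.tr)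
          (TM2.init .main (PartrecToTM2.trList [n]))).Dom := Iff.rfl
    rw [h6, h5]
    refine (iff_of_eq (congrArg Part.Dom h2)).trans ?_
    rw [Part.map_eq_map, Part.map_Dom, h3]
    rfl
  rw [← h4, ← h1]
  have h5 : TM2to1.trInit (K := PartrecToTM2.K') (Γ := fun _ => PartrecToTM2.Γ') .main
      (PartrecToTM2.trList [n]) = (true, Function.update e .main (some .cons)) ::
        (Nat.digits 2 n).reverse.map
          (fun d => (false, Function.update e .main (some (ψ d)))) := by
    simp only [TM2to1.trInit, PartrecToTM2.trList, trNat_eq_digits, List.reverse_append,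
      List.reverse_cons, List.reverse_nil, List.nil_append, List.singleton_append]
    refine congrArg₂ List.cons rfl ?_
    change List.map (fun a => (false, Function.update e .main (some a)))
      (List.map ψ (Nat.digits 2 n)).reverse = _
    rw [← List.map_reverse, List.map_map]
    rfl
  rw [h5]

end Reduction

theorem primrec_mismatches (m : ℕ) : Primrec (mismatches m) := by
  have hfilter : Primrec fun a : ℕ => (List.range m).filter (· ≠ a) := by
    have h : Primrec₂ fun a b : ℕ => if b = a then none else some b :=
      Primrec.ite (Primrec.eq.comp Primrec.snd Primrec.fst) (Primrec.const none)
        (Primrec.option_some.comp Primrec.snd)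
    refine (Primrec.listFilterMap (Primrec.const (List.range m)) h).of_eq fun a => ?_
    rw [← List.filterMap_eq_filter]
    apply List.filterMap_congr
    intro b _
    by_cases hb : b = a <;> simp [Option.guard, hb]
  refine Primrec.list_foldr Primrec.id (Primrec.const []) (h := fun _ p =>
    ((List.range m).filter (· ≠ p.1)).map (fun b => [b]) ++ p.2.map (p.1 :: ·)) ?_
  have h1 : Primrec fun p : List ℕ × ℕ × List (List ℕ) => p.2.1 :=
    Primrec.fst.comp Primrec.snd
  refine Primrec.list_append.comp (Primrec.list_map (hfilter.comp h1) ?_)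
    (Primrec.list_map (Primrec.snd.comp Primrec.snd) ?_)
  · exact Primrec.list_cons.comp Primrec.snd (Primrec.const [])
  · exact Primrec.list_cons.comp (h1.comp Primrec.fst) Primrec.snd

theorem primrec_historyAutomaton (m H : ℕ) (ℓ : ℕ → ℕ) (G : ℕ → ℕ → ℕ → List ℕ) :
    Primrec (historyAutomaton m H ℓ G) := by
  have hpair : ∀ s : Fin 3, Primrec fun v : List ℕ => ((0, s, [m], v) : Trans2) := fun s =>
    (Primrec.const 0).pair ((Primrec.const s).pair ((Primrec.const [m]).pair Primrec.id))
  exact Primrec.list_append.comp (Primrec.const _) (Primrec.list_cons.comp (hpair 1)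
    (Primrec.list_map (primrec_mismatches m) ((hpair 2).comp Primrec.snd)))

theorem exists_primrec_reduction (f : ℕ →. ℕ) (hf : Partrec f) :
    ∃ (m : ℕ) (T : ℕ → List Trans2), Primrec T ∧
      ∀ n, AutWF (m + 1) m (T n) ∧ (Universal (m + 1) m (T n) 0 ↔ ¬ (f n).Dom) := by
  obtain ⟨Γ, Λ, _, _, _, M, S, κ, φ, hS, hM, h⟩ := exists_machine f hf
  obtain ⟨m, H, G, α, ψ, hA⟩ := exists_historyAutomaton hS hM
  refine ⟨m, fun n => historyAutomaton m H prodLength G (0 :: α κ ::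
    ((Nat.digits 2 n).reverse.map (fun d => if d = 0 then ψ (φ 0) else ψ (φ 1)) ++
      [ψ default])), ?_, fun n => ?_⟩
  · refine (primrec_historyAutomaton _ _ _ _).comp (Primrec.list_cons.comp (Primrec.const _)
      (Primrec.list_cons.comp (Primrec.const _) (Primrec.list_append.comp (Primrec.list_map
        (Primrec.list_reverse.comp digits_two_primrec) ?_) (Primrec.const _))))
    exact Primrec.ite (Primrec.eq.comp Primrec.snd (Primrec.const 0)) (Primrec.const _)
      (Primrec.const _)
  · rw [← h n]
    convert hA κ ((Nat.digits 2 n).reverse.map φ) using 6 <;>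
    · rw [List.map_append, List.map_map]
      refine congrArg (· ++ _) (List.map_congr_left fun d hd => ?_)
      have := Nat.digits_lt_base one_lt_two (List.mem_reverse.1 hd)
      interval_cases d <;> simp

/-- It is undecidable whether a given state of a given 2-tape automaton with
3 states is universal. -/
theorem undecidable_universal_state :
    ¬ ∃ f : ℕ × ℕ × List Trans2 × Fin 3 → Bool, Computable f ∧
      ∀ inst : ℕ × ℕ × List Trans2 × Fin 3, AutWF inst.1 inst.2.1 inst.2.2.1 →
        (f inst = true ↔ Universal inst.1 inst.2.1 inst.2.2.1 inst.2.2.2) := by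
  rintro ⟨D, hD, hspec⟩
  let f : ℕ →. ℕ := fun n => Nat.Partrec.Code.eval (Denumerable.ofNat Nat.Partrec.Code n) 0
  have hf : Partrec f :=
    Nat.Partrec.Code.eval_part.comp (Computable.ofNat _) (Computable.const 0)
  obtain ⟨m, T, hT, h⟩ := exists_primrec_reduction f hf
  refine ComputablePred.halting_problem 0 (ComputablePred.computable_iff.2
    ⟨fun c => !D (m + 1, m, T (Encodable.encode c), 0), ?_, ?_⟩)
  · refine Primrec.not.to_comp.comp (hD.comp ((Computable.const _).pair ((Computable.const _).pair
      (Computable.pair ?_ (Computable.const _)))))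
    exact hT.to_comp.comp Computable.encode
  · funext c
    obtain ⟨hwf, hU⟩ := h (Encodable.encode c)
    have := (hspec (m + 1, m, T (Encodable.encode c), 0) hwf).trans hU
    have hfc : f (Encodable.encode c) = Nat.Partrec.Code.eval c 0 := by
      simp only [f, Denumerable.ofNat_encode]
    rw [hfc] at this
    rw [Bool.not_eq_true', ← Bool.not_eq_true, this, not_not]
end

section
/- There is no algorithm (no total computable function, for any fixed effective encoding of instances by natural numbers) that, given a 2-tape automaton with 3 states over a finite alphabet A = A₁ × A₂ together with a state q of it, decides whether q admits a universal prefix, i.e., whether there exists a finite word x ∈ A^* such that for every infinite sequence y ∈ A^ℕ the configuration x·y is q-accepted. -/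
/-- Prepend a finite word to an infinite sequence. -/
def prependSeq {α : Type*} (x : List α) (y : ℕ → α) : ℕ → α :=
  fun i => if h : i < x.length then x.get ⟨i, h⟩ else y (i - x.length)

/-- State `q` admits a universal prefix: a finite word `x` over the alphabet such that
every configuration beginning with `x` is `q`-accepted. -/
def HasUniversalPrefix (n₁ n₂ : ℕ) (T : List Trans2) (q : Fin 3) : Prop :=
  ∃ x : List (ℕ × ℕ), (∀ a ∈ x, a.1 < n₁ ∧ a.2 < n₂) ∧
    ∀ y : ℕ → ℕ × ℕ, (∀ i, (y i).1 < n₁ ∧ (y i).2 < n₂) →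
      Accepts2 T q (prependSeq x y)

namespace UniversalPrefix

open Turing

section Machines

theorem trNat_two_pow_sub_one (m : ℕ) :
    PartrecToTM2.trNat (2 ^ m - 1) = List.replicate m PartrecToTM2.Γ'.bit1 := by
  induction m with
  | zero => simp
  | succ m ih =>
    have h2 : 2 ^ (m + 1) - 1 = Nat.bit true (2 ^ m - 1) := by
      have := Nat.one_le_two_pow (n := m)
      simp only [Nat.bit_true, pow_succ]
      omega
    rw [List.replicate_succ, ← ih, h2]
    simp only [PartrecToTM2.trNat]
    have h3 : ((Nat.bit true (2 ^ m - 1) : ℕ) : Num) = Num.bit1 ((2 ^ m - 1 : ℕ) : Num) := by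
      rw [← Num.bit1_of_bit1, ← Nat.cast_add, ← Nat.cast_succ]
      exact congrArg _ (by simp only [Nat.bit_true]; omega)
    rw [h3]
    cases ((2 ^ m - 1 : ℕ) : Num) <;> rfl

theorem exists_partrec_dom_two_pow_not_computable :
    ∃ g : ℕ →. ℕ, Partrec g ∧ ¬ ComputablePred fun m => (g (2 ^ m - 1)).Dom := by
  have hpow : Primrec₂ (fun a b : ℕ => a ^ b) := Primrec₂.unpaired'.1 Nat.Primrec.pow
  let size : ℕ →. ℕ := fun x => Nat.rfind fun m => Part.some (decide (x < 2 ^ m))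
  have hsize : Partrec size := by
    refine Partrec.rfind ?_
    have h : PrimrecPred fun p : ℕ × ℕ => p.1 < 2 ^ p.2 :=
      Primrec.nat_lt.comp Primrec.fst (hpow.comp (Primrec.const 2) Primrec.snd)
    exact h.decide.to_comp
  have hval : ∀ m, size (2 ^ m - 1) = Part.some m := by
    intro m
    rw [Part.eq_some_iff]
    refine Nat.mem_rfind.2 ?_
    have := Nat.one_le_two_pow (n := m)
    refine ⟨by simp, fun {k} hk => ?_⟩
    have : 2 ^ k < 2 ^ m := Nat.pow_lt_pow_right (by norm_num) hk
    simp; omega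
  refine ⟨fun x => (size x).bind fun m => (Denumerable.ofNat Nat.Partrec.Code m).eval 0,
    hsize.bind ?_, ?_⟩
  · exact Nat.Partrec.Code.eval_part.comp
      ((Computable.ofNat Nat.Partrec.Code).comp Computable.snd) (Computable.const 0)
  · intro h
    refine ComputablePred.halting_problem 0 ?_
    refine ComputablePred.computable_of_manyOneReducible
      ⟨Encodable.encode, Computable.encode, fun c => ?_⟩ h
    simp [hval]

theorem exists_TM0_dom_not_computable :
    ∃ (Γ Λ : Type) (_ : Inhabited Γ) (_ : Inhabited Λ) (_ : Finite Γ) (_ : Finite Λ)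
      (M : TM0.Machine Γ Λ) (a b : Γ),
      ¬ ComputablePred fun m =>
        (StateTransition.eval (TM0.step M) (TM0.init (a :: List.replicate m b))).Dom := by
  classical
  obtain ⟨g, hg, hgc⟩ := exists_partrec_dom_two_pow_not_computable
  obtain ⟨c, hc⟩ := ToPartrec.Code.exists_code (Nat.Partrec'.part_iff₁.2 hg)
  let : Fintype PartrecToTM2.K' := ⟨{.main, .rev, .aux, .stack}, by intro x; cases x <;> simp⟩
  let : Inhabited PartrecToTM2.Λ' := ⟨PartrecToTM2.trNormal c .halt⟩
  let M₁ := TM2to1.tr PartrecToTM2.tr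
  let M₀ := TM1to0.tr M₁
  have supp := TM1to0.tr_supports M₁ (TM2to1.tr_supports PartrecToTM2.tr
    (PartrecToTM2.tr_supports c .halt))
  set S := TM1to0.trStmts M₁ (TM2to1.trSupp PartrecToTM2.tr (PartrecToTM2.codeSupp c .halt))
  let : Inhabited S := ⟨⟨default, supp.1⟩⟩
  let g₁ : PointedMap (TM1to0.Λ' M₁) S :=
    ⟨fun q => if h : q ∈ S then ⟨q, h⟩ else default, by
      rw [dif_pos (by exact supp.1)]; rfl⟩
  let idΓ : PointedMap (TM2to1.Γ' PartrecToTM2.K' fun _ => PartrecToTM2.Γ')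
      (TM2to1.Γ' PartrecToTM2.K' fun _ => PartrecToTM2.Γ') := ⟨id, rfl⟩
  have key : ∀ m, (StateTransition.eval (TM0.step (M₀.map idΓ idΓ g₁ Subtype.val))
      (TM0.init (TM2to1.trInit PartrecToTM2.K'.main
        (PartrecToTM2.trList [2 ^ m - 1])))).Dom ↔ (g (2 ^ m - 1)).Dom := by
    intro m
    have h1 := StateTransition.tr_eval_dom
      (TM0.Machine.map_respects M₀ idΓ idΓ g₁ Subtype.val supp (fun _ => rfl)
        (fun q hq => congrArg Subtype.val (dif_pos (Finset.mem_coe.1 hq))))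
      (a₁ := TM0.init (TM2to1.trInit PartrecToTM2.K'.main (PartrecToTM2.trList [2 ^ m - 1])))
      ⟨supp.1, TM0.map_init idΓ g₁ _⟩
    rw [show List.map (fun x => idΓ x) _ = _ from List.map_id _] at h1
    rw [h1]
    have h2 := StateTransition.tr_eval_dom (TM1to0.tr_respects M₁)
      (a₁ := TM1.init (TM2to1.trInit PartrecToTM2.K'.main (PartrecToTM2.trList [2 ^ m - 1])))
      (a₂ := TM0.init (TM2to1.trInit PartrecToTM2.K'.main (PartrecToTM2.trList [2 ^ m - 1])))
      rfl
    rw [h2]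
    have h3 := StateTransition.tr_eval_dom (TM2to1.tr_respects PartrecToTM2.tr)
      (TM2to1.trCfg_init PartrecToTM2.K'.main (PartrecToTM2.trList [2 ^ m - 1]))
    rw [h3]
    have h4 : (TM2.init PartrecToTM2.K'.main (PartrecToTM2.trList [2 ^ m - 1]) :
        PartrecToTM2.Cfg') = PartrecToTM2.init c [2 ^ m - 1] := by
      simp only [TM2.init, PartrecToTM2.init]
      congr 1
      funext k
      cases k <;> rfl
    rw [h4, PartrecToTM2.tr_eval]
    have h5 := hc ⟨[2 ^ m - 1], rfl⟩
    simp only [List.Vector.head] at h5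
    rw [h5]
    rfl
  let cell : Bool → PartrecToTM2.Γ' → TM2to1.Γ' PartrecToTM2.K' fun _ => PartrecToTM2.Γ' :=
    fun t x => (t, Function.update (fun _ => none) PartrecToTM2.K'.main (some x))
  refine ⟨_, S, inferInstance, inferInstance, Finite.of_fintype _, inferInstance,
    M₀.map idΓ idΓ g₁ Subtype.val, cell true .cons, cell false .bit1, fun h => hgc ?_⟩
  refine h.of_eq fun m => ?_
  rw [← key m]
  have : TM2to1.trInit PartrecToTM2.K'.main (PartrecToTM2.trList [2 ^ m - 1]) =
      cell true .cons :: List.replicate m (cell false .bit1) := by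
    simp only [TM2to1.trInit, PartrecToTM2.trList, trNat_two_pow_sub_one, cell,
      List.reverse_append, List.reverse_cons, List.reverse_nil, List.nil_append,
      List.reverse_replicate, List.singleton_append]
    exact congrArg _ List.map_replicate
  rw [this]

end Machines

section Rewriting

/-- One step of the string rewriting system with set of rules `R`. -/
inductive RewriteStep {α : Type*} (R : Set (List α × List α)) : List α → List α → Prop
  | intro {l r : List α} (h : (l, r) ∈ R) (a b : List α) : RewriteStep R (a ++ l ++ b) (a ++ r ++ b)

/-- Derivability of words in the string rewriting system with set of rules `R`. -/
abbrev Rewrites {α : Type*} (R : Set (List α × List α)) : List α → List α → Prop :=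
  Relation.ReflTransGen (RewriteStep R)

/-- Letters of the words that encode configurations of a Turing machine. -/
inductive Letter (Γ Λ : Type) : Type
  | left | right | halt
  | state (q : Λ)
  | cell (a : Γ)

instance {Γ Λ : Type} [Finite Γ] [Finite Λ] : Finite (Letter Γ Λ) := by
  let f : Letter Γ Λ → Fin 3 ⊕ Λ ⊕ Γ
    | .left => .inl 0
    | .right => .inl 1
    | .halt => .inl 2
    | .state q => .inr (.inl q)
    | .cell a => .inr (.inr a)
  refine Finite.of_injective f ?_
  rintro (_ | _ | _ | q | a) (_ | _ | _ | q' | a') h <;> simp_all [f]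

variable {Γ Λ : Type}

open Letter

/-- The word that encodes the state `q` and the tape with left part `l` and right part `r`. -/
def configWord (q : Λ) (l r : List Γ) : List (Letter Γ Λ) :=
  (left :: l.reverse.map cell) ++ state q :: (r.map cell ++ [right])

theorem append_cons_inj_of_forall_not {α : Type*} {p : α → Prop} {a b c d : List α} {x y : α}
    (hx : p x) (hc : ∀ z ∈ c, ¬ p z) (hd : ∀ z ∈ d, ¬ p z)
    (h : a ++ x :: b = c ++ y :: d) : a = c ∧ x = y ∧ b = d := by
  induction a generalizing c with
  | nil =>
    cases c with
    | nil => simpa using h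
    | cons z c =>
      simp only [List.nil_append, List.cons_append, List.cons.injEq] at h
      exact absurd (h.1 ▸ hx) (hc z (by simp))
  | cons w a ih =>
    cases c with
    | nil =>
      simp only [List.nil_append, List.cons_append, List.cons.injEq] at h
      exact absurd hx (hd x (by rw [← h.2]; simp))
    | cons z c =>
      simp only [List.cons_append, List.cons.injEq] at h
      obtain ⟨h1, h2, h3⟩ := ih (fun z hz => hc z (by simp [hz])) h.2
      exact ⟨by rw [h.1, h1], h2, h3⟩

theorem append_state_eq_configWord {q q₀ : Λ} {l r : List Γ} {a b : List (Letter Γ Λ)}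
    (h : a ++ state q₀ :: b = configWord q l r) :
    a = left :: l.reverse.map cell ∧ q₀ = q ∧ b = r.map cell ++ [right] := by
  have := append_cons_inj_of_forall_not (p := fun x => ∃ q, x = state q) ⟨_, rfl⟩
    (by simp) (by rintro z hz ⟨q, rfl⟩; simp at hz) h
  simpa using this

theorem halt_notMem_configWord (q : Λ) (l r : List Γ) : halt ∉ configWord q l r := by
  simp [configWord]

theorem cell_cons_eq {h : Γ} {r : List Γ} {b : List (Letter Γ Λ)}
    (e : cell h :: b = r.map cell ++ [right]) :
    ∃ r', r = h :: r' ∧ b = r'.map cell ++ [right] := by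
  cases r with
  | nil => simp at e
  | cons x r =>
    simp only [List.map_cons, List.cons_append, List.cons.injEq, Letter.cell.injEq] at e
    exact ⟨r, by rw [e.1], e.2⟩

variable [Inhabited Γ]

/-- The configuration encoded by `configWord q l r`. -/
def config (q : Λ) (l r : List Γ) : TM0.Cfg Γ Λ :=
  ⟨q, Tape.mk' (ListBlank.mk l) (ListBlank.mk r)⟩

theorem config_pad (q : Λ) (l : List Γ) : config q l [] = config q l [default] := by
  simp only [config]
  congr 2
  exact ListBlank.ext fun i => by cases i <;> simp [ListBlank.nth_mk, List.getI]

variable [Inhabited Λ]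

/-- The rewriting rules that simulate a Turing machine `M` and erase the tape once it halts. -/
inductive IsMachineRule (M : TM0.Machine Γ Λ) : List (Letter Γ Λ) × List (Letter Γ Λ) → Prop
  | write {q h q' h'} : M q h = some (q', .write h') →
      IsMachineRule M ([state q, cell h], [state q', cell h'])
  | moveRight {q h q'} : M q h = some (q', .move .right) →
      IsMachineRule M ([state q, cell h], [cell h, state q'])
  | moveLeft {q h q'} (a) : M q h = some (q', .move .left) →
      IsMachineRule M ([cell a, state q, cell h], [state q', cell a, cell h])
  | moveLeftEnd {q h q'} : M q h = some (q', .move .left) →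
      IsMachineRule M ([left, state q, cell h], [left, state q', cell default, cell h])
  | pad (q) : IsMachineRule M ([state q, right], [state q, cell default, right])
  | halt {q h} : M q h = none → IsMachineRule M ([state q, cell h], [halt])
  | eraseRight (a) : IsMachineRule M ([halt, cell a], [halt])
  | eraseLeft (a) : IsMachineRule M ([cell a, halt], [halt])

/-- The set of rewriting rules of a Turing machine. -/
def machineRules (M : TM0.Machine Γ Λ) : Set (List (Letter Γ Λ) × List (Letter Γ Λ)) :=
  {p | IsMachineRule M p}

theorem machineRules_finite [Finite Γ] [Finite Λ] (M : TM0.Machine Γ Λ) :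
    (machineRules M).Finite := by
  refine ((List.finite_length_le (Letter Γ Λ) 4).prod
    (List.finite_length_le (Letter Γ Λ) 4)).subset ?_
  rintro _ (_ | _ | _ | _ | _ | _ | _ | _) <;> simp

theorem machineRules_ne_nil {M : TM0.Machine Γ Λ} {p : List (Letter Γ Λ) × List (Letter Γ Λ)}
    (hp : p ∈ machineRules M) : p.1 ≠ [] ∧ p.2 ≠ [] := by
  rcases hp with (_ | _ | _ | _ | _ | _ | _ | _) <;> simp

theorem step_config {M : TM0.Machine Γ Λ} {q q' : Λ} {h : Γ} {s : TM0.Stmt Γ} {l r : List Γ}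
    (hM : M q h = some (q', s)) :
    TM0.step M (config q l (h :: r)) = some (match s with
      | .write h' => config q' l (h' :: r)
      | .move .right => config q' (h :: l) r
      | .move .left => config q' l.tail (l.headI :: h :: r)) := by
  have : M q (ListBlank.mk (h :: r)).head = some (q', s) := hM
  simp only [TM0.step, config, Tape.mk'_head, this, Option.map_some, Option.some.injEq]
  rcases s with (_ | _) | h'
  · simp only [Tape.move_left_mk', ListBlank.tail_mk, ListBlank.head_mk, ListBlank.cons_mk]
  · simp only [Tape.move_right_mk', ListBlank.tail_mk, ListBlank.head_mk, ListBlank.cons_mk,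
      List.headI, List.tail_cons]
  · simp only [Tape.write_mk', ListBlank.tail_mk, ListBlank.cons_mk, List.tail_cons]

theorem step_config_eq_none {M : TM0.Machine Γ Λ} {q : Λ} {h : Γ} {l r : List Γ} :
    TM0.step M (config q l (h :: r)) = none ↔ M q h = none := by
  simp [TM0.step, config]

theorem RewriteStep.configWord {M : TM0.Machine Γ Λ} {q : Λ} {l r : List Γ}
    {w : List (Letter Γ Λ)} (hw : RewriteStep (machineRules M) (configWord q l r) w) :
    TM0.step M (config q l r) = none ∨
      ∃ q' l' r', w = UniversalPrefix.configWord q' l' r' ∧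
        TM0.Reaches M (config q l r) (config q' l' r') := by
  generalize he : UniversalPrefix.configWord q l r = v at hw
  rcases hw with @⟨lhs, rhs, h, a, b⟩
  rcases h with (@⟨q₀, h, q', h', hM⟩ | @⟨q₀, h, q', hM⟩ | @⟨q₀, h, q', x, hM⟩ | @⟨q₀, h, q', hM⟩ |
    ⟨q₀⟩ | @⟨q₀, h, hM⟩ | ⟨x⟩ | ⟨x⟩)
  · obtain ⟨rfl, rfl, hb⟩ := append_state_eq_configWord (a := a) (b := cell h :: b)
      (by simpa using he.symm)
    obtain ⟨r', rfl, rfl⟩ := cell_cons_eq hb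
    exact .inr ⟨q', l, h' :: r', by simp [UniversalPrefix.configWord],
      .single (step_config hM)⟩
  · obtain ⟨rfl, rfl, hb⟩ := append_state_eq_configWord (a := a) (b := cell h :: b)
      (by simpa using he.symm)
    obtain ⟨r', rfl, rfl⟩ := cell_cons_eq hb
    exact .inr ⟨q', h :: l, r', by simp [UniversalPrefix.configWord],
      .single (step_config hM)⟩
  · obtain ⟨ha, rfl, hb⟩ := append_state_eq_configWord (a := a ++ [cell x]) (b := cell h :: b)
      (by simpa using he.symm)
    obtain ⟨r', rfl, rfl⟩ := cell_cons_eq hb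
    cases l with
    | nil => simpa using (List.append_inj' (s₂ := []) ha rfl).2
    | cons y l =>
      rw [List.reverse_cons, List.map_append, ← List.cons_append] at ha
      obtain ⟨rfl, h2⟩ := List.append_inj' ha rfl
      simp only [List.map_cons, List.map_nil, List.cons.injEq, Letter.cell.injEq, and_true] at h2
      subst h2
      exact .inr ⟨q', l, x :: h :: r', by simp [UniversalPrefix.configWord],
        .single (step_config hM)⟩
  · obtain ⟨ha, rfl, hb⟩ := append_state_eq_configWord (a := a ++ [left]) (b := cell h :: b)
      (by simpa using he.symm)
    obtain ⟨r', rfl, rfl⟩ := cell_cons_eq hb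
    cases l with
    | nil =>
      obtain ⟨rfl, -⟩ := List.append_inj' (s₂ := []) ha rfl
      exact .inr ⟨q', [], default :: h :: r', by simp [UniversalPrefix.configWord],
        .single (step_config hM)⟩
    | cons y l =>
      rw [List.reverse_cons, List.map_append, ← List.cons_append] at ha
      simpa using (List.append_inj' ha rfl).2
  · obtain ⟨rfl, rfl, hb⟩ := append_state_eq_configWord (a := a) (b := right :: b)
      (by simpa using he.symm)
    cases r with
    | cons y r => simp at hb
    | nil =>
      obtain rfl : b = [] := by simpa using hb
      exact .inr ⟨q₀, l, [default], by simp [UniversalPrefix.configWord],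
        config_pad q₀ l ▸ .refl⟩
  · obtain ⟨rfl, rfl, hb⟩ := append_state_eq_configWord (a := a) (b := cell h :: b)
      (by simpa using he.symm)
    obtain ⟨r', rfl, rfl⟩ := cell_cons_eq hb
    exact .inl (step_config_eq_none.2 hM)
  · exact absurd (by rw [he]; simp) (halt_notMem_configWord q l r)
  · exact absurd (by rw [he]; simp) (halt_notMem_configWord q l r)

theorem RewriteStep.append {α : Type*} {R : Set (List α × List α)} {v w : List α}
    (h : RewriteStep R v w) (a b : List α) : RewriteStep R (a ++ v ++ b) (a ++ w ++ b) := by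
  obtain ⟨h, c, d⟩ := h
  simpa using RewriteStep.intro h (a ++ c) (d ++ b)

theorem dom_of_rewrites {M : TM0.Machine Γ Λ} {q : Λ} {l r : List Γ}
    (h : Rewrites (machineRules M) (configWord q l r) [left, halt, right]) :
    (StateTransition.eval (TM0.step M) (config q l r)).Dom := by
  generalize he : configWord q l r = v at h
  induction h using Relation.ReflTransGen.head_induction_on generalizing q l r with
  | refl => exact absurd (by rw [he]; simp) (halt_notMem_configWord q l r)
  | head hs _ ih =>
    subst he
    rcases hs.configWord with hn | ⟨q', l', r', rfl, hr⟩
    · exact Part.dom_iff_mem.2 ⟨_, StateTransition.mem_eval.2 ⟨.refl, hn⟩⟩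
    · rw [StateTransition.reaches_eval hr]
      exact ih rfl

theorem rewrites_erase (M : TM0.Machine Γ Λ) (l r : List Γ) :
    Rewrites (machineRules M) ((left :: l.reverse.map cell) ++ halt :: (r.map cell ++ [right]))
      [left, halt, right] := by
  induction r with
  | cons x r ih =>
    refine .head ?_ ih
    simpa using RewriteStep.intro (R := machineRules M) (.eraseRight x)
      (left :: l.reverse.map cell) (r.map cell ++ [right])
  | nil =>
    induction l with
    | nil => exact .refl
    | cons x l ih =>
      refine .head ?_ ih
      simpa using RewriteStep.intro (R := machineRules M) (.eraseLeft x)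
        (left :: l.reverse.map cell) [right]

theorem rewrites_configWord_cons {M : TM0.Machine Γ Λ} {q : Λ} {l r : List Γ} {h : Γ} :
    (M q h = none ∧ Rewrites (machineRules M) (configWord q l (h :: r)) [left, halt, right]) ∨
      ∃ q' l' r', TM0.step M (config q l (h :: r)) = some (config q' l' r') ∧
        RewriteStep (machineRules M) (configWord q l (h :: r)) (configWord q' l' r') := by
  rcases hM : M q h with _ | ⟨q', (_ | _) | h'⟩
  · refine .inl ⟨rfl, .head ?_ (rewrites_erase M l r)⟩
    simpa [configWord] using RewriteStep.intro (R := machineRules M) (.halt hM)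
      (left :: l.reverse.map cell) (r.map cell ++ [right])
  · refine .inr ⟨_, _, _, step_config hM, ?_⟩
    cases l with
    | nil =>
      simpa [configWord] using RewriteStep.intro (R := machineRules M) (.moveLeftEnd hM)
        [] (r.map cell ++ [right])
    | cons x l =>
      simpa [configWord] using RewriteStep.intro (R := machineRules M) (.moveLeft x hM)
        (left :: l.reverse.map cell) (r.map cell ++ [right])
  · refine .inr ⟨_, _, _, step_config hM, ?_⟩
    simpa [configWord] using RewriteStep.intro (R := machineRules M) (.moveRight hM)
      (left :: l.reverse.map cell) (r.map cell ++ [right])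
  · refine .inr ⟨_, _, _, step_config hM, ?_⟩
    simpa [configWord] using RewriteStep.intro (R := machineRules M) (.write hM)
      (left :: l.reverse.map cell) (r.map cell ++ [right])

theorem rewrites_of_dom {M : TM0.Machine Γ Λ} {q : Λ} {l r : List Γ}
    (h : (StateTransition.eval (TM0.step M) (config q l r)).Dom) :
    Rewrites (machineRules M) (configWord q l r) [left, halt, right] := by
  obtain ⟨c, hc⟩ := Part.dom_iff_mem.1 h
  suffices ∀ v, c ∈ StateTransition.eval (TM0.step M) v → ∀ q l r, config q l r = v →
      Rewrites (machineRules M) (configWord q l r) [left, halt, right] from this _ hc _ _ _ rfl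
  intro v hv
  refine StateTransition.evalInduction hv fun v _ ih q l r he => ?_
  subst he
  have main : ∀ h r', config q l r = config q l (h :: r') →
      Rewrites (machineRules M) (configWord q l (h :: r')) [left, halt, right] := by
    intro h r' e
    rcases rewrites_configWord_cons (M := M) (q := q) (l := l) (r := r') (h := h) with
      h1 | ⟨q', l', r'', h1, h2⟩
    · exact h1.2
    · exact .head h2 (ih _ (e ▸ h1) _ _ _ rfl)
  cases r with
  | cons h r => exact main h r rfl
  | nil =>
    refine .head ?_ (main default [] (config_pad q l))
    simpa [configWord] using RewriteStep.intro (R := machineRules M) (.pad q)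
      (left :: l.reverse.map cell) []

/-- A string rewriting system, a target word, and a family of source words of the form `u bᵐ v`
for which derivability of the target is undecidable. -/
theorem exists_rewrites_not_computable :
    ∃ (α : Type) (_ : Finite α) (R : Set (List α × List α)) (u v e : List α) (b : α),
      R.Finite ∧ (∀ p ∈ R, p.1 ≠ [] ∧ p.2 ≠ []) ∧
      ¬ ComputablePred fun m => Rewrites R (u ++ List.replicate m b ++ v) e := by
  obtain ⟨Γ, Λ, _, _, _, _, M, a, b, h⟩ := exists_TM0_dom_not_computable
  refine ⟨Letter Γ Λ, inferInstance, machineRules M, [left, state default, cell a], [right],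
    [left, halt, right], cell b, machineRules_finite M, fun p => machineRules_ne_nil,
    fun hc => h (hc.of_eq fun m => ?_)⟩
  have : ([left, state default, cell a] ++ List.replicate m (cell b) ++ [right] :
      List (Letter Γ Λ)) = configWord default [] (a :: List.replicate m b) := by
    simp [configWord]
  rw [this]
  exact ⟨dom_of_rewrites, rewrites_of_dom⟩

end Rewriting

section Correspondence

variable {α : Type*}

/-- The tiles that simulate a string rewriting system: each tile pushes its first word and pops its
second word. The letter `none` separates successive words of a derivation. -/
def tiles (R : Set (List α × List α)) : Set (List (Option α) × List (Option α)) :=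
  (Set.range fun a : Option α => ([a], [a])) ∪
    (fun p : List α × List α => (p.2.map some, p.1.map some)) '' R

theorem tiles_finite [Finite α] {R : Set (List α × List α)} (hR : R.Finite) : (tiles R).Finite :=
  (Set.finite_range _).union (hR.image _)

theorem tiles_ne_nil {R : Set (List α × List α)} (hR : ∀ p ∈ R, p.1 ≠ [] ∧ p.2 ≠ [])
    {t : List (Option α) × List (Option α)} (ht : t ∈ tiles R) : t.1 ≠ [] ∧ t.2 ≠ [] := by
  rcases ht with ⟨a, rfl⟩ | ⟨p, hp, rfl⟩
  · simp
  · simpa using (hR p hp).symm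

/-- The queue `w` can be turned into `e` by pushing and popping tiles from `𝒯`. -/
def Solvable {β : Type*} (𝒯 : Set (List β × List β)) (s e : List β) : Prop :=
  ∃ J : List (List β × List β), (∀ t ∈ J, t ∈ 𝒯) ∧
    s ++ J.flatMap Prod.fst = J.flatMap Prod.snd ++ e

theorem rewrites_of_tiles {R : Set (List α × List α)} {e : List α}
    {J : List (List (Option α) × List (Option α))} (hJ : ∀ t ∈ J, t ∈ tiles R) {x y : List α}
    (h : x.map some ++ none :: y.map some ++ J.flatMap Prod.fst =
      J.flatMap Prod.snd ++ (e.map some ++ [none])) : Rewrites R (y ++ x) e := by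
  induction J generalizing x y with
  | nil =>
    obtain ⟨h1, -, h2⟩ := append_cons_inj_of_forall_not (p := (· = none)) rfl (by simp) (by simp)
      (show x.map some ++ none :: y.map some = e.map some ++ none :: [] by simpa using h)
    have := List.map_injective_iff.2 (Option.some_injective α) h1
    obtain rfl : y = [] := by simpa using h2
    simpa [this] using Relation.ReflTransGen.refl
  | cons t J ih =>
    have hJ' : ∀ t ∈ J, t ∈ tiles R := fun t ht => hJ t (by simp [ht])
    rcases hJ t (by simp) with ⟨_ | a, rfl⟩ | ⟨⟨l, r⟩, hp, rfl⟩
    · cases x with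
      | nil => simpa using ih hJ' (x := y) (y := []) (by simpa using h)
      | cons b x => simp at h
    · cases x with
      | nil => simp at h
      | cons b x =>
        simp only [List.map_cons, List.cons_append, List.flatMap_cons, List.nil_append,
          List.cons.injEq, Option.some.injEq] at h
        obtain ⟨rfl, h⟩ := h
        simpa using ih hJ' (x := x) (y := y ++ [b]) (by simpa using h)
    · have key : ∀ (l x : List α) (u v : List (Option α)),
          x.map some ++ none :: u = l.map some ++ v →
            ∃ x', x = l ++ x' ∧ x'.map some ++ none :: u = v := by
        intro l
        induction l with
        | nil => exact fun x u v h => ⟨x, rfl, h⟩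
        | cons a l ihl =>
          intro x u v h
          cases x with
          | nil => simp at h
          | cons b x =>
            simp only [List.map_cons, List.cons_append, List.cons.injEq, Option.some.injEq] at h
            obtain ⟨x', rfl, h2⟩ := ihl x u v h.2
            exact ⟨x', by rw [h.1]; rfl, h2⟩
      obtain ⟨x', rfl, h'⟩ := key l x (y.map some ++ (r.map some ++ J.flatMap Prod.fst))
        (J.flatMap Prod.snd ++ (e.map some ++ [none])) (by simpa using h)
      have := ih hJ' (x := x') (y := y ++ r) (by simpa using h')
      exact .head (by simpa using RewriteStep.intro hp y x') this

theorem solvable_tiles_iff {R : Set (List α × List α)} {w e : List α} :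
    Solvable (tiles R) (w.map some ++ [none]) (e.map some ++ [none]) ↔ Rewrites R w e := by
  refine ⟨fun ⟨J, hJ, h⟩ => ?_, fun h => ?_⟩
  · simpa using rewrites_of_tiles (y := []) hJ (by simpa using h)
  · induction h using Relation.ReflTransGen.head_induction_on with
    | refl => exact ⟨[], by simp, by simp⟩
    | head hs _ ih =>
      obtain ⟨J, hJ, h⟩ := ih
      obtain ⟨hp, a, b⟩ := hs
      rename_i l r _
      let copy : List (Option α) → List (List (Option α) × List (Option α)) :=
        List.map fun a => ([a], [a])
      have hfst : ∀ z, (copy z).flatMap Prod.fst = z := fun z => by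
        simp [copy, List.flatMap_map]
      have hsnd : ∀ z, (copy z).flatMap Prod.snd = z := fun z => by
        simp [copy, List.flatMap_map]
      have hcopy : ∀ z, ∀ t ∈ copy z, t ∈ tiles R := by
        intro z t ht
        obtain ⟨c, -, rfl⟩ := List.mem_map.1 ht
        exact .inl ⟨c, rfl⟩
      refine ⟨copy (a.map some) ++ (r.map some, l.map some) :: copy (b.map some ++ [none]) ++ J,
        ?_, ?_⟩
      · intro t ht
        simp only [List.mem_append, List.mem_cons] at ht
        rcases ht with (ht | rfl | ht) | ht
        · exact hcopy _ t ht
        · exact .inr ⟨_, hp, rfl⟩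
        · exact hcopy _ t ht
        · exact hJ t ht
      · simp only [List.flatMap_append, List.flatMap_cons, hfst, hsnd]
        simp only [List.map_append, List.append_assoc] at h ⊢
        rw [← h]

theorem solvable_image_iff {β γ : Type*} {g : β → γ} (hg : g.Injective)
    {𝒯 : Set (List β × List β)} {s e : List β} :
    Solvable (Prod.map (List.map g) (List.map g) '' 𝒯) (s.map g) (e.map g) ↔ Solvable 𝒯 s e := by
  have hfst (J : List (List β × List β)) : (J.map (Prod.map (List.map g) (List.map g))).flatMap
      Prod.fst = (J.flatMap Prod.fst).map g := by
    simp [List.flatMap_map, List.map_flatMap]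
  have hsnd (J : List (List β × List β)) : (J.map (Prod.map (List.map g) (List.map g))).flatMap
      Prod.snd = (J.flatMap Prod.snd).map g := by
    simp [List.flatMap_map, List.map_flatMap]
  constructor
  · rintro ⟨J, hJ, h⟩
    obtain ⟨J, rfl⟩ : J ∈ Set.range (List.map (Prod.map (List.map g) (List.map g))) := by
      rw [Set.range_list_map]
      exact fun t ht => Set.image_subset_range _ _ (hJ t ht)
    refine ⟨J, fun t ht => ?_, List.map_injective_iff.2 hg ?_⟩
    · obtain ⟨t', ht', e'⟩ := hJ _ (List.mem_map_of_mem ht)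
      rwa [← (List.map_injective_iff.2 hg).prodMap (List.map_injective_iff.2 hg) e']
    · simpa [hfst, hsnd] using h
  · rintro ⟨J, hJ, h⟩
    refine ⟨J.map (Prod.map (List.map g) (List.map g)), fun t ht => ?_, ?_⟩
    · obtain ⟨t', ht', rfl⟩ := List.mem_map.1 ht
      exact ⟨t', hJ t' ht', rfl⟩
    · rw [hfst, hsnd, ← List.map_append, ← List.map_append, h]

/-- The words over the letters `2, …, k - 1`. -/
def InRange (k : ℕ) (w : List ℕ) : Prop :=
  ∀ a ∈ w, 2 ≤ a ∧ a < k

/-- A finite set of tiles over the natural numbers for which solvability is undecidable. -/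
theorem exists_solvable_not_computable :
    ∃ (k : ℕ) (𝒯 : List (List ℕ × List ℕ)) (u v e : List ℕ) (b : ℕ),
      (∀ t ∈ 𝒯, t.1 ≠ [] ∧ t.2 ≠ [] ∧ InRange k t.1 ∧ InRange k t.2) ∧
      (∀ m, InRange k (u ++ List.replicate m b ++ v)) ∧ InRange k e ∧
      ¬ ComputablePred fun m => Solvable {t | t ∈ 𝒯} (u ++ List.replicate m b ++ v) e := by
  obtain ⟨α, _, R, u, v, e, b, hfin, hne, h⟩ := exists_rewrites_not_computable
  obtain ⟨n, ⟨f⟩⟩ := Finite.exists_equiv_fin (Option α)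
  let g : Option α → ℕ := fun a => (f a : ℕ) + 2
  have hg : g.Injective := fun a b hab => f.injective (Fin.ext (by simpa [g] using hab))
  have hrange (w : List (Option α)) : InRange (n + 2) (w.map g) := by
    intro a ha
    obtain ⟨c, -, rfl⟩ := List.mem_map.1 ha
    exact ⟨by simp [g], by simp [g]⟩
  have hword (m : ℕ) : (u.map some).map g ++ List.replicate m (g (some b)) ++
      (v.map some ++ [none]).map g =
        ((u ++ List.replicate m b ++ v).map some ++ [none]).map g := by
    simp
  have hfin' := (tiles_finite hfin).image (Prod.map (List.map g) (List.map g))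
  obtain ⟨𝒯, h𝒯⟩ : ∃ 𝒯 : List (List ℕ × List ℕ),
      {t | t ∈ 𝒯} = Prod.map (List.map g) (List.map g) '' tiles R :=
    ⟨hfin'.toFinset.toList, by ext; simp⟩
  refine ⟨n + 2, 𝒯, (u.map some).map g, (v.map some ++ [none]).map g, (e.map some ++ [none]).map g,
    g (some b), fun t ht => ?_, fun m => hword m ▸ hrange _, hrange _, fun hc => h (hc.of_eq ?_)⟩
  · obtain ⟨t, ht', rfl⟩ := h𝒯.subset ht
    have := tiles_ne_nil hne ht'
    exact ⟨by simpa using this.1, by simpa using this.2, hrange _, hrange _⟩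
  · intro m
    rw [hword, h𝒯, solvable_image_iff hg, solvable_tiles_iff]

end Correspondence

section Matching

/-- The word `p` occurs in the sequence `c` at position `i`. -/
def MatchAt (c : ℕ → ℕ) : ℕ → List ℕ → Prop
  | _, [] => True
  | i, a :: p => c i = a ∧ MatchAt c (i + 1) p

theorem matchAt_iff {c : ℕ → ℕ} {i : ℕ} {p : List ℕ} :
    MatchAt c i p ↔ ∀ j : Fin p.length, c (i + j) = p.get j := by
  induction p generalizing i with
  | nil => simp [MatchAt]
  | cons a p ih =>
    refine (and_congr_right' ih).trans (Iff.trans ?_ (Fin.forall_fin_succ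
      (P := fun j : Fin (p.length + 1) => c (i + j) = (a :: p).get j)).symm)
    simp [Nat.add_assoc, Nat.add_comm 1]

theorem matchAt_append {c : ℕ → ℕ} {i : ℕ} {p q : List ℕ} :
    MatchAt c i (p ++ q) ↔ MatchAt c i p ∧ MatchAt c (i + p.length) q := by
  induction p generalizing i with
  | nil => simp [MatchAt]
  | cons a p ih => simp [MatchAt, ih, and_assoc, Nat.add_assoc, Nat.add_comm 1]

/-- A word is determined by its occurrence if it is followed by the first letter below `2`. -/
theorem MatchAt.unique {c : ℕ → ℕ} {i : ℕ} {p q : List ℕ} {a b : ℕ} (hp : ∀ x ∈ p, 2 ≤ x)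
    (hq : ∀ x ∈ q, 2 ≤ x) (ha : a < 2) (hb : b < 2) (h : MatchAt c i (p ++ [a]))
    (h₂ : MatchAt c i (q ++ [b])) : p = q := by
  induction p generalizing i q with
  | nil =>
    cases q with
    | nil => rfl
    | cons y q =>
      have := hq y (by simp)
      have e₁ := h.1
      have e₂ := h₂.1
      omega
  | cons x p ih =>
    cases q with
    | nil =>
      have := hp x (by simp)
      have e₁ := h.1
      have e₂ := h₂.1
      omega
    | cons y q =>
      rw [← h.1, ← h₂.1, ih (fun z hz => hp z (by simp [hz])) (fun z hz => hq z (by simp [hz]))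
        h.2 h₂.2]

/-- The minimal words over `0, …, n - 1` that are not prefixes of `p` and do not extend `p`. -/
def errs (n : ℕ) (p : List ℕ) : List (List ℕ) :=
  p.foldr (fun a ws => ((List.range n).flatMap fun c => if c = a then [] else [[c]]) ++
    ws.map (a :: ·)) []

theorem mem_errs_cons {n a : ℕ} {p w : List ℕ} :
    w ∈ errs n (a :: p) ↔ (∃ c < n, c ≠ a ∧ w = [c]) ∨ ∃ w' ∈ errs n p, w = a :: w' := by
  have h : errs n (a :: p) = ((List.range n).flatMap fun c => if c = a then [] else [[c]]) ++
    (errs n p).map (a :: ·) := rfl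
  rw [h]
  simp only [List.mem_append, List.mem_flatMap, List.mem_range, List.mem_map]
  refine or_congr (exists_congr fun c => and_congr_right' ?_)
    (exists_congr fun w' => and_congr_right' eq_comm)
  split_ifs with hc <;> simp [hc]

theorem ne_nil_of_mem_errs {n : ℕ} {p w : List ℕ} (h : w ∈ errs n p) : w ≠ [] := by
  cases p with
  | nil => simp [errs] at h
  | cons a p =>
    rcases mem_errs_cons.1 h with ⟨c, -, -, rfl⟩ | ⟨w', -, rfl⟩ <;> simp

theorem lt_of_mem_errs {n : ℕ} {p w : List ℕ} (hp : ∀ a ∈ p, a < n) (h : w ∈ errs n p) :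
    ∀ a ∈ w, a < n := by
  induction p generalizing w with
  | nil => simp [errs] at h
  | cons a p ih =>
    rcases mem_errs_cons.1 h with ⟨c, hc, -, rfl⟩ | ⟨w', hw, rfl⟩
    · simpa using hc
    · simpa using ⟨hp a (by simp), ih (fun b hb => hp b (by simp [hb])) hw⟩

theorem matchAt_or_exists_mem_errs {n : ℕ} {c : ℕ → ℕ} (hc : ∀ i, c i < n) (i : ℕ)
    (p : List ℕ) : MatchAt c i p ∨ ∃ w ∈ errs n p, MatchAt c i w := by
  induction p generalizing i with
  | nil => exact .inl trivial
  | cons a p ih =>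
    by_cases ha : c i = a
    · refine (ih (i + 1)).imp (fun h => ⟨ha, h⟩) ?_
      rintro ⟨w, hw, h⟩
      exact ⟨a :: w, mem_errs_cons.2 (.inr ⟨w, hw, rfl⟩), ha, h⟩
    · exact .inr ⟨[c i], mem_errs_cons.2 (.inl ⟨_, hc i, ha, rfl⟩), rfl, trivial⟩

theorem MatchAt.not_of_mem_errs {n : ℕ} {c : ℕ → ℕ} {i : ℕ} {p w : List ℕ} (h : MatchAt c i p)
    (hw : w ∈ errs n p) : ¬ MatchAt c i w := by
  induction p generalizing i w with
  | nil => simp [errs] at hw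
  | cons a p ih =>
    rcases mem_errs_cons.1 hw with ⟨b, -, hb, rfl⟩ | ⟨w', hw', rfl⟩
    · exact fun h' => hb (h'.1.symm.trans h.1)
    · exact fun h' => ih h.2 hw' h'.2

end Matching

section Acceptance

/-- From the state `q` and head positions `i` and `j`, some transition in `T` applicable to the
tapes `c₁` and `c₂` leads into `G`. -/
def CanStep (T : List Trans2) (c₁ c₂ : ℕ → ℕ) (G : Fin 3 → ℕ → ℕ → Prop) (q : Fin 3) (i j : ℕ) :
    Prop :=
  ∃ t ∈ T, t.1 = q ∧ MatchAt c₁ i t.2.2.1 ∧ MatchAt c₂ j t.2.2.2 ∧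
    G t.2.1 (i + t.2.2.1.length) (j + t.2.2.2.length)

theorem concatEq_iff {w : ℕ → List ℕ} {c : ℕ → ℕ} :
    ConcatEq w c ↔ ∀ n, MatchAt c ((Finset.range n).sum fun i => (w i).length) (w n) := by
  simp only [ConcatEq, matchAt_iff]

theorem accepts2_iff {T : List Trans2} {q : Fin 3} {c : ℕ → ℕ × ℕ} :
    Accepts2 T q c ↔ ∃ G : Fin 3 → ℕ → ℕ → Prop, G q 0 0 ∧ ∀ q i j, G q i j →
      CanStep T (fun i => (c i).1) (fun i => (c i).2) G q i j := by
  constructor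
  · rintro ⟨t, hT, rfl, ht, h₁, h₂⟩
    rw [concatEq_iff] at h₁ h₂
    refine ⟨fun q i j => ∃ n, (t n).1 = q ∧
      ((Finset.range n).sum fun i => (t i).2.2.1.length) = i ∧
      ((Finset.range n).sum fun i => (t i).2.2.2.length) = j, ⟨0, rfl, rfl, rfl⟩, ?_⟩
    rintro _ _ _ ⟨n, rfl, rfl, rfl⟩
    exact ⟨t n, hT n, rfl, h₁ n, h₂ n, n + 1, (ht n).symm, Finset.sum_range_succ _ _,
      Finset.sum_range_succ _ _⟩
  · rintro ⟨G, h0, hG⟩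
    choose! f hT hq h₁ h₂ hf using hG
    let S : ℕ → Fin 3 × ℕ × ℕ := fun n => (fun s : Fin 3 × ℕ × ℕ =>
      let t := f s.1 s.2.1 s.2.2
      (t.2.1, s.2.1 + t.2.2.1.length, s.2.2 + t.2.2.2.length))^[n] (q, 0, 0)
    let t : ℕ → Trans2 := fun n => f (S n).1 (S n).2.1 (S n).2.2
    have hS (n : ℕ) : S (n + 1) = ((t n).2.1, (S n).2.1 + (t n).2.2.1.length,
        (S n).2.2 + (t n).2.2.2.length) := Function.iterate_succ_apply' _ _ _
    have hGS (n : ℕ) : G (S n).1 (S n).2.1 (S n).2.2 := by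
      induction n with
      | zero => exact h0
      | succ n ih =>
        rw [hS]
        exact hf _ _ _ ih
    have hS₁ (n : ℕ) : ((Finset.range n).sum fun i => (t i).2.2.1.length) = (S n).2.1 := by
      induction n with
      | zero => rfl
      | succ n ih => rw [Finset.sum_range_succ, ih, hS]
    have hS₂ (n : ℕ) : ((Finset.range n).sum fun i => (t i).2.2.2.length) = (S n).2.2 := by
      induction n with
      | zero => rfl
      | succ n ih => rw [Finset.sum_range_succ, ih, hS]
    refine ⟨t, fun n => hT _ _ _ (hGS n), hq _ _ _ h0, fun n => ?_, concatEq_iff.2 fun n => ?_,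
      concatEq_iff.2 fun n => ?_⟩
    · rw [hq _ _ _ (hGS (n + 1)), hS]
    · rw [hS₁]
      exact h₁ _ _ _ (hGS n)
    · rw [hS₂]
      exact h₂ _ _ _ (hGS n)

end Acceptance

section Automaton

/-- The transitions of a state `q` that reads a letter `b` on the first tape and `g b` on the
second tape, and that moves to state `0` as soon as the tapes do not agree in this way. -/
def codeTrans (n₁ n₂ : ℕ) (q : Fin 3) (g : ℕ → List ℕ) : List Trans2 :=
  (List.range n₁).flatMap fun b => (if 2 ≤ b then [(q, q, [b], g b)] else []) ++
    (errs n₂ (g b)).map fun w => (q, 0, [b], w)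

/-- The transitions of state `0` that pass over every pair of letters but `(1, 1)`. -/
def skipTrans (n₁ n₂ : ℕ) : List Trans2 :=
  (List.range n₁).flatMap fun b => (List.range n₂).flatMap fun c =>
    if b = 1 ∧ c = 1 then [] else [(0, 0, [b], [c])]

/-- The automaton that looks for a violation of the equations `c₂ = s g₁(c₁)` and `c₂ = g₂(c₁)`
after each simultaneous occurrence of the letter `1` on both tapes. -/
def automaton (n₁ n₂ : ℕ) (g₁ g₂ : ℕ → List ℕ) (s : List ℕ) : List Trans2 :=
  (skipTrans n₁ n₂ ++ codeTrans n₁ n₂ 1 g₁ ++ codeTrans n₁ n₂ 2 g₂ ++ [(0, 2, [1], [1])]) ++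
    (0, 1, [1], 1 :: s) :: (errs n₂ s).map fun w => (0, 0, [1], 1 :: w)

variable {n₁ n₂ : ℕ} {g₁ g₂ : ℕ → List ℕ} {s : List ℕ} {t : Trans2}

theorem mem_codeTrans {q : Fin 3} {g : ℕ → List ℕ} :
    t ∈ codeTrans n₁ n₂ q g ↔ ∃ b < n₁, (2 ≤ b ∧ t = (q, q, [b], g b)) ∨
      ∃ w ∈ errs n₂ (g b), t = (q, 0, [b], w) := by
  simp only [codeTrans, List.mem_flatMap, List.mem_range, List.mem_append, List.mem_map, eq_comm]
  refine exists_congr fun b => and_congr_right' (or_congr_left ?_)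
  split_ifs with hb <;> simp [hb]

theorem mem_skipTrans :
    t ∈ skipTrans n₁ n₂ ↔ ∃ b < n₁, ∃ c < n₂, ¬ (b = 1 ∧ c = 1) ∧ t = (0, 0, [b], [c]) := by
  simp only [skipTrans, List.mem_flatMap, List.mem_range]
  refine exists_congr fun b => and_congr_right' (exists_congr fun c => and_congr_right' ?_)
  split_ifs with hb <;> simp [hb]

theorem mem_automaton : t ∈ automaton n₁ n₂ g₁ g₂ s ↔
    t ∈ skipTrans n₁ n₂ ∨ t ∈ codeTrans n₁ n₂ 1 g₁ ∨ t ∈ codeTrans n₁ n₂ 2 g₂ ∨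
      t = (0, 2, [1], [1]) ∨ t = (0, 1, [1], 1 :: s) ∨
        ∃ w ∈ errs n₂ s, t = (0, 0, [1], 1 :: w) := by
  simp only [automaton, List.mem_append, List.mem_cons, List.mem_map, List.not_mem_nil, or_false,
    or_assoc, eq_comm (b := t)]

theorem autWF_automaton (h₁ : 2 ≤ n₁) (h₂ : 2 ≤ n₂)
    (hg₁ : ∀ b < n₁, g₁ b ≠ [] ∧ ∀ a ∈ g₁ b, a < n₂)
    (hg₂ : ∀ b < n₁, g₂ b ≠ [] ∧ ∀ a ∈ g₂ b, a < n₂) (hs : ∀ a ∈ s, a < n₂) :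
    AutWF n₁ n₂ (automaton n₁ n₂ g₁ g₂ s) := by
  have hcode {q : Fin 3} {g : ℕ → List ℕ} (hg : ∀ b < n₁, g b ≠ [] ∧ ∀ a ∈ g b, a < n₂) :
      ∀ t ∈ codeTrans n₁ n₂ q g, t.2.2.1 ≠ [] ∧ t.2.2.2 ≠ [] ∧
        (∀ a ∈ t.2.2.1, a < n₁) ∧ (∀ a ∈ t.2.2.2, a < n₂) := by
    intro t ht
    obtain ⟨b, hb, ⟨-, rfl⟩ | ⟨w, hw, rfl⟩⟩ := mem_codeTrans.1 ht
    · exact ⟨by simp, (hg b hb).1, by simpa using hb, (hg b hb).2⟩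
    · exact ⟨by simp, ne_nil_of_mem_errs hw, by simpa using hb, lt_of_mem_errs (hg b hb).2 hw⟩
  refine ⟨by omega, by omega, fun t ht => ?_⟩
  rcases mem_automaton.1 ht with ht | ht | ht | rfl | rfl | ⟨w, hw, rfl⟩
  · obtain ⟨b, hb, c, hc, -, rfl⟩ := mem_skipTrans.1 ht
    simpa using ⟨hb, hc⟩
  · exact hcode hg₁ t ht
  · exact hcode hg₂ t ht
  · simp only [ne_eq, List.cons_ne_nil, not_false_eq_true, List.mem_singleton, forall_eq, true_and]
    omega
  · simp only [ne_eq, List.cons_ne_nil, not_false_eq_true, List.mem_singleton, forall_eq, true_and,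
      List.forall_mem_cons]
    exact ⟨by omega, by omega, hs⟩
  · simp only [ne_eq, List.cons_ne_nil, not_false_eq_true, List.mem_singleton, forall_eq, true_and,
      List.forall_mem_cons]
    exact ⟨by omega, by omega, lt_of_mem_errs hs hw⟩

variable {c₁ c₂ : ℕ → ℕ} {G : Fin 3 → ℕ → ℕ → Prop} {i j : ℕ}

/-- The possible continuations in a state with transitions `codeTrans n₁ n₂ q g`. -/
def CodeStep (n₂ : ℕ) (g : ℕ → List ℕ) (c₁ c₂ : ℕ → ℕ) (G : Fin 3 → ℕ → ℕ → Prop) (q : Fin 3)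
    (i j : ℕ) : Prop :=
  (2 ≤ c₁ i ∧ MatchAt c₂ j (g (c₁ i)) ∧ G q (i + 1) (j + (g (c₁ i)).length)) ∨
    ∃ w ∈ errs n₂ (g (c₁ i)), MatchAt c₂ j w ∧ G 0 (i + 1) (j + w.length)

theorem canStep_zero_iff (hc₁ : ∀ i, c₁ i < n₁) (hc₂ : ∀ i, c₂ i < n₂) :
    CanStep (automaton n₁ n₂ g₁ g₂ s) c₁ c₂ G 0 i j ↔
      (¬ (c₁ i = 1 ∧ c₂ j = 1) ∧ G 0 (i + 1) (j + 1)) ∨ c₁ i = 1 ∧ c₂ j = 1 ∧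
        (G 2 (i + 1) (j + 1) ∨
          (MatchAt c₂ (j + 1) s ∧ G 1 (i + 1) (j + (s.length + 1))) ∨
          ∃ w ∈ errs n₂ s, MatchAt c₂ (j + 1) w ∧ G 0 (i + 1) (j + (w.length + 1))) := by
  constructor
  · rintro ⟨t, ht, h0, h1, h2, h3⟩
    rcases mem_automaton.1 ht with ht | ht | ht | rfl | rfl | ⟨w, hw, rfl⟩
    · obtain ⟨b, hb, c, hc, hbc, rfl⟩ := mem_skipTrans.1 ht
      exact .inl ⟨by rwa [h1.1, h2.1], h3⟩
    · obtain ⟨b, hb, ⟨-, rfl⟩ | ⟨w, hw, rfl⟩⟩ := mem_codeTrans.1 ht <;> simp at h0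
    · obtain ⟨b, hb, ⟨-, rfl⟩ | ⟨w, hw, rfl⟩⟩ := mem_codeTrans.1 ht <;> simp at h0
    · exact .inr ⟨h1.1, h2.1, .inl h3⟩
    · exact .inr ⟨h1.1, h2.1, .inr (.inl ⟨h2.2, h3⟩)⟩
    · exact .inr ⟨h1.1, h2.1, .inr (.inr ⟨w, hw, h2.2, h3⟩)⟩
  · rintro (⟨h, hG⟩ | ⟨h1, h2, hG | ⟨hs, hG⟩ | ⟨w, hw, hm, hG⟩⟩)
    · exact ⟨_, mem_automaton.2 (.inl (mem_skipTrans.2 ⟨_, hc₁ i, _, hc₂ j, h, rfl⟩)), rfl,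
        ⟨rfl, trivial⟩, ⟨rfl, trivial⟩, hG⟩
    · exact ⟨_, mem_automaton.2 (.inr (.inr (.inr (.inl rfl)))), rfl,
        ⟨h1, trivial⟩, ⟨h2, trivial⟩, hG⟩
    · exact ⟨_, mem_automaton.2 (.inr (.inr (.inr (.inr (.inl rfl))))), rfl,
        ⟨h1, trivial⟩, ⟨h2, hs⟩, hG⟩
    · exact ⟨_, mem_automaton.2 (.inr (.inr (.inr (.inr (.inr ⟨w, hw, rfl⟩))))), rfl,
        ⟨h1, trivial⟩, ⟨h2, hm⟩, hG⟩

theorem codeStep_iff (hc₁ : ∀ i, c₁ i < n₁) {q : Fin 3} {g : ℕ → List ℕ} :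
    CanStep (codeTrans n₁ n₂ q g) c₁ c₂ G q i j ↔ CodeStep n₂ g c₁ c₂ G q i j := by
  constructor
  · rintro ⟨t, ht, -, h1, h2, h3⟩
    obtain ⟨b, hb, ⟨h, rfl⟩ | ⟨w, hw, rfl⟩⟩ := mem_codeTrans.1 ht
    · obtain rfl := h1.1
      exact .inl ⟨h, h2, h3⟩
    · obtain rfl := h1.1
      exact .inr ⟨w, hw, h2, h3⟩
  · rintro (⟨h, h2, h3⟩ | ⟨w, hw, h2, h3⟩)
    · exact ⟨_, mem_codeTrans.2 ⟨_, hc₁ i, .inl ⟨h, rfl⟩⟩, rfl, ⟨rfl, trivial⟩, h2, h3⟩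
    · exact ⟨_, mem_codeTrans.2 ⟨_, hc₁ i, .inr ⟨w, hw, rfl⟩⟩, rfl, ⟨rfl, trivial⟩, h2, h3⟩

theorem canStep_one_iff (hc₁ : ∀ i, c₁ i < n₁) :
    CanStep (automaton n₁ n₂ g₁ g₂ s) c₁ c₂ G 1 i j ↔ CodeStep n₂ g₁ c₁ c₂ G 1 i j := by
  rw [← codeStep_iff hc₁]
  refine exists_congr fun t => and_congr_left fun h => ⟨fun ht => ?_, fun ht =>
    mem_automaton.2 (.inr (.inl ht))⟩
  have h0 := h.1
  rcases mem_automaton.1 ht with ht | ht | ht | rfl | rfl | ⟨w, hw, rfl⟩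
  · obtain ⟨b, hb, c, hc, hbc, rfl⟩ := mem_skipTrans.1 ht
    simp at h0
  · exact ht
  · obtain ⟨b, hb, ⟨-, rfl⟩ | ⟨w, hw, rfl⟩⟩ := mem_codeTrans.1 ht <;> simp at h0
  all_goals simp at h0

theorem canStep_two_iff (hc₁ : ∀ i, c₁ i < n₁) :
    CanStep (automaton n₁ n₂ g₁ g₂ s) c₁ c₂ G 2 i j ↔ CodeStep n₂ g₂ c₁ c₂ G 2 i j := by
  rw [← codeStep_iff hc₁]
  refine exists_congr fun t => and_congr_left fun h => ⟨fun ht => ?_, fun ht =>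
    mem_automaton.2 (.inr (.inr (.inl ht)))⟩
  have h0 := h.1
  rcases mem_automaton.1 ht with ht | ht | ht | rfl | rfl | ⟨w, hw, rfl⟩
  · obtain ⟨b, hb, c, hc, hbc, rfl⟩ := mem_skipTrans.1 ht
    simp at h0
  · obtain ⟨b, hb, ⟨-, rfl⟩ | ⟨w, hw, rfl⟩⟩ := mem_codeTrans.1 ht <;> simp at h0
  · exact ht
  all_goals simp at h0

end Automaton

section Correctness

variable {n₁ n₂ : ℕ} {g g₁ g₂ : ℕ → List ℕ} {s e : List ℕ} {c₁ c₂ : ℕ → ℕ}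
  {G : Fin 3 → ℕ → ℕ → Prop} {q : Fin 3} {i j : ℕ}

theorem MatchAt.exists_eq {c : ℕ → ℕ} {p : List ℕ} {a : ℕ} (h : MatchAt c i p) (ha : a ∈ p) :
    ∃ k, c k = a := by
  obtain ⟨k, rfl⟩ := List.mem_iff_get.1 ha
  exact ⟨_, matchAt_iff.1 h k⟩

theorem InRange.append {k : ℕ} {v w : List ℕ} (hv : InRange k v) (hw : InRange k w) :
    InRange k (v ++ w) := by
  intro a ha
  exact (List.mem_append.1 ha).elim (hv a) (hw a)

theorem InRange.flatMap {k l : ℕ} {I : List ℕ} (hI : InRange k I)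
    (hg : ∀ b, 2 ≤ b → b < k → InRange l (g b)) : InRange l (I.flatMap g) := by
  intro a ha
  obtain ⟨b, hb, ha⟩ := List.mem_flatMap.1 ha
  exact hg b (hI b hb).1 (hI b hb).2 a ha

/-- On the tapes `c₁` and `c₂`, the map `g` translates the letters from positions `i` and `j` on up
to and including the first letter below `2` on the first tape. -/
def CodeMatch (g : ℕ → List ℕ) (c₁ c₂ : ℕ → ℕ) (i j : ℕ) : Prop :=
  ∃ I b, (∀ a ∈ I, 2 ≤ a) ∧ b < 2 ∧ MatchAt c₁ i (I ++ [b]) ∧ MatchAt c₂ j (I.flatMap g ++ g b)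

theorem codeStep_of_not_codeMatch (hc₂ : ∀ i, c₂ i < n₂) (hG : ∀ i j, G 0 i j)
    (hq : ∀ i j, ¬ CodeMatch g c₁ c₂ i j → G q i j) (h : ¬ CodeMatch g c₁ c₂ i j) :
    CodeStep n₂ g c₁ c₂ G q i j := by
  rcases matchAt_or_exists_mem_errs hc₂ j (g (c₁ i)) with hm | ⟨w, hw, hm⟩
  · have h2 : 2 ≤ c₁ i := by
      by_contra! hlt
      exact h ⟨[], c₁ i, by simp, hlt, ⟨rfl, trivial⟩, by simpa using hm⟩
    refine .inl ⟨h2, hm, hq _ _ ?_⟩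
    rintro ⟨I, b, hI, hb, h₁, h₂⟩
    refine h ⟨c₁ i :: I, b, by simpa [h2] using hI, hb, ⟨rfl, h₁⟩, ?_⟩
    rw [List.flatMap_cons, List.append_assoc]
    exact matchAt_append.2 ⟨hm, h₂⟩
  · exact .inr ⟨w, hw, hm, hG _ _⟩

theorem accepts_of_forall_ne (hg₁ : ∀ b < 2, g₁ b = [0]) (hg₂ : ∀ b < 2, g₂ b = e ++ [0])
    (hr₁ : ∀ b, 2 ≤ b → b < n₁ → InRange n₂ (g₁ b))
    (hr₂ : ∀ b, 2 ≤ b → b < n₁ → InRange n₂ (g₂ b)) (hs : InRange n₂ s) (he : InRange n₂ e)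
    (hne : ∀ I, InRange n₁ I → s ++ I.flatMap g₁ ≠ I.flatMap g₂ ++ e)
    {c : ℕ → ℕ × ℕ} (hc : ∀ i, (c i).1 < n₁ ∧ (c i).2 < n₂) :
    Accepts2 (automaton n₁ n₂ g₁ g₂ s) 0 c := by
  rw [accepts2_iff]
  set c₁ : ℕ → ℕ := fun i => (c i).1
  set c₂ : ℕ → ℕ := fun i => (c i).2
  have hc₁ : ∀ i, c₁ i < n₁ := fun i => (hc i).1
  have hc₂ : ∀ i, c₂ i < n₂ := fun i => (hc i).2
  refine ⟨fun q i j => (q = 1 → ¬ CodeMatch g₁ c₁ c₂ i j) ∧ (q = 2 → ¬ CodeMatch g₂ c₁ c₂ i j),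
    by simp, fun q i j hG => ?_⟩
  fin_cases q
  · refine (canStep_zero_iff hc₁ hc₂).2 ?_
    by_cases h : c₁ i = 1 ∧ c₂ j = 1
    · refine .inr ⟨h.1, h.2, ?_⟩
      rcases matchAt_or_exists_mem_errs hc₂ (j + 1) s with hm | ⟨w, hw, hm⟩
      · by_cases h₁ : CodeMatch g₁ c₁ c₂ (i + 1) (j + (s.length + 1))
        · by_cases h₂ : CodeMatch g₂ c₁ c₂ (i + 1) (j + 1)
          · exfalso
            obtain ⟨I, b, hI, hb, h₁, h₁'⟩ := h₁
            obtain ⟨I', b', hI', hb', h₂, h₂'⟩ := h₂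
            obtain rfl := h₁.unique hI hI' hb hb' h₂
            have hI : InRange n₁ I := fun a ha => ⟨hI a ha, by
              obtain ⟨k, rfl⟩ := h₁.exists_eq (a := a) (by simp [ha])
              exact hc₁ k⟩
            rw [hg₁ b hb] at h₁'
            rw [hg₂ b' hb', ← List.append_assoc] at h₂'
            refine hne I hI (MatchAt.unique (fun a ha => (hs.append (hI.flatMap hr₁) a ha).1)
              (fun a ha => ((hI.flatMap hr₂).append he a ha).1) zero_lt_two zero_lt_two ?_ h₂')
            rw [List.append_assoc, matchAt_append]
            exact ⟨hm, by rwa [Nat.add_assoc, Nat.add_comm 1]⟩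
          · exact .inl (by simpa using h₂)
        · exact .inr (.inl ⟨hm, by simpa using h₁⟩)
      · exact .inr (.inr ⟨w, hw, hm, by simp⟩)
    · exact .inl ⟨h, by simp⟩
  · exact (canStep_one_iff hc₁).2 (codeStep_of_not_codeMatch hc₂ (by simp) (by simp)
      (by simpa using hG))
  · exact (canStep_two_iff hc₁).2 (codeStep_of_not_codeMatch hc₂ (by simp) (by simp)
      (by simpa using hG))

theorem not_of_forall_codeStep (hq : ∀ i j, G q i j → CodeStep n₂ g c₁ c₂ G q i j) {I : List ℕ}
    {b : ℕ} (hb : b < 2) (h₁ : MatchAt c₁ i (I ++ [b]))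
    (h₂ : MatchAt c₂ j (I.flatMap g ++ g b)) : ¬ G q i j := by
  induction I generalizing i j with
  | nil =>
    intro h
    obtain rfl := h₁.1
    rcases hq _ _ h with ⟨h, -⟩ | ⟨w, hw, hm, -⟩
    · exact absurd h (by simpa using hb)
    · exact MatchAt.not_of_mem_errs (by simpa using h₂) hw hm
  | cons a I ih =>
    intro h
    obtain rfl := h₁.1
    rw [List.flatMap_cons, List.append_assoc, matchAt_append] at h₂
    rcases hq _ _ h with ⟨-, -, h⟩ | ⟨w, hw, hm, -⟩
    · exact ih h₁.2 h₂.2 h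
    · exact h₂.1.not_of_mem_errs hw hm

theorem exists_zero_of_forall_codeStep (hq : ∀ i j, G q i j → CodeStep n₂ g c₁ c₂ G q i j) {d : ℕ}
    (hd : c₁ (i + d) < 2) (h : G q i j) : ∃ i' j', i ≤ i' ∧ j ≤ j' ∧ G 0 i' j' := by
  induction d generalizing i j with
  | zero =>
    rcases hq _ _ h with ⟨h, -⟩ | ⟨w, -, -, h⟩
    · exact absurd h (by simpa using hd)
    · exact ⟨_, _, by omega, by omega, h⟩
  | succ d ih =>
    rcases hq _ _ h with ⟨-, -, h⟩ | ⟨w, -, -, h⟩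
    · obtain ⟨i', j', hi, hj, h⟩ := ih (by rwa [Nat.add_assoc, Nat.add_comm 1]) h
      exact ⟨i', j', by omega, by omega, h⟩
    · exact ⟨_, _, by omega, by omega, h⟩

theorem exists_le_of_canStep {T : List Trans2}
    (hT : ∀ t ∈ T, t.2.2.1 ≠ [] ∧ t.2.2.2 ≠ []) (h0 : G q 0 0)
    (hG : ∀ q i j, G q i j → CanStep T c₁ c₂ G q i j) (L : ℕ) :
    ∃ q i j, L ≤ i ∧ L ≤ j ∧ G q i j := by
  induction L with
  | zero => exact ⟨q, 0, 0, le_rfl, le_rfl, h0⟩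
  | succ L ih =>
    obtain ⟨q, i, j, hi, hj, h⟩ := ih
    obtain ⟨t, ht, -, -, -, h⟩ := hG _ _ _ h
    have h₁ := List.length_pos_iff.2 (hT t ht).1
    have h₂ := List.length_pos_iff.2 (hT t ht).2
    exact ⟨_, _, _, by omega, by omega, h⟩

/-- The sequence `c` consists of copies of `1 :: w ++ [0]`, padded with zeros to length `D`, from
position `L` on. -/
def PeriodicFrom (L D : ℕ) (w : List ℕ) (c : ℕ → ℕ) : Prop :=
  ∀ i, L ≤ i → c i = (1 :: w ++ [0]).getD ((i - L) % D) 0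

theorem PeriodicFrom.eq_one_iff {L D k : ℕ} {w : List ℕ} {c : ℕ → ℕ} (h : PeriodicFrom L D w c)
    (hw : InRange k w) (hi : L ≤ i) : c i = 1 ↔ (i - L) % D = 0 := by
  rw [h i hi]
  generalize (i - L) % D = m
  cases m with
  | zero => simp
  | succ m =>
    simp only [List.cons_append, List.getD_cons_succ, Nat.add_eq_zero_iff, one_ne_zero, and_false,
      iff_false]
    intro h1
    by_cases hm : m < (w ++ [0]).length
    · rw [List.getD_eq_getElem _ _ hm] at h1
      have := List.getElem_mem hm
      rw [h1] at this
      rcases List.mem_append.1 this with h' | h'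
      · exact absurd (hw 1 h').1 (by simp)
      · simp at h'
    · rw [List.getD_eq_default _ _ (by omega)] at h1
      omega

theorem PeriodicFrom.matchAt {L D : ℕ} {w : List ℕ} {c : ℕ → ℕ} (h : PeriodicFrom L D w c)
    (hD : w.length + 2 ≤ D) (hi : L ≤ i) (hm : (i - L) % D = 0) :
    MatchAt c i (1 :: w ++ [0]) := by
  refine matchAt_iff.2 fun k => ?_
  have hk : (k : ℕ) < w.length + 2 := Nat.lt_succ_of_le (by simpa using k.2)
  rw [h _ (by omega), Nat.sub_add_comm hi, Nat.add_mod, hm, zero_add, Nat.mod_mod,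
    Nat.mod_eq_of_lt (by omega), List.getD_eq_getElem _ _ k.2]
  rfl

theorem not_of_periodicFrom (hc₁ : ∀ i, c₁ i < n₁) (hc₂ : ∀ i, c₂ i < n₂)
    (hg₁ : ∀ b < 2, g₁ b = [0]) (hg₂ : ∀ b < 2, g₂ b = e ++ [0])
    (hr₁ : ∀ b, 2 ≤ b → b < n₁ → InRange n₂ (g₁ b)) (hs : InRange n₂ s) {I : List ℕ}
    (hI : InRange n₁ I) (heq : s ++ I.flatMap g₁ = I.flatMap g₂ ++ e) {L D : ℕ}
    (hD₁ : I.length + 2 ≤ D) (hD₂ : (s ++ I.flatMap g₁).length + 2 ≤ D)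
    (hp₁ : PeriodicFrom L D I c₁) (hp₂ : PeriodicFrom L (D + 1) (s ++ I.flatMap g₁) c₂)
    (hT : ∀ t ∈ automaton n₁ n₂ g₁ g₂ s, t.2.2.1 ≠ [] ∧ t.2.2.2 ≠ [])
    (hG : ∀ q i j, G q i j → CanStep (automaton n₁ n₂ g₁ g₂ s) c₁ c₂ G q i j) :
    ¬ G 0 0 0 := by
  intro h0
  have hW : InRange n₂ (s ++ I.flatMap g₁) := hs.append (hI.flatMap hr₁)
  have hG0 := fun i j h => (canStep_zero_iff hc₁ hc₂).1 (hG 0 i j h)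
  have hG1 := fun i j h => (canStep_one_iff hc₁).1 (hG 1 i j h)
  have hG2 := fun i j h => (canStep_two_iff hc₁).1 (hG 2 i j h)
  have dead : ∀ i j, L ≤ i → L ≤ j → (i - L) % D = 0 → (j - L) % (D + 1) = 0 → ¬ G 0 i j := by
    intro i j hi hj hi0 hj0 h
    have h₁ := hp₁.matchAt hD₁ hi hi0
    have h₂ := hp₂.matchAt (by omega) hj hj0
    have h₂' : MatchAt c₂ (j + 1) (s ++ (I.flatMap g₁ ++ [0])) := by simpa using h₂.2
    rw [matchAt_append] at h₂'
    rcases hG0 i j h with ⟨hne, -⟩ | ⟨-, -, h | ⟨-, h⟩ | ⟨w, hw, hm, -⟩⟩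
    · exact hne ⟨h₁.1, h₂.1⟩
    · refine not_of_forall_codeStep hG2 zero_lt_two h₁.2 ?_ h
      rw [hg₂ 0 zero_lt_two, ← List.append_assoc, ← heq]
      exact h₂.2
    · refine not_of_forall_codeStep hG1 zero_lt_two h₁.2 ?_ h
      rw [hg₁ 0 zero_lt_two, ← Nat.add_comm 1, ← Nat.add_assoc]
      exact h₂'.2
    · exact h₂'.1.not_of_mem_errs hw hm
  have aligned : ∀ t i j, L ≤ i → L ≤ j → (i - L + t) % D = 0 → (j - L + t) % (D + 1) = 0 →
      ¬ G 0 i j := by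
    intro t
    induction t with
    | zero => exact dead
    | succ t ih =>
      intro i j hi hj hi0 hj0 h
      rcases hG0 i j h with ⟨-, h⟩ | ⟨h₁, h₂, -⟩
      · refine ih _ _ (by omega) (by omega) ?_ ?_ h
        · rwa [Nat.sub_add_comm hi, Nat.add_assoc, Nat.add_comm 1]
        · rwa [Nat.sub_add_comm hj, Nat.add_assoc, Nat.add_comm 1]
      · exact dead i j hi hj ((hp₁.eq_one_iff hI hi).1 h₁) ((hp₂.eq_one_iff hW hj).1 h₂) h
  have zero : ∀ i j, L ≤ i → L ≤ j → ¬ G 0 i j := by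
    intro i j hi hj
    obtain ⟨t, h₁, h₂⟩ := Nat.chineseRemainder (Nat.coprime_self_add_right.2 (by simp) :
      Nat.Coprime D (D + 1)) ((D - 1) * (i - L)) (D * (j - L))
    obtain ⟨D', rfl⟩ : ∃ D', D = D' + 1 := ⟨D - 1, by omega⟩
    refine aligned t i j hi hj ?_ ?_
    · refine Eq.trans ((h₁.add_left (i - L)).trans (c := 0) ?_) (Nat.zero_mod _)
      rw [Nat.add_sub_cancel, show i - L + D' * (i - L) = (D' + 1) * (i - L) by ring]
      simp [Nat.ModEq]
    · refine Eq.trans ((h₂.add_left (j - L)).trans (c := 0) ?_) (Nat.zero_mod _)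
      rw [show j - L + (D' + 1) * (j - L) = (D' + 1 + 1) * (j - L) by ring]
      simp [Nat.ModEq]
  obtain ⟨q, i, j, hi, hj, h⟩ := exists_le_of_canStep hT h0 hG L
  have hlt : c₁ (i + (L + D * i - i)) < 2 := by
    have hle : i ≤ D * i := Nat.le_mul_of_pos_left i (by omega)
    rw [(hp₁.eq_one_iff hI (by omega)).2]
    · simp
    · rw [show i + (L + D * i - i) - L = D * i by omega]
      simp
  have back : ∃ i' j', i ≤ i' ∧ j ≤ j' ∧ G 0 i' j' := by
    fin_cases q
    · exact ⟨i, j, le_rfl, le_rfl, h⟩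
    · exact exists_zero_of_forall_codeStep hG1 hlt h
    · exact exists_zero_of_forall_codeStep hG2 hlt h
  obtain ⟨i', j', hi', hj', h⟩ := back
  exact zero i' j' (hi.trans hi') (hj.trans hj') h

theorem periodicFrom_prependSeq (x : List (ℕ × ℕ)) (D : ℕ) (w : List ℕ) (y : ℕ → ℕ × ℕ)
    (f : ℕ × ℕ → ℕ) (h : ∀ i, f (y i) = (1 :: w ++ [0]).getD (i % D) 0) :
    PeriodicFrom x.length D w fun i => f (prependSeq x y i) := by
  intro i hi
  simp only [prependSeq, dif_neg (Nat.not_lt.2 hi), h]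

theorem getD_lt {k : ℕ} (hk : 2 ≤ k) {w : List ℕ} (hw : InRange k w) (i : ℕ) :
    (1 :: w ++ [0]).getD i 0 < k := by
  by_cases hi : i < (1 :: w ++ [0]).length
  · rw [List.getD_eq_getElem _ _ hi]
    have := List.getElem_mem hi
    simp only [List.cons_append, List.mem_cons, List.mem_append, List.not_mem_nil, or_false] at this
    rcases this with h | h | h
    · exact h.trans_lt (by omega)
    · exact (hw _ h).2
    · exact h.trans_lt (by omega)
  · rw [List.getD_eq_default _ _ (by omega)]
    omega

theorem hasUniversalPrefix_automaton_iff (hn₁ : 2 ≤ n₁) (hn₂ : 2 ≤ n₂)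
    (hg₁ : ∀ b < 2, g₁ b = [0]) (hg₂ : ∀ b < 2, g₂ b = e ++ [0])
    (hr₁ : ∀ b, 2 ≤ b → b < n₁ → InRange n₂ (g₁ b))
    (hr₂ : ∀ b, 2 ≤ b → b < n₁ → InRange n₂ (g₂ b)) (hs : InRange n₂ s) (he : InRange n₂ e)
    (hT : AutWF n₁ n₂ (automaton n₁ n₂ g₁ g₂ s)) :
    HasUniversalPrefix n₁ n₂ (automaton n₁ n₂ g₁ g₂ s) 0 ↔
      ¬ ∃ I, InRange n₁ I ∧ s ++ I.flatMap g₁ = I.flatMap g₂ ++ e := by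
  constructor
  · rintro ⟨x, hx, h⟩ ⟨I, hI, heq⟩
    have hW : InRange n₂ (s ++ I.flatMap g₁) := hs.append (hI.flatMap hr₁)
    let D := I.length + (s ++ I.flatMap g₁).length + 2
    let y : ℕ → ℕ × ℕ := fun i => ((1 :: I ++ [0]).getD (i % D) 0,
      (1 :: (s ++ I.flatMap g₁) ++ [0]).getD (i % (D + 1)) 0)
    have hy : ∀ i, (y i).1 < n₁ ∧ (y i).2 < n₂ := fun i => ⟨getD_lt hn₁ hI _, getD_lt hn₂ hW _⟩
    have hc : ∀ i, (prependSeq x y i).1 < n₁ ∧ (prependSeq x y i).2 < n₂ := by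
      intro i
      unfold prependSeq
      split_ifs
      · exact hx _ (List.get_mem _ _)
      · exact hy _
    obtain ⟨G, h0, hG⟩ := accepts2_iff.1 (h y hy)
    exact not_of_periodicFrom (fun i => (hc i).1) (fun i => (hc i).2) hg₁ hg₂ hr₁ hs hI heq
      (by omega) (by omega) (periodicFrom_prependSeq x D I y Prod.fst fun i => rfl)
      (periodicFrom_prependSeq x (D + 1) _ y Prod.snd fun i => rfl)
      (fun t ht => ⟨(hT.2.2 t ht).1, (hT.2.2 t ht).2.1⟩) hG h0
  · intro h
    refine ⟨[], by simp, fun y hy => accepts_of_forall_ne hg₁ hg₂ hr₁ hr₂ hs he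
      (fun I hI heq => h ⟨I, hI, heq⟩) fun i => ?_⟩
    simpa [prependSeq] using hy i

end Correctness

section Undecidability

/-- The words pushed by the tiles in `𝒯`, with tile `i` represented by the letter `i + 2`. -/
def pushCode (𝒯 : List (List ℕ × List ℕ)) (b : ℕ) : List ℕ :=
  if b < 2 then [0] else (𝒯.getD (b - 2) ([], [])).1

/-- The words popped by the tiles in `𝒯`, with tile `i` represented by the letter `i + 2`. -/
def popCode (𝒯 : List (List ℕ × List ℕ)) (e : List ℕ) (b : ℕ) : List ℕ :=
  if b < 2 then e ++ [0] else (𝒯.getD (b - 2) ([], [])).2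

theorem flatMap_pushCode {𝒯 : List (List ℕ × List ℕ)} {I : List ℕ} (hI : ∀ b ∈ I, 2 ≤ b) :
    I.flatMap (pushCode 𝒯) = (I.map fun b => 𝒯.getD (b - 2) ([], [])).flatMap Prod.fst := by
  rw [List.flatMap_map]
  exact List.flatMap_congr fun b hb => if_neg (Nat.not_lt.2 (hI b hb))

theorem flatMap_popCode {𝒯 : List (List ℕ × List ℕ)} {e I : List ℕ} (hI : ∀ b ∈ I, 2 ≤ b) :
    I.flatMap (popCode 𝒯 e) = (I.map fun b => 𝒯.getD (b - 2) ([], [])).flatMap Prod.snd := by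
  rw [List.flatMap_map]
  exact List.flatMap_congr fun b hb => if_neg (Nat.not_lt.2 (hI b hb))

theorem getD_mem {𝒯 : List (List ℕ × List ℕ)} {b : ℕ} (h2 : 2 ≤ b) (hb : b < 𝒯.length + 2) :
    𝒯.getD (b - 2) ([], []) ∈ 𝒯 := by
  rw [List.getD_eq_getElem _ _ (by omega)]
  exact List.getElem_mem _

theorem solvable_iff_exists_code {𝒯 : List (List ℕ × List ℕ)} {s e : List ℕ} :
    Solvable {t | t ∈ 𝒯} s e ↔ ∃ I, InRange (𝒯.length + 2) I ∧
      s ++ I.flatMap (pushCode 𝒯) = I.flatMap (popCode 𝒯 e) ++ e := by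
  constructor
  · rintro ⟨J, hJ, h⟩
    have hidx {t} (ht : t ∈ J) : 𝒯.idxOf t < 𝒯.length := List.idxOf_lt_length_iff.2 (hJ t ht)
    have hI : InRange (𝒯.length + 2) (J.map fun t => 𝒯.idxOf t + 2) := by
      intro b hb
      obtain ⟨t, ht, rfl⟩ := List.mem_map.1 hb
      have := hidx ht
      omega
    have hmap : ((J.map fun t => 𝒯.idxOf t + 2).map fun b => 𝒯.getD (b - 2) ([], [])) = J := by
      rw [List.map_map]
      refine (List.map_congr_left fun t ht => ?_).trans (List.map_id J)
      simp [List.getElem?_eq_getElem (hidx ht)]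
    refine ⟨_, hI, ?_⟩
    rwa [flatMap_pushCode fun b hb => (hI b hb).1, flatMap_popCode fun b hb => (hI b hb).1, hmap]
  · rintro ⟨I, hI, h⟩
    rw [flatMap_pushCode fun b hb => (hI b hb).1, flatMap_popCode fun b hb => (hI b hb).1] at h
    refine ⟨_, fun t ht => ?_, h⟩
    obtain ⟨b, hb, rfl⟩ := List.mem_map.1 ht
    exact getD_mem (hI b hb).1 (hI b hb).2

theorem primrec_errs (n : ℕ) : Primrec (errs n) := by
  have hsingle : Primrec fun a : ℕ =>
      (List.range n).flatMap fun c => if c = a then [] else [[c]] := by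
    refine Primrec.list_flatMap (Primrec.const _) ?_
    exact Primrec.ite (Primrec.eq.comp Primrec.snd Primrec.fst) (Primrec.const _)
      (Primrec.list_cons.comp (Primrec.list_cons.comp Primrec.snd (Primrec.const _))
        (Primrec.const _))
  have hcons : Primrec fun x : List ℕ × ℕ × List (List ℕ) => x.2.2.map (x.2.1 :: ·) :=
    Primrec.list_map (Primrec.snd.comp Primrec.snd)
      (Primrec.list_cons.comp (Primrec.fst.comp (Primrec.snd.comp Primrec.fst)) Primrec.snd)
  have hstep : Primrec₂ fun (_ : List ℕ) (x : ℕ × List (List ℕ)) =>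
      ((List.range n).flatMap fun c => if c = x.1 then [] else [[c]]) ++ x.2.map (x.1 :: ·) :=
    Primrec.list_append.comp (hsingle.comp (Primrec.fst.comp Primrec.snd)) hcons
  exact Primrec.list_foldr Primrec.id (Primrec.const []) hstep

theorem primrec_automaton (n₁ n₂ : ℕ) (g₁ g₂ : ℕ → List ℕ) :
    Primrec (automaton n₁ n₂ g₁ g₂) := by
  have htrans (q : Fin 3) : Primrec fun w : List ℕ => ((0, q, [1], 1 :: w) : Trans2) :=
    (Primrec.const _).pair ((Primrec.const _).pair ((Primrec.const _).pair
      (Primrec.list_cons.comp (Primrec.const _) Primrec.id)))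
  exact Primrec.list_append.comp (Primrec.const _) (Primrec.list_cons.comp (htrans 1)
    (Primrec.list_map (primrec_errs n₂) ((htrans 0).comp Primrec.snd)))

theorem primrec_word (u v : List ℕ) (b : ℕ) :
    Primrec fun m => u ++ List.replicate m b ++ v := by
  have h : Primrec fun m => (List.range m).map fun _ => b :=
    Primrec.list_map Primrec.list_range (Primrec.const b).to₂
  refine Primrec.list_append.comp (Primrec.list_append.comp (Primrec.const u)
    (h.of_eq fun m => ?_)) (Primrec.const v)
  simp

end Undecidability

end UniversalPrefix

/-- It is undecidable whether a given state of a given 2-tape automaton with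
3 states admits a universal prefix. -/
theorem undecidable_universal_prefix :
    ¬ ∃ f : ℕ × ℕ × List Trans2 × Fin 3 → Bool, Computable f ∧
      ∀ inst : ℕ × ℕ × List Trans2 × Fin 3, AutWF inst.1 inst.2.1 inst.2.2.1 →
        (f inst = true ↔ HasUniversalPrefix inst.1 inst.2.1 inst.2.2.1 inst.2.2.2) := by
  rintro ⟨f, hf, hspec⟩
  obtain ⟨k, 𝒯, u, v, e, b, h𝒯, hs, he, h⟩ := UniversalPrefix.exists_solvable_not_computable
  let g₁ := UniversalPrefix.pushCode 𝒯
  let g₂ := UniversalPrefix.popCode 𝒯 e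
  let inst : ℕ → ℕ × ℕ × List Trans2 × Fin 3 := fun m =>
    (𝒯.length + 2, k + 2,
      UniversalPrefix.automaton (𝒯.length + 2) (k + 2) g₁ g₂ (u ++ List.replicate m b ++ v), 0)
  have hmono {w : List ℕ} (hw : UniversalPrefix.InRange k w) : UniversalPrefix.InRange (k + 2) w :=
    fun a ha => ⟨(hw a ha).1, by have := (hw a ha).2; omega⟩
  have hinst : Computable inst := ((Primrec.const _).pair ((Primrec.const _).pair
    (((UniversalPrefix.primrec_automaton _ _ g₁ g₂).comp
      (UniversalPrefix.primrec_word u v b)).pair (Primrec.const _)))).to_comp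
  have hlow₁ : ∀ b < 2, g₁ b = [0] := fun b hb => if_pos hb
  have hlow₂ : ∀ b < 2, g₂ b = e ++ [0] := fun b hb => if_pos hb
  have hhigh₁ : ∀ b, 2 ≤ b → g₁ b = (𝒯.getD (b - 2) ([], [])).1 :=
    fun b hb => if_neg (Nat.not_lt.2 hb)
  have hhigh₂ : ∀ b, 2 ≤ b → g₂ b = (𝒯.getD (b - 2) ([], [])).2 :=
    fun b hb => if_neg (Nat.not_lt.2 hb)
  have hr₁ : ∀ b, 2 ≤ b → b < 𝒯.length + 2 → UniversalPrefix.InRange (k + 2) (g₁ b) :=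
    fun b h2 hb => hhigh₁ b h2 ▸ hmono (h𝒯 _ (UniversalPrefix.getD_mem h2 hb)).2.2.1
  have hr₂ : ∀ b, 2 ≤ b → b < 𝒯.length + 2 → UniversalPrefix.InRange (k + 2) (g₂ b) :=
    fun b h2 hb => hhigh₂ b h2 ▸ hmono (h𝒯 _ (UniversalPrefix.getD_mem h2 hb)).2.2.2
  have hwf (m : ℕ) : AutWF (𝒯.length + 2) (k + 2) (inst m).2.2.1 := by
    refine UniversalPrefix.autWF_automaton (by omega) (by omega) (fun b hb => ?_) (fun b hb => ?_)
      fun a ha => (hmono (hs m) a ha).2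
    · rcases Nat.lt_or_ge b 2 with h2 | h2
      · simp [hlow₁ b h2]
      · refine ⟨?_, fun a ha => (hr₁ b h2 hb a ha).2⟩
        rw [hhigh₁ b h2]
        exact (h𝒯 _ (UniversalPrefix.getD_mem h2 hb)).1
    · rcases Nat.lt_or_ge b 2 with h2 | h2
      · rw [hlow₂ b h2]
        refine ⟨by simp, fun a ha => ?_⟩
        rcases List.mem_append.1 ha with ha | ha
        · exact (hmono he a ha).2
        · obtain rfl : a = 0 := by simpa using ha
          omega
      · refine ⟨?_, fun a ha => (hr₂ b h2 hb a ha).2⟩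
        rw [hhigh₂ b h2]
        exact (h𝒯 _ (UniversalPrefix.getD_mem h2 hb)).2.1
  have key (m : ℕ) : (!f (inst m)) = true ↔
      UniversalPrefix.Solvable {t | t ∈ 𝒯} (u ++ List.replicate m b ++ v) e := by
    rw [Bool.not_eq_true', ← Bool.not_eq_true, hspec (inst m) (hwf m),
      UniversalPrefix.solvable_iff_exists_code, ← not_not (a := ∃ I, _)]
    exact not_congr (UniversalPrefix.hasUniversalPrefix_automaton_iff (Nat.le_add_left 2 _)
      (Nat.le_add_left 2 _) hlow₁ hlow₂ hr₁ hr₂ (hmono (hs m)) (hmono he) (hwf m))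
  refine h (ComputablePred.of_eq (p := fun m => (!f (inst m)) = true) ⟨inferInstance, ?_⟩ key)
  simpa using Primrec.not.to_comp.comp (hf.comp hinst)
end

section
/- The prefix Post correspondence problem is undecidable: there is no algorithm (no total computable function, for any fixed effective encoding of instances by natural numbers) that, given a finite list of pairs of nonempty words (u₁,v₁),…,(u_n,v_n) over a finite alphabet, decides whether this instance admits a prefix-PCP solution. -/
/-- A prefix-PCP solution of the instance `L = [(u₁,v₁),…,(u_n,v_n)]`: two nonempty
index words `s`, `t` (one a prefix of the other) with
`u_{s₁} ⋯ u_{s_m} = v_{t₁} ⋯ v_{t_{m'}}`. -/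
def PrefixPCPSolvable {β : Type*} (L : List (List β × List β)) : Prop :=
  ∃ s t : List (Fin L.length), s ≠ [] ∧ t ≠ [] ∧ (s <+: t ∨ t <+: s) ∧
    (s.map fun i => (L.get i).1).flatten = (t.map fun i => (L.get i).2).flatten

open Relation

section Rewriting

variable {α : Type*}

/-- One step of the string rewriting system with rule set `R`. -/
def RewriteStep (R : Set (List α × List α)) (x y : List α) : Prop :=
  ∃ a b, ∃ p ∈ R, x = a ++ p.1 ++ b ∧ y = a ++ p.2 ++ b

theorem RewriteStep.of_rule {R : Set (List α × List α)} {l r : List α} (h : (l, r) ∈ R)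
    (a b : List α) : RewriteStep R (a ++ l ++ b) (a ++ r ++ b) :=
  ⟨a, b, _, h, rfl, rfl⟩

/-- Prefix-PCP solvability in terms of lists of tiles rather than lists of indices. -/
theorem prefixPCPSolvable_iff_tiles {L : List (List α × List α)} :
    PrefixPCPSolvable L ↔ ∃ s t : List (List α × List α), (∀ p ∈ s, p ∈ L) ∧ (∀ p ∈ t, p ∈ L) ∧
      s ≠ [] ∧ t ≠ [] ∧ (s <+: t ∨ t <+: s) ∧ s.flatMap Prod.fst = t.flatMap Prod.snd := by
  constructor
  · rintro ⟨s, t, hs, ht, hst, h⟩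
    refine ⟨s.map L.get, t.map L.get, by simp, by simp, by simpa, by simpa,
      hst.imp (·.map _) (·.map _), ?_⟩
    simpa [List.flatMap, Function.comp_def] using h
  · rintro ⟨s, t, hs, ht, hs0, ht0, hst, h⟩
    have lift : ∀ w : List (List α × List α), (∀ p ∈ w, p ∈ L) →
        ∃ w' : List (Fin L.length), w'.map L.get = w := by
      intro w hw
      induction w with
      | nil => exact ⟨[], rfl⟩
      | cons p w ih =>
        obtain ⟨w', rfl⟩ := ih fun q hq => hw q (by simp [hq])
        obtain ⟨i, hi⟩ := List.mem_iff_get.1 (hw p (by simp))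
        exact ⟨i :: w', by simp [← hi]⟩
    rcases hst with ⟨r, rfl⟩ | ⟨r, rfl⟩
    · obtain ⟨s', rfl⟩ := lift s hs
      obtain ⟨r', rfl⟩ := lift r fun p hp => ht p (by simp [hp])
      refine ⟨s', s' ++ r', by simpa using hs0, by simp_all, .inl ⟨r', rfl⟩, ?_⟩
      simpa [List.flatMap, Function.comp_def] using h
    · obtain ⟨t', rfl⟩ := lift t ht
      obtain ⟨r', rfl⟩ := lift r fun p hp => hs p (by simp [hp])
      refine ⟨t' ++ r', t', by simp_all, by simpa using ht0, .inr ⟨r', rfl⟩, ?_⟩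
      simpa [List.flatMap, Function.comp_def] using h

/-- Put the separator `0` before every letter. -/
def padBefore (x : List ℕ) : List ℕ := x.flatMap fun a => [0, a]

/-- Put the separator `0` after every letter. -/
def padAfter (x : List ℕ) : List ℕ := x.flatMap fun a => [a, 0]

@[simp] theorem padBefore_nil : padBefore [] = [] := rfl

@[simp] theorem padBefore_cons (a : ℕ) (x : List ℕ) :
    padBefore (a :: x) = 0 :: a :: padBefore x := rfl

@[simp] theorem padBefore_append (x y : List ℕ) :
    padBefore (x ++ y) = padBefore x ++ padBefore y := by
  simp [padBefore]

@[simp] theorem padAfter_nil : padAfter [] = [] := rfl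

@[simp] theorem padAfter_cons (a : ℕ) (x : List ℕ) :
    padAfter (a :: x) = a :: 0 :: padAfter x := rfl

@[simp] theorem padAfter_append (x y : List ℕ) :
    padAfter (x ++ y) = padAfter x ++ padAfter y := by
  simp [padAfter]

theorem cons_padAfter (x y : List ℕ) : 0 :: (padAfter x ++ y) = padBefore x ++ 0 :: y := by
  induction x with
  | nil => rfl
  | cons a x ih => simp [ih]

theorem even_length_padBefore (x : List ℕ) : Even (padBefore x).length := by
  simp [padBefore, List.length_flatMap]

/-- The code of a letter; the codes `0`, `1`, `2`, `3` are reserved for the separator, the start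
marker, the word delimiter and the end marker. -/
def encodeWord (e : α → ℕ) (x : List α) : List ℕ := x.map fun a => e a + 4

@[simp] theorem encodeWord_nil (e : α → ℕ) : encodeWord e [] = [] := rfl

@[simp] theorem encodeWord_cons (e : α → ℕ) (a : α) (x : List α) :
    encodeWord e (a :: x) = (e a + 4) :: encodeWord e x := rfl

@[simp] theorem encodeWord_append (e : α → ℕ) (x y : List α) :
    encodeWord e (x ++ y) = encodeWord e x ++ encodeWord e y := by
  simp [encodeWord]

/-- The tile that starts the derivation at the word `w`. -/
def startTile (e : α → ℕ) (w : List α) : List ℕ × List ℕ :=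
  ([0, 1], 0 :: 1 :: 0 :: padAfter (encodeWord e w ++ [2]))

/-- The tile that ends the derivation at the one-letter word `[f]`. -/
def endTile (e : α → ℕ) (f : α) : List ℕ × List ℕ :=
  (padBefore [e f + 4, 2, 3], [3])

/-- The tile matching `x` against `y`. -/
def matchTile (x y : List ℕ) : List ℕ × List ℕ :=
  (padBefore x, padAfter y)

/-- The tiles that do not depend on the starting word. -/
noncomputable def commonTiles [Fintype α] (e : α → ℕ) (R : List (List α × List α)) (f : α) :
    List (List ℕ × List ℕ) :=
  endTile e f :: matchTile [2] [2] ::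
    ((Finset.univ.toList.map fun a => matchTile [e a + 4] [e a + 4]) ++
      R.map fun p => matchTile (encodeWord e p.1) (encodeWord e p.2))

theorem forall_mem_commonTiles [Fintype α] {e : α → ℕ} {R : List (List α × List α)} {f : α}
    {P : List ℕ × List ℕ → Prop} :
    (∀ p ∈ commonTiles e R f, P p) ↔ P (endTile e f) ∧ P (matchTile [2] [2]) ∧
      (∀ a, P (matchTile [e a + 4] [e a + 4])) ∧
      ∀ p ∈ R, P (matchTile (encodeWord e p.1) (encodeWord e p.2)) := by
  simp only [commonTiles, List.mem_cons, List.mem_append, List.mem_map, Finset.mem_toList,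
    Finset.mem_univ, true_and]
  constructor
  · intro h
    exact ⟨h _ (.inl rfl), h _ (.inr (.inl rfl)), fun a => h _ (.inr (.inr (.inl ⟨a, rfl⟩))),
      fun p hp => h _ (.inr (.inr (.inr ⟨p, hp, rfl⟩)))⟩
  · rintro ⟨h1, h2, h3, h4⟩ p (rfl | rfl | ⟨a, rfl⟩ | ⟨q, hq, rfl⟩)
    exacts [h1, h2, h3 a, h4 q hq]

/-- If the starting word derives `[f]`, the tiles have an ordinary PCP solution. -/
theorem exists_tiles_of_derives [Fintype α] {e : α → ℕ} {R : List (List α × List α)} {f : α}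
    {x : List α} (h : ReflTransGen (RewriteStep {p | p ∈ R}) x [f]) :
    ∃ s : List (List ℕ × List ℕ), (∀ p ∈ s, p ∈ commonTiles e R f) ∧
      s.flatMap Prod.fst = padBefore (encodeWord e x ++ [2]) ++ 0 :: s.flatMap Prod.snd := by
  obtain ⟨m1, m2, m3, m4⟩ := forall_mem_commonTiles.1 fun p (hp : p ∈ commonTiles e R f) => hp
  have copies : ∀ y : List α, ∃ s : List (List ℕ × List ℕ), (∀ p ∈ s, p ∈ commonTiles e R f) ∧
      s.flatMap Prod.fst = padBefore (encodeWord e y) ∧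
      s.flatMap Prod.snd = padAfter (encodeWord e y) := by
    intro y
    refine ⟨y.map fun a => matchTile [e a + 4] [e a + 4], by simpa using fun a _ => m3 a, ?_, ?_⟩
    all_goals induction y with
      | nil => rfl
      | cons a y ih => simp_all [matchTile]
  induction h using ReflTransGen.head_induction_on with
  | refl => exact ⟨[endTile e f], by simpa using m1, by simp [endTile]⟩
  | head hstep _ ih =>
    obtain ⟨a, b, p, hp, rfl, rfl⟩ := hstep
    obtain ⟨s, hs, h⟩ := ih
    obtain ⟨sa, hsa, ha1, ha2⟩ := copies a
    obtain ⟨sb, hsb, hb1, hb2⟩ := copies b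
    refine ⟨sa ++ matchTile (encodeWord e p.1) (encodeWord e p.2) :: sb ++ matchTile [2] [2] :: s,
      ?_, ?_⟩
    · simp only [List.mem_append, List.mem_cons]
      rintro q ((h | rfl | h) | rfl | h)
      exacts [hsa _ h, m4 _ hp, hsb _ h, m2, hs _ h]
    · have := cons_padAfter (encodeWord e (a ++ p.2 ++ b) ++ [2]) (s.flatMap Prod.snd)
      rw [← this] at h
      simp [ha1, ha2, hb1, hb2, h, matchTile]

/-- Reading a word off the pending part of the overhang. -/
theorem eq_append_of_padBefore_eq {e : α → ℕ} (he : Function.Injective e) {l a : List α}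
    {b X Y : List ℕ}
    (h : padBefore (encodeWord e l) ++ X = padBefore (encodeWord e a ++ 2 :: b) ++ 0 :: Y) :
    ∃ a', a = l ++ a' ∧ X = padBefore (encodeWord e a' ++ 2 :: b) ++ 0 :: Y := by
  induction l generalizing a with
  | nil => exact ⟨a, rfl, h⟩
  | cons c l ih =>
    cases a with
    | nil => simp at h
    | cons c' a =>
      simp only [encodeWord_cons, padBefore_cons, List.cons_append, List.cons.injEq, true_and,
        Nat.add_right_cancel_iff] at h
      obtain ⟨hc, h⟩ := h
      obtain ⟨a', rfl, h'⟩ := ih h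
      exact ⟨a', by simp [he hc], h'⟩

theorem derives_of_overhang [Fintype α] {e : α → ℕ} (he : Function.Injective e)
    {R : List (List α × List α)} {f : α} {w : List α} {s t : List (List ℕ × List ℕ)}
    (hs : ∀ p ∈ s, p ∈ startTile e w :: commonTiles e R f)
    (ht : ∀ p ∈ t, p ∈ startTile e w :: commonTiles e R f)
    (hst : s <+: t ∨ t <+: s) {a b : List α}
    (hw : ReflTransGen (RewriteStep {p | p ∈ R}) w (b ++ a))
    (h : s.flatMap Prod.fst =
      padBefore (encodeWord e a ++ 2 :: encodeWord e b) ++ 0 :: t.flatMap Prod.snd) :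
    ReflTransGen (RewriteStep {p | p ∈ R}) w [f] := by
  induction s generalizing t a b with
  | nil => simp at h
  | cons p s ih =>
    cases t with
    | nil =>
      exfalso
      have key : ∀ q ∈ startTile e w :: commonTiles e R f, Even q.1.length := by
        simp only [List.forall_mem_cons, forall_mem_commonTiles]
        exact ⟨even_length_padBefore [1], even_length_padBefore _, even_length_padBefore _,
          fun _ => even_length_padBefore _, fun _ _ => even_length_padBefore _⟩
      have even : ∀ s' : List (List ℕ × List ℕ),
          (∀ q ∈ s', q ∈ startTile e w :: commonTiles e R f) →
          Even (s'.flatMap Prod.fst).length := by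
        intro s' hs'
        induction s' with
        | nil => simp
        | cons q s' ih =>
          simp only [List.flatMap_cons, List.length_append]
          exact (key q (hs' q (by simp))).add (ih fun r hr => hs' r (by simp [hr]))
      have := even _ hs
      rw [h, List.flatMap_nil, List.length_append, List.length_singleton, Nat.even_add_one] at this
      exact this (even_length_padBefore _)
    | cons p' t =>
      have hpp : p' = p := by
        rcases hst with h | h
        · exact (List.cons_prefix_cons.1 h).1.symm
        · exact (List.cons_prefix_cons.1 h).1
      subst hpp
      have hst' : s <+: t ∨ t <+: s := by simpa [List.cons_prefix_cons] using hst
      have hs' := fun q hq => hs q (List.mem_cons_of_mem _ hq)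
      have ht' := fun q hq => ht q (List.mem_cons_of_mem _ hq)
      have hp := hs p' (by simp)
      simp only [List.flatMap_cons] at h
      have key : ∀ q ∈ startTile e w :: commonTiles e R f,
          q.1 ++ s.flatMap Prod.fst = padBefore (encodeWord e a ++ 2 :: encodeWord e b) ++
            0 :: (q.2 ++ t.flatMap Prod.snd) →
          ReflTransGen (RewriteStep {p | p ∈ R}) w [f] := by
        simp only [List.forall_mem_cons, forall_mem_commonTiles]
        refine ⟨fun h => ?_, fun h => ?_, fun h => ?_, fun c h => ?_, fun q hq h => ?_⟩
        · cases a <;> simp [startTile] at h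
        · obtain ⟨a', rfl, hX⟩ := eq_append_of_padBefore_eq he
            (l := [f]) (X := padBefore [2, 3] ++ s.flatMap Prod.fst) (by simpa [endTile] using h)
          cases a' with
          | cons => simp at hX
          | nil =>
            cases b with
            | cons => simp at hX
            | nil => simpa using hw
        · cases a with
          | cons => simp [matchTile] at h
          | nil =>
            refine ih hs' ht' hst' (a := b) (b := []) (by simpa using hw) ?_
            simpa [matchTile] using h
        · obtain ⟨a', rfl, h⟩ := eq_append_of_padBefore_eq he
            (l := [c]) (X := s.flatMap Prod.fst) (by simpa [matchTile] using h)
          refine ih hs' ht' hst' (a := a') (b := b ++ [c]) (by simpa using hw) ?_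
          simpa [matchTile] using h
        · obtain ⟨a', rfl, h⟩ := eq_append_of_padBefore_eq he h
          refine ih hs' ht' hst' (a := a') (b := b ++ q.2) (hw.tail ?_) ?_
          · simpa using RewriteStep.of_rule (R := {p | p ∈ R}) hq b a'
          · simpa [matchTile, cons_padAfter] using h
      exact key p' hp h

/-- Derivability of `[f]` from `w` is the solvability of a prefix-PCP instance. -/
theorem prefixPCPSolvable_tiles_iff [Fintype α] {e : α → ℕ} (he : Function.Injective e)
    {R : List (List α × List α)} {f : α} {w : List α} (hR : ∀ p ∈ R, p.1 ≠ [] ∧ p.2 ≠ []) :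
    PrefixPCPSolvable (startTile e w :: commonTiles e R f) ↔
      ReflTransGen (RewriteStep {p | p ∈ R}) w [f] := by
  rw [prefixPCPSolvable_iff_tiles]
  constructor
  · rintro ⟨s, t, hs, ht, hs0, ht0, hst, h⟩
    obtain ⟨p, s, rfl⟩ := List.exists_cons_of_ne_nil hs0
    obtain ⟨p', t, rfl⟩ := List.exists_cons_of_ne_nil ht0
    have hpp : p' = p := by
      rcases hst with h | h
      · exact (List.cons_prefix_cons.1 h).1.symm
      · exact (List.cons_prefix_cons.1 h).1
    subst hpp
    have hst' : s <+: t ∨ t <+: s := by simpa [List.cons_prefix_cons] using hst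
    refine derives_of_overhang he (fun q hq => hs q (List.mem_cons_of_mem _ hq))
      (fun q hq => ht q (List.mem_cons_of_mem _ hq)) hst' (a := w) (b := []) .refl ?_
    have key : ∀ q ∈ startTile e w :: commonTiles e R f,
        q.1 ++ s.flatMap Prod.fst = q.2 ++ t.flatMap Prod.snd →
        s.flatMap Prod.fst =
          padBefore (encodeWord e w ++ 2 :: encodeWord e []) ++ 0 :: t.flatMap Prod.snd := by
      simp only [List.forall_mem_cons, forall_mem_commonTiles]
      refine ⟨fun h => ?_, fun h => ?_, fun h => ?_, fun c h => ?_, fun q hq h => ?_⟩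
      · simpa [startTile, cons_padAfter] using h
      · simp [endTile] at h
      · simp [matchTile] at h
      · simp [matchTile] at h
      · obtain ⟨⟨c, l, hl⟩, d, r, hr⟩ := (hR q hq).imp List.exists_cons_of_ne_nil
          List.exists_cons_of_ne_nil
        simp [matchTile, hl, hr] at h
    exact key p' (hs p' (by simp)) (by simpa using h)
  · intro h
    obtain ⟨s, hs, h⟩ := exists_tiles_of_derives (e := e) h
    refine ⟨startTile e w :: s, startTile e w :: s, ?_, ?_, by simp, by simp, .inl ⟨[], by simp⟩,
      ?_⟩
    · simpa using fun a b h' => .inr (hs _ h')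
    · simpa using fun a b h' => .inr (hs _ h')
    · simp [h, startTile, cons_padAfter]

end Rewriting

section TuringMachine

open Turing StateTransition

variable {Γ Λ : Type*}

/-- Letters of the words describing Turing machine configurations. -/
inductive TapeLetter (Γ Λ : Type*)
  | symbol (a : Γ)
  | state (q : Λ)
  | leftEnd
  | rightEnd
  | halted

namespace TapeLetter

instance [Finite Γ] [Finite Λ] : Finite (TapeLetter Γ Λ) := by
  let code : TapeLetter Γ Λ → (Γ ⊕ Λ) ⊕ Fin 3
    | symbol a => .inl (.inl a)
    | state q => .inl (.inr q)
    | leftEnd => .inr 0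
    | rightEnd => .inr 1
    | halted => .inr 2
  refine Finite.of_injective code fun x y h => ?_
  cases x <;> cases y <;> simp_all [code]

end TapeLetter

open TapeLetter

/-- The word describing a configuration: `L` is the part of the tape to the left of the head, in
reverse order, and `R` is the rest of the tape, starting with the scanned symbol. -/
def configWord (L : List Γ) (q : Λ) (R : List Γ) : List (TapeLetter Γ Λ) :=
  leftEnd :: L.reverse.map symbol ++ state q :: (R.map symbol ++ [rightEnd])

theorem List.append_cons_inj_of_unique {α : Type*} {P : α → Prop} {x y x' y' : List α} {c c' : α}
    (hc : P c) (hc' : P c') (hx' : ∀ a ∈ x', ¬ P a) (hy' : ∀ a ∈ y', ¬ P a)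
    (h : x ++ c :: y = x' ++ c' :: y') : x = x' ∧ c = c' ∧ y = y' := by
  induction x generalizing x' with
  | nil =>
    cases x' with
    | nil => simpa using h
    | cons a x' =>
      obtain rfl : c = a := by simpa using congrArg List.head? h
      exact absurd hc (hx' c (by simp))
  | cons a x ih =>
    cases x' with
    | nil =>
      obtain ⟨rfl, rfl⟩ : a = c' ∧ x ++ c :: y = y' := by simpa using h
      exact absurd hc (hy' c (by simp))
    | cons a' x' =>
      obtain ⟨rfl, hxy⟩ : a = a' ∧ x ++ c :: y = x' ++ c' :: y' := by simpa using h
      obtain ⟨rfl, hcy⟩ := ih (fun b hb => hx' b (List.mem_cons_of_mem _ hb)) hxy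
      exact ⟨rfl, hcy⟩

theorem eq_of_append_state_eq_configWord {x y : List (TapeLetter Γ Λ)} {q q' : Λ} {L R : List Γ}
    (h : x ++ state q' :: y = configWord L q R) :
    x = leftEnd :: L.reverse.map symbol ∧ q' = q ∧ y = R.map symbol ++ [rightEnd] := by
  have := List.append_cons_inj_of_unique (P := fun c => ∃ q : Λ, c = state q) ⟨_, rfl⟩ ⟨_, rfl⟩
    (by simp) (by rintro _ h ⟨_, rfl⟩; simp at h) h
  simpa using this

variable [Inhabited Γ] [Inhabited Λ]

/-- The rewriting rules simulating a Turing machine. The state letter stands just before the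
scanned symbol, the tape may be extended by blanks at any time, and once the machine has halted the
letter `halted` erases everything else. -/
inductive TapeRule (M : TM0.Machine Γ Λ) : List (TapeLetter Γ Λ) × List (TapeLetter Γ Λ) → Prop
  | extendLeft : TapeRule M ([leftEnd], [leftEnd, symbol default])
  | extendRight : TapeRule M ([rightEnd], [symbol default, rightEnd])
  | write {q a q' b} : M q a = some (q', .write b) →
      TapeRule M ([state q, symbol a], [state q', symbol b])
  | moveRight {q a q'} : M q a = some (q', .move .right) →
      TapeRule M ([state q, symbol a], [symbol a, state q'])
  | moveLeft {q a q'} (b) : M q a = some (q', .move .left) →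
      TapeRule M ([symbol b, state q, symbol a], [state q', symbol b, symbol a])
  | halt {q a} : M q a = none → TapeRule M ([state q, symbol a], [halted])
  | eraseLeft (x) : TapeRule M ([x, halted], [halted])
  | eraseRight (x) : TapeRule M ([halted, x], [halted])

theorem TapeRule.ne_nil {M : TM0.Machine Γ Λ} {p} (h : TapeRule M p) : p.1 ≠ [] ∧ p.2 ≠ [] := by
  cases h <;> simp

theorem finite_setOf_tapeRule [Finite Γ] [Finite Λ] (M : TM0.Machine Γ Λ) :
    {p | TapeRule M p}.Finite := by
  refine ((List.finite_length_le (TapeLetter Γ Λ) 3).prod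
    (List.finite_length_le (TapeLetter Γ Λ) 3)).subset ?_
  rintro _ (_ | _) <;> simp

/-- The word `x` can be rewritten to the word `y`. -/
abbrev TapeDerives (M : TM0.Machine Γ Λ) : List (TapeLetter Γ Λ) → List (TapeLetter Γ Λ) → Prop :=
  ReflTransGen (RewriteStep {p | TapeRule M p})

theorem TapeRule.derives {M : TM0.Machine Γ Λ} {l r} (h : TapeRule M (l, r)) (x y) :
    TapeDerives M (x ++ l ++ y) (x ++ r ++ y) :=
  .single (RewriteStep.of_rule h x y)

theorem tapeDerives_halted (M : TM0.Machine Γ Λ) (x y : List (TapeLetter Γ Λ)) :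
    TapeDerives M (x ++ halted :: y) [halted] := by
  induction y with
  | nil =>
    induction x using List.reverseRecOn with
    | nil => exact .refl
    | append_singleton x a ih =>
      exact .trans (by simpa using (TapeRule.eraseLeft (M := M) a).derives x []) ih
  | cons a y ih => exact .trans (by simpa using (TapeRule.eraseRight (M := M) a).derives x y) ih

theorem Turing.ListBlank.mk_append_default (l : List Γ) :
    ListBlank.mk (l ++ [default]) = ListBlank.mk l :=
  (Quotient.sound' (Or.inl ⟨1, by simp⟩)).symm

theorem Turing.Tape.mk₂_append_default_left (L R : List Γ) :
    Tape.mk₂ (L ++ [default]) R = Tape.mk₂ L R := by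
  simp [Tape.mk₂, ListBlank.mk_append_default]

theorem Turing.Tape.mk₂_append_default_right (L R : List Γ) :
    Tape.mk₂ L (R ++ [default]) = Tape.mk₂ L R := by
  simp [Tape.mk₂, ListBlank.mk_append_default]

theorem tapeDerives_extendRight (M : TM0.Machine Γ Λ) (L : List Γ) (q : Λ) (R : List Γ) :
    TapeDerives M (configWord L q R) (configWord L q (R ++ [default])) := by
  convert (TapeRule.extendRight (M := M)).derives
    (leftEnd :: L.reverse.map symbol ++ state q :: R.map symbol) [] using 1 <;> simp [configWord]

theorem tapeDerives_extendLeft (M : TM0.Machine Γ Λ) (L : List Γ) (q : Λ) (R : List Γ) :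
    TapeDerives M (configWord L q R) (configWord (L ++ [default]) q R) := by
  simpa [configWord] using (TapeRule.extendLeft (M := M)).derives []
    (L.reverse.map symbol ++ state q :: (R.map symbol ++ [rightEnd]))

@[simp] theorem Turing.Tape.mk₂_cons_head (L R : List Γ) (a : Γ) :
    (Tape.mk₂ L (a :: R)).head = a := rfl

theorem Turing.Tape.write_mk₂ (L R : List Γ) (a b : Γ) :
    (Tape.mk₂ L (a :: R)).write b = Tape.mk₂ L (b :: R) := rfl

theorem Turing.Tape.move_right_mk₂ (L R : List Γ) (a : Γ) :
    (Tape.mk₂ L (a :: R)).move .right = Tape.mk₂ (a :: L) R := by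
  simp [Tape.mk₂]

theorem Turing.Tape.move_left_mk₂ (L R : List Γ) (a : Γ) :
    (Tape.mk₂ (a :: L) R).move .left = Tape.mk₂ L (a :: R) := by
  simp [Tape.mk₂]

theorem tapeDerives_of_reaches {M : TM0.Machine Γ Λ} {L R : List Γ} {q : Λ} {c : TM0.Cfg Γ Λ}
    (h : Reaches (TM0.step M) ⟨q, Tape.mk₂ L R⟩ c) (hc : TM0.step M c = none) :
    TapeDerives M (configWord L q R) [halted] := by
  generalize hd : (⟨q, Tape.mk₂ L R⟩ : TM0.Cfg Γ Λ) = d at h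
  induction h using ReflTransGen.head_induction_on generalizing L q R with
  | refl =>
    subst hd
    wlog hR : ∃ a R', R = a :: R' generalizing R
    · obtain rfl : R = [] := by cases R <;> simp_all
      exact (tapeDerives_extendRight M L q []).trans
        (this (R := [] ++ [default]) (by rwa [Tape.mk₂_append_default_right]) ⟨_, _, rfl⟩)
    obtain ⟨a, R, rfl⟩ := hR
    have hM : M q a = none := by simpa [TM0.step] using hc
    refine .trans ?_ (tapeDerives_halted M (leftEnd :: L.reverse.map symbol)
      (R.map symbol ++ [rightEnd]))
    simpa [configWord] using (TapeRule.halt hM).derives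
      (leftEnd :: L.reverse.map symbol) (R.map symbol ++ [rightEnd])
  | @head c₁ c₂ hstep _ ih =>
    subst hd
    wlog hR : ∃ a R', R = a :: R' generalizing R
    · obtain rfl : R = [] := by cases R <;> simp_all
      refine (tapeDerives_extendRight M L q []).trans
        (this (R := [] ++ [default]) ?_ ⟨_, _, rfl⟩)
      rwa [Tape.mk₂_append_default_right]
    obtain ⟨a, R, rfl⟩ := hR
    wlog hL : ∃ b L', L = b :: L' generalizing L
    · obtain rfl : L = [] := by cases L <;> simp_all
      refine (tapeDerives_extendLeft M [] q _).trans
        (this (L := [] ++ [default]) ?_ ⟨_, _, rfl⟩)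
      rwa [Tape.mk₂_append_default_left]
    obtain ⟨b, L, rfl⟩ := hL
    obtain ⟨⟨q', s⟩, hM, rfl⟩ := Option.map_eq_some_iff.1 hstep
    rw [Tape.mk₂_cons_head] at hM
    rcases s with (_ | _) | b'
    · refine .trans ?_ (ih (L := L) (R := b :: a :: R) (q := q')
        (congrArg _ (Tape.move_left_mk₂ _ _ _).symm))
      simpa [configWord] using (TapeRule.moveLeft b hM).derives
        (leftEnd :: L.reverse.map symbol) (R.map symbol ++ [rightEnd])
    · refine .trans ?_ (ih (L := a :: b :: L) (R := R) (q := q')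
        (congrArg _ (Tape.move_right_mk₂ _ _ _).symm))
      simpa [configWord] using (TapeRule.moveRight hM).derives
        (leftEnd :: (b :: L).reverse.map symbol) (R.map symbol ++ [rightEnd])
    · refine .trans ?_ (ih (L := b :: L) (R := b' :: R) (q := q')
        (congrArg _ (Tape.write_mk₂ _ _ _ _).symm))
      simpa [configWord] using (TapeRule.write hM).derives
        (leftEnd :: (b :: L).reverse.map symbol) (R.map symbol ++ [rightEnd])

/-- A rewriting step from a configuration word leads to the word of the same or of the next
configuration, unless the configuration is a halting one. -/
theorem configWord_step {M : TM0.Machine Γ Λ} {L R : List Γ} {q : Λ} {y : List (TapeLetter Γ Λ)}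
    (h : RewriteStep {p | TapeRule M p} (configWord L q R) y) :
    TM0.step M ⟨q, Tape.mk₂ L R⟩ = none ∨ ∃ L' q' R', y = configWord L' q' R' ∧
      Reaches (TM0.step M) ⟨q, Tape.mk₂ L R⟩ ⟨q', Tape.mk₂ L' R'⟩ := by
  have scanned : ∀ {x z : List (TapeLetter Γ Λ)} {q₀ : Λ} {a : Γ},
      configWord L q R = x ++ state q₀ :: symbol a :: z → q₀ = q ∧
        x = leftEnd :: L.reverse.map symbol ∧
        ∃ R', R = a :: R' ∧ z = R'.map symbol ++ [rightEnd] := by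
    intro x z q₀ a h
    obtain ⟨h1, h2, h3⟩ := eq_of_append_state_eq_configWord h.symm
    cases R with
    | nil => simp at h3
    | cons b R => simp_all
  obtain ⟨x, z, p, hp, hx, rfl⟩ := h
  cases hp with
  | extendLeft =>
    obtain ⟨rfl, -, rfl⟩ := List.append_cons_inj_of_unique (P := (· = leftEnd)) (x' := [])
      (y' := L.reverse.map symbol ++ state q :: (R.map symbol ++ [rightEnd])) rfl rfl
      (by simp) (by rintro _ h rfl; simp at h) (by simpa [configWord] using hx.symm)
    exact .inr ⟨L ++ [default], q, R, by simp [configWord],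
      by rw [Tape.mk₂_append_default_left]; exact .refl⟩
  | extendRight =>
    obtain ⟨rfl, -, rfl⟩ := List.append_cons_inj_of_unique (P := (· = rightEnd))
      (x' := leftEnd :: L.reverse.map symbol ++ state q :: R.map symbol) (y' := []) rfl rfl
      (by rintro _ h rfl; simp at h) (by simp) (by simpa [configWord] using hx.symm)
    exact .inr ⟨L, q, R ++ [default], by simp [configWord],
      by rw [Tape.mk₂_append_default_right]; exact .refl⟩
  | @write q₀ a q' b hM =>
    obtain ⟨rfl, rfl, R', rfl, rfl⟩ := scanned (by simpa using hx)
    refine .inr ⟨L, q', b :: R', by simp [configWord], .single ?_⟩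
    simp [TM0.step, hM, Tape.write_mk₂]
  | @moveRight q₀ a q' hM =>
    obtain ⟨rfl, rfl, R', rfl, rfl⟩ := scanned (by simpa using hx)
    refine .inr ⟨a :: L, q', R', by simp [configWord], .single ?_⟩
    simp [TM0.step, hM, Tape.move_right_mk₂]
  | @moveLeft q₀ a q' b hM =>
    obtain ⟨rfl, hx', R', rfl, rfl⟩ := scanned (x := x ++ [symbol b]) (by simpa using hx)
    cases L with
    | nil => cases x <;> simp at hx'
    | cons b' L =>
      obtain ⟨rfl, hb⟩ : x = leftEnd :: L.reverse.map symbol ∧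
          (symbol b : TapeLetter Γ Λ) = symbol b' :=
        List.concat_inj.1 (by simpa using hx')
      obtain rfl := TapeLetter.symbol.inj hb
      refine .inr ⟨L, q', b :: a :: R', by simp [configWord], .single ?_⟩
      simp [TM0.step, hM, Tape.move_left_mk₂]
  | @halt q₀ a hM =>
    obtain ⟨rfl, rfl, R', rfl, rfl⟩ := scanned (by simpa using hx)
    exact .inl (by simp [TM0.step, hM])
  | eraseLeft a =>
    have : halted ∈ configWord L q R := by simp [hx]
    simp [configWord] at this
  | eraseRight a =>
    have : halted ∈ configWord L q R := by simp [hx]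
    simp [configWord] at this

/-- A Turing machine halts iff the word of its initial configuration derives the halting letter. -/
theorem tapeDerives_halted_iff {M : TM0.Machine Γ Λ} {l : List Γ} :
    TapeDerives M (configWord [] default l) [halted] ↔ (TM0.eval M l).Dom := by
  change _ ↔ (StateTransition.eval (TM0.step M) _).Dom
  constructor
  · intro h
    have key : ∀ y, TapeDerives M (configWord [] default l) y →
        (StateTransition.eval (TM0.step M) (TM0.init l)).Dom ∨ ∃ L q R, y = configWord L q R ∧
          Reaches (TM0.step M) (TM0.init l) ⟨q, Tape.mk₂ L R⟩ := by
      intro y hy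
      induction hy with
      | refl => exact .inr ⟨[], default, l, rfl, .refl⟩
      | tail _ hstep ih =>
        rcases ih with h | ⟨L, q, R, rfl, hr⟩
        · exact .inl h
        · rcases configWord_step hstep with h | ⟨L', q', R', rfl, hr'⟩
          · exact .inl (Part.dom_iff_mem.2 ⟨_, mem_eval.2 ⟨hr, h⟩⟩)
          · exact .inr ⟨L', q', R', rfl, hr.trans hr'⟩
    rcases key _ h with h | ⟨L, q, R, h, -⟩
    · exact h
    · simp [configWord] at h
  · intro h
    obtain ⟨c, hc⟩ := Part.dom_iff_mem.1 h
    obtain ⟨hr, hc⟩ := mem_eval.1 hc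
    exact tapeDerives_of_reaches hr hc

end TuringMachine

section Universality

open Turing StateTransition

theorem Turing.TM0.Supports.exists_restrict {Γ Λ : Type*} [Inhabited Γ] [Inhabited Λ]
    {M : TM0.Machine Γ Λ} {S : Set Λ} (hS : TM0.Supports M S) :
    ∃ (_ : Inhabited S) (N : TM0.Machine Γ S),
      ∀ l, (TM0.eval N l).Dom ↔ (TM0.eval M l).Dom := by
  classical
  let _ : Inhabited S := ⟨⟨default, hS.1⟩⟩
  let idMap : PointedMap Γ Γ := ⟨id, rfl⟩
  let toSub : PointedMap Λ S := ⟨fun q => if h : q ∈ S then ⟨q, h⟩ else default, dif_pos hS.1⟩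
  refine ⟨inferInstance, M.map idMap idMap toSub Subtype.val, fun l => ?_⟩
  have hresp := TM0.Machine.map_respects M idMap idMap toSub Subtype.val hS (fun _ => rfl)
    (fun q hq => congrArg Subtype.val (dif_pos hq))
  refine StateTransition.tr_eval_dom (a₁ := TM0.init l) (a₂ := TM0.init l) hresp ⟨hS.1, ?_⟩
  rw [TM0.map_init]
  exact congrArg _ (List.map_id l)

instance : Finite PartrecToTM2.K' := by
  let code : PartrecToTM2.K' → Fin 4
    | .main => 0
    | .rev => 1
    | .aux => 2
    | .stack => 3
  refine Finite.of_injective code fun x y h => ?_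
  cases x <;> cases y <;> simp_all [code]

theorem Turing.ToPartrec.Code.exists_tm2_eval_dom (c : ToPartrec.Code) :
    ∃ (_ : Inhabited PartrecToTM2.Λ') (S : Finset PartrecToTM2.Λ'),
      TM2.Supports PartrecToTM2.tr S ∧ ∀ v, (TM2.eval PartrecToTM2.tr PartrecToTM2.K'.main
        (PartrecToTM2.trList v)).Dom ↔ (c.eval v).Dom := by
  let _ : Inhabited PartrecToTM2.Λ' := ⟨PartrecToTM2.trNormal c .halt⟩
  refine ⟨inferInstance, _, PartrecToTM2.tr_supports c .halt, fun v => ?_⟩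
  have hinit : TM2.init PartrecToTM2.K'.main (PartrecToTM2.trList v) = PartrecToTM2.init c v := by
    refine congrArg (TM2.Cfg.mk _ _) (funext fun k => ?_)
    cases k <;> rfl
  change (StateTransition.eval (TM2.step PartrecToTM2.tr) (TM2.init _ _)).Dom ↔ _
  rw [hinit, PartrecToTM2.tr_eval]
  rfl

/-- Every partial recursive function has the domain of some finite Turing machine. -/
theorem Partrec.exists_tm0_eval_dom {f : ℕ →. ℕ} (hf : Partrec f) :
    ∃ (Γ Λ : Type) (_ : Finite Γ) (_ : Finite Λ) (_ : Inhabited Γ) (_ : Inhabited Λ)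
      (M : TM0.Machine Γ Λ) (a : Γ) (g : PartrecToTM2.Γ' → Γ),
      ∀ n, (TM0.eval M (a :: (PartrecToTM2.trNat n).reverse.map g)).Dom ↔ (f n).Dom := by
  obtain ⟨c, hc⟩ := ToPartrec.Code.exists_code (Nat.Partrec'.part_iff₁.2 hf)
  obtain ⟨_, S, hS, heval⟩ := c.exists_tm2_eval_dom
  obtain ⟨_, N, hN⟩ := (TM1to0.tr_supports _ (TM2to1.tr_supports _ hS)).exists_restrict
  have : Finite (TM2to1.Γ' PartrecToTM2.K' fun _ => PartrecToTM2.Γ') :=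
    inferInstanceAs (Finite (Bool × (PartrecToTM2.K' → Option PartrecToTM2.Γ')))
  let column (s : PartrecToTM2.Γ') (k : PartrecToTM2.K') : Option PartrecToTM2.Γ' :=
    Function.update (fun _ => Option.none) PartrecToTM2.K'.main (some s) k
  refine ⟨_, _, this, inferInstance, inferInstance, inferInstance, N, (true, column .cons),
    fun s => (false, column s), fun n => ?_⟩
  have hf : (c.eval [n]).Dom ↔ (f n).Dom := by
    simpa using! congrArg Part.Dom (hc ⟨[n], rfl⟩)
  have hinput : TM2to1.trInit PartrecToTM2.K'.main (PartrecToTM2.trList [n]) =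
      (true, column .cons) :: (PartrecToTM2.trNat n).reverse.map fun s => (false, column s) := by
    have hrev : (PartrecToTM2.trList [n]).reverse = .cons :: (PartrecToTM2.trNat n).reverse := by
      simp [PartrecToTM2.trList]
    rw [TM2to1.trInit, hrev]
    rfl
  have hsim := TM2to1.tr_eval_dom PartrecToTM2.tr PartrecToTM2.K'.main (PartrecToTM2.trList [n])
  rw [hinput] at hsim
  rw [← hf, ← heval, hN, TM1to0.tr_eval]
  exact hsim

end Universality

section Undecidability

open Turing PartrecToTM2

theorem trNat_two_mul {n : ℕ} (hn : n ≠ 0) : trNat (2 * n) = .bit0 :: trNat n := by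
  have h : ((2 * n : ℕ) : Num) = (n : Num).bit0 := by
    rw [two_mul, Nat.cast_add, Num.bit0_of_bit0]
  have h0 : (n : Num) ≠ 0 := by exact_mod_cast hn
  rw [trNat, trNat, h]
  cases hm : (n : Num) with
  | zero => exact absurd hm h0
  | pos m => rfl

theorem trNat_two_mul_add_one (n : ℕ) : trNat (2 * n + 1) = .bit1 :: trNat n := by
  have h : ((2 * n + 1 : ℕ) : Num) = (n : Num).bit1 := by
    rw [two_mul, Nat.cast_add, Nat.cast_add, Nat.cast_one, Num.bit1_of_bit1]
  rw [trNat, trNat, h]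
  cases (n : Num) <;> rfl

theorem trNat_of_ne_zero {n : ℕ} (hn : n ≠ 0) :
    trNat n = (if n % 2 = 0 then .bit0 else .bit1) :: trNat (n / 2) := by
  split_ifs with h
  · obtain ⟨m, rfl⟩ : ∃ m, n = 2 * m := ⟨n / 2, by lia⟩
    rw [trNat_two_mul (by lia), Nat.mul_div_cancel_left m two_pos]
  · obtain ⟨m, rfl⟩ : ∃ m, n = 2 * m + 1 := ⟨n / 2, by lia⟩
    rw [trNat_two_mul_add_one, show (2 * m + 1) / 2 = m by lia]

theorem primrec_map_trNat (h : Γ' → ℕ) : Primrec fun n => (trNat n).map h := by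
  let next (l : List (List ℕ)) : Option (List ℕ) :=
    if l.length = 0 then some []
    else l[l.length / 2]?.map
      (List.cons (if l.length % 2 = 0 then h .bit0 else h .bit1))
  have hlength : Primrec (List.length : List (List ℕ) → ℕ) := Primrec.list_length
  have hdigit : Primrec fun l : List (List ℕ) =>
      if l.length % 2 = 0 then h .bit0 else h .bit1 :=
    .ite (Primrec.eq.comp (Primrec.nat_mod.comp hlength (.const 2)) (.const 0))
      (.const _) (.const _)
  have hnext : Primrec next :=
    .ite (Primrec.eq.comp hlength (.const 0)) (.const _)
      (.option_map (Primrec.list_getElem?.comp .id (Primrec.nat_div.comp hlength (.const 2)))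
        (Primrec.list_cons.comp₂ (hdigit.comp₂ .left) .right))
  have hrec : Primrec₂ fun (_ : Unit) n => (trNat n).map h := by
    refine Primrec.nat_strong_rec _ (hnext.comp₂ .right) fun _ n => ?_
    by_cases hn : n = 0
    · simp [next, hn]
    · have hlt : n / 2 < n := Nat.div_lt_self (Nat.pos_of_ne_zero hn) one_lt_two
      rw [trNat_of_ne_zero hn]
      simp [next, hn, hlt, apply_ite h]
  exact hrec.comp (.const ()) .id

theorem primrec_padAfter : Primrec padAfter :=
  .list_flatMap .id (Primrec.list_cons.comp₂ .right (Primrec₂.const [0]))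

theorem startTile_configWord {Γ Λ : Type*} (e : TapeLetter Γ Λ → ℕ) (q : Λ) (R : List Γ) :
    startTile e (configWord [] q R) = ([0, 1], [0, 1, 0, e .leftEnd + 4, 0, e (.state q) + 4, 0] ++
      padAfter (R.map (fun a => e (.symbol a) + 4) ++ [e .rightEnd + 4, 2])) := by
  simp [startTile, configWord, encodeWord, padAfter, Function.comp_def]

/-- Every partial recursive domain reduces computably to the prefix Post correspondence problem. -/
theorem Partrec.exists_prefixPCP_reduction {f : ℕ →. ℕ} (hf : Partrec f) :
    ∃ tiles : ℕ → List (List ℕ × List ℕ), Primrec tiles ∧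
      (∀ n, ∀ p ∈ tiles n, p.1 ≠ [] ∧ p.2 ≠ []) ∧
      ∀ n, PrefixPCPSolvable (tiles n) ↔ (f n).Dom := by
  obtain ⟨Γ, Λ, _, _, _, _, M, a, g, hM⟩ := hf.exists_tm0_eval_dom
  have := Fintype.ofFinite (TapeLetter Γ Λ)
  let e (x : TapeLetter Γ Λ) : ℕ := Fintype.equivFin _ x
  have he : Function.Injective e := Fin.val_injective.comp (Fintype.equivFin _).injective
  let R := (finite_setOf_tapeRule M).toFinset.toList
  have hR : {p | p ∈ R} = {p | TapeRule M p} := by ext; simp [R]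
  have hR' : ∀ p ∈ R, p.1 ≠ [] ∧ p.2 ≠ [] := fun p hp => TapeRule.ne_nil (hR.subset hp)
  let input (n : ℕ) : List Γ := a :: (trNat n).reverse.map g
  refine ⟨fun n => startTile e (configWord [] default (input n)) :: commonTiles e R .halted,
    ?_, fun n => ?_, fun n => ?_⟩
  · refine Primrec.list_cons.comp ?_ (.const _)
    simp only [startTile_configWord, input, List.map_cons, List.map_map, List.map_reverse]
    refine .pair (.const _) (Primrec.list_append.comp (.const _) (primrec_padAfter.comp ?_))
    exact Primrec.list_append.comp (Primrec.list_cons.comp (.const _)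
      (Primrec.list_reverse.comp (primrec_map_trNat _))) (.const _)
  · refine List.forall_mem_cons.2 ⟨by simp [startTile], ?_⟩
    refine forall_mem_commonTiles.2 ⟨by simp [endTile], by simp [matchTile],
      fun _ => by simp [matchTile], fun p hp => ?_⟩
    obtain ⟨⟨c, l, hl⟩, d, r, hr⟩ := (hR' p hp).imp List.exists_cons_of_ne_nil
      List.exists_cons_of_ne_nil
    simp [matchTile, hl, hr]
  · rw [prefixPCPSolvable_tiles_iff he hR', hR, ← hM]
    exact tapeDerives_halted_iff

end Undecidability

/-- The prefix Post correspondence problem is undecidable: no total computable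
function decides, given a finite list of pairs of nonempty words, whether it admits
a prefix-PCP solution. -/
theorem undecidable_prefixPCP :
    ¬ ∃ f : List (List ℕ × List ℕ) → Bool, Computable f ∧
      ∀ L : List (List ℕ × List ℕ), (∀ p ∈ L, p.1 ≠ [] ∧ p.2 ≠ []) →
        (f L = true ↔ PrefixPCPSolvable L) := by
  rintro ⟨f, hf, hdec⟩
  have huniv : Partrec fun n => (Denumerable.ofNat Nat.Partrec.Code n).eval 0 :=
    Nat.Partrec.Code.eval_part.comp (Computable.ofNat _) (.const 0)
  obtain ⟨tiles, htiles, hne, hiff⟩ := huniv.exists_prefixPCP_reduction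
  refine ComputablePred.halting_problem 0 (ComputablePred.computable_iff.2
    ⟨fun c => f (tiles (Encodable.encode c)),
      hf.comp (htiles.to_comp.comp Computable.encode), funext fun c => propext ?_⟩)
  rw [hdec _ (hne _), hiff, Denumerable.ofNat_encode]
end

section
/- Let (u₁,v₁),…,(u_n,v_n) be pairs of nonempty words over a finite alphabet 𝒜, let # and * be two new symbols not in 𝒜, and over ℬ = 𝒜 ∪ {#,*} define for each i (writing u_i = x₁⋯x_k and v_i = y₁⋯y_ℓ with letters x_j, y_j ∈ 𝒜): A_i = # x₁ * x₂ * ⋯ * x_k, B_i = # y₁ * y₂ * ⋯ * y_ℓ *, U_i = * x₁ * x₂ * ⋯ * x_k, V_i = y₁ * y₂ * ⋯ * y_ℓ *, and Y = *#, Z = #. Then the instance (A₁,B₁),…,(A_n,B_n),(U₁,V₁),…,(U_n,V_n),(Y,Z) admits a prefix-PCP solution if and only if the instance (u₁,v₁),…,(u_n,v_n) admits a PCP solution. -/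
/-- A PCP solution of the instance `L`: a nonempty index word `s` with
`u_{s₁} ⋯ u_{s_m} = v_{s₁} ⋯ v_{s_m}`. -/
def PCPSolvable {β : Type*} (L : List (List β × List β)) : Prop :=
  ∃ s : List (Fin L.length), s ≠ [] ∧
    (s.map fun i => (L.get i).1).flatten = (s.map fun i => (L.get i).2).flatten

/-- `A_i = # x₁ * x₂ * ⋯ * x_k` for `u_i = x₁ ⋯ x_k`. -/
def wordA {𝒜 ℬ : Type*} (emb : 𝒜 → ℬ) (hash star : ℬ) (w : List 𝒜) : List ℬ :=
  hash :: List.intersperse star (w.map emb)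

/-- `U_i = * x₁ * x₂ * ⋯ * x_k` for `u_i = x₁ ⋯ x_k`. -/
def wordU {𝒜 ℬ : Type*} (emb : 𝒜 → ℬ) (star : ℬ) (w : List 𝒜) : List ℬ :=
  star :: List.intersperse star (w.map emb)

/-- `B_i = # y₁ * y₂ * ⋯ * y_ℓ *` for `v_i = y₁ ⋯ y_ℓ`. -/
def wordB {𝒜 ℬ : Type*} (emb : 𝒜 → ℬ) (hash star : ℬ) (w : List 𝒜) : List ℬ :=
  hash :: (w.map fun y => [emb y, star]).flatten

/-- `V_i = y₁ * y₂ * ⋯ * y_ℓ *` for `v_i = y₁ ⋯ y_ℓ`. -/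
def wordV {𝒜 ℬ : Type*} (emb : 𝒜 → ℬ) (star : ℬ) (w : List 𝒜) : List ℬ :=
  (w.map fun y => [emb y, star]).flatten

/-- The transformed instance
`(A₁,B₁),…,(A_n,B_n),(U₁,V₁),…,(U_n,V_n),(Y,Z)` with `Y = *#` and `Z = #`. -/
def transformedInstance {𝒜 ℬ : Type*} (emb : 𝒜 → ℬ) (hash star : ℬ)
    (P : List (List 𝒜 × List 𝒜)) : List (List ℬ × List ℬ) :=
  (P.map fun p => (wordA emb hash star p.1, wordB emb hash star p.2)) ++
  (P.map fun p => (wordU emb star p.1, wordV emb star p.2)) ++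
  [([star, hash], [hash])]

/-- `* x₁ * x₂ * ⋯ * x_k` for `w = x₁ ⋯ x_k`; unlike `wordU`, it is empty when `w` is. -/
def starBefore {𝒜 ℬ : Type*} (emb : 𝒜 → ℬ) (star : ℬ) (w : List 𝒜) : List ℬ :=
  w.flatMap fun x => [star, emb x]

section Words

variable {𝒜 ℬ : Type*} {emb : 𝒜 → ℬ} {hash star : ℬ}

theorem star_cons_intersperse {w : List 𝒜} (hw : w ≠ []) :
    star :: List.intersperse star (w.map emb) = starBefore emb star w := by
  induction w with
  | nil => contradiction
  | cons x w ih =>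
    cases w with
    | nil => simp [starBefore]
    | cons y w =>
      have h := ih (by simp)
      simp only [starBefore, List.map_cons, List.flatMap_cons] at h ⊢
      rw [← h]
      simp [List.intersperse]

theorem star_cons_wordV (w : List 𝒜) :
    star :: wordV emb star w = starBefore emb star w ++ [star] := by
  induction w with
  | nil => rfl
  | cons x w ih => simpa [starBefore, wordV] using ih

theorem starBefore_append (v w : List 𝒜) :
    starBefore emb star (v ++ w) = starBefore emb star v ++ starBefore emb star w := by
  simp [starBefore]

theorem starBefore_getLast_mem {w : List 𝒜} {z : ℬ}
    (hz : z ∈ (starBefore emb star w).getLast?) : z ∈ Set.range emb := by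
  induction w using List.reverseRecOn with
  | nil => simp [starBefore] at hz
  | append_singleton w x _ =>
    simp [starBefore] at hz
    exact ⟨x, hz⟩

theorem eq_of_starBefore_append_star_hash (hemb : Function.Injective emb)
    (hhash : hash ∉ Set.range emb) {a b : List 𝒜} {r r' : List ℬ}
    (h : starBefore emb star a ++ star :: hash :: r =
      starBefore emb star b ++ star :: hash :: r') : a = b := by
  induction a generalizing b with
  | nil =>
    cases b with
    | nil => rfl
    | cons y b => exact absurd ⟨y, by simp_all [starBefore]⟩ hhash
  | cons x a ih =>
    cases b with
    | nil => exact absurd ⟨x, by simp_all [starBefore]⟩ hhash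
    | cons y b =>
      simp only [starBefore, List.flatMap_cons, List.cons_append, List.nil_append,
        List.cons.injEq, true_and] at h
      rw [hemb h.1, ih h.2]

theorem starBefore_append_hash_ne (hhash : hash ∉ Set.range emb) (hns : hash ≠ star)
    {a b : List 𝒜} {r r' : List ℬ} :
    starBefore emb star a ++ hash :: r ≠ starBefore emb star b ++ star :: hash :: r' := by
  induction a generalizing b with
  | nil => cases b <;> simp [starBefore, hns]
  | cons x a ih =>
    cases b with
    | nil =>
      intro h
      exact hhash ⟨x, by simp_all [starBefore]⟩
    | cons y b =>
      intro h
      simp only [starBefore, List.flatMap_cons, List.cons_append, List.nil_append,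
        List.cons.injEq, true_and] at h
      exact ih h.2

theorem getLast?_flatten_mem {S : Set ℬ} {L : List (List ℬ)}
    (hL : ∀ w ∈ L, ∃ z ∈ S, w.getLast? = some z) {z : ℬ}
    (hz : z ∈ L.flatten.getLast?) : z ∈ S := by
  induction L using List.reverseRecOn with
  | nil => simp at hz
  | append_singleton L w _ =>
    obtain ⟨y, hy, hw⟩ := hL w (by simp)
    simp [List.getLast?_append, hw] at hz
    exact hz ▸ hy

theorem mem_transformedInstance {P : List (List 𝒜 × List 𝒜)} {e : List ℬ × List ℬ} :
    e ∈ transformedInstance emb hash star P ↔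
      (∃ p ∈ P, e = (wordA emb hash star p.1, wordB emb hash star p.2)) ∨
      (∃ p ∈ P, e = (wordU emb star p.1, wordV emb star p.2)) ∨
      e = ([star, hash], [hash]) := by
  simp [transformedInstance, eq_comm]

theorem getLast?_fst_of_mem_transformedInstance (hstar : star ∉ Set.range emb)
    (hns : hash ≠ star) {P : List (List 𝒜 × List 𝒜)} (hP : ∀ p ∈ P, p.1 ≠ [] ∧ p.2 ≠ [])
    {e : List ℬ × List ℬ} (he : e ∈ transformedInstance emb hash star P) :
    ∃ z ∈ ({star}ᶜ : Set ℬ), e.1.getLast? = some z := by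
  have key : ∀ w : List 𝒜, w ≠ [] → ∀ c : ℬ, ∃ z ∈ ({star}ᶜ : Set ℬ),
      (c :: List.intersperse star (w.map emb)).getLast? = some z := by
    intro w hw c
    have h := star_cons_intersperse (emb := emb) (star := star) hw
    induction w using List.reverseRecOn with
    | nil => contradiction
    | append_singleton w x _ =>
      refine ⟨emb x, fun hx => hstar ⟨x, hx⟩, ?_⟩
      have hl := congrArg List.getLast? h
      cases hI : List.intersperse star ((w ++ [x]).map emb) with
      | nil =>
        rw [hI] at hl
        simp [starBefore] at hl
        exact absurd ⟨x, hl.symm⟩ hstar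
      | cons d I =>
        rw [hI] at hl
        rw [List.getLast?_cons_cons] at hl ⊢
        simpa [starBefore] using hl
  rcases mem_transformedInstance.1 he with ⟨p, hp, rfl⟩ | ⟨p, hp, rfl⟩ | rfl
  · exact key _ (hP p hp).1 _
  · exact key _ (hP p hp).1 _
  · exact ⟨hash, hns, rfl⟩

theorem getLast?_snd_of_mem_transformedInstance (hhash : hash ∉ Set.range emb)
    (hstar : star ∉ Set.range emb)
    {P : List (List 𝒜 × List 𝒜)} (hP : ∀ p ∈ P, p.1 ≠ [] ∧ p.2 ≠ [])
    {e : List ℬ × List ℬ} (he : e ∈ transformedInstance emb hash star P) :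
    ∃ z ∈ (Set.range emb)ᶜ, e.2.getLast? = some z := by
  have key : ∀ w : List 𝒜, w ≠ [] → (wordV emb star w).getLast? = some star := by
    intro w hw
    induction w using List.reverseRecOn with
    | nil => contradiction
    | append_singleton w x _ => simp [wordV]
  rcases mem_transformedInstance.1 he with ⟨p, hp, rfl⟩ | ⟨p, hp, rfl⟩ | rfl
  · refine ⟨star, hstar, ?_⟩
    have h := key _ (hP p hp).2
    change (hash :: wordV emb star p.2).getLast? = some star
    rw [List.getLast?_cons, h]
    rfl
  · exact ⟨star, hstar, key _ (hP p hp).2⟩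
  · exact ⟨hash, hhash, rfl⟩

/-- The tiles in `c` form the block of `A`- and `U`-tiles read so far; `s` and `t` are what remains
of the two index words. -/
theorem exists_solution_of_block (hemb : Function.Injective emb)
    (hhash : hash ∉ Set.range emb) (hstar : star ∉ Set.range emb) (hns : hash ≠ star)
    {P : List (List 𝒜 × List 𝒜)} (hP : ∀ p ∈ P, p.1 ≠ [] ∧ p.2 ≠ [])
    {s t : List (List ℬ × List ℬ)}
    (hs : ∀ e ∈ s, e ∈ transformedInstance emb hash star P)
    (ht : ∀ e ∈ t, e ∈ transformedInstance emb hash star P)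
    (hst : s <+: t ∨ t <+: s) {c : List (List 𝒜 × List 𝒜)} (hc : c ≠ []) (hcP : ∀ p ∈ c, p ∈ P)
    (h : starBefore emb star (c.map Prod.fst).flatten ++ (s.map Prod.fst).flatten =
      starBefore emb star (c.map Prod.snd).flatten ++ star :: (t.map Prod.snd).flatten) :
    ∃ d : List (List 𝒜 × List 𝒜), d ≠ [] ∧ (∀ p ∈ d, p ∈ P) ∧
      (d.map Prod.fst).flatten = (d.map Prod.snd).flatten := by
  induction s generalizing t c with
  | nil =>
    have hT : ∀ z ∈ (star :: (t.map Prod.snd).flatten).getLast?, z ∈ (Set.range emb)ᶜ := by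
      intro z hz
      refine getLast?_flatten_mem (L := [star] :: t.map Prod.snd) ?_ hz
      simp only [List.mem_cons, List.mem_map]
      rintro w (rfl | ⟨e, he, rfl⟩)
      · exact ⟨star, hstar, rfl⟩
      · exact getLast?_snd_of_mem_transformedInstance hhash hstar hP (ht e he)
    obtain ⟨z, hz⟩ : ∃ z, (star :: (t.map Prod.snd).flatten).getLast? = some z :=
      ⟨_, List.getLast?_cons⟩
    refine absurd (starBefore_getLast_mem (w := (c.map Prod.fst).flatten) (star := star) (z := z) ?_)
      (hT z hz)
    simp only [List.map_nil, List.flatten_nil, List.append_nil] at h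
    rw [h, List.getLast?_append, hz]
    rfl
  | cons e s ih =>
    cases t with
    | nil =>
      have hS : star ∈ ({star}ᶜ : Set ℬ) := by
        refine getLast?_flatten_mem (L := (e :: s).map Prod.fst) ?_ ?_
        · simp only [List.mem_map]
          rintro w ⟨e, he, rfl⟩
          exact getLast?_fst_of_mem_transformedInstance hstar hns hP (hs e he)
        · obtain ⟨y, -, hy⟩ := getLast?_fst_of_mem_transformedInstance hstar hns hP
            (hs e (by simp))
          have hne : ((e :: s).map Prod.fst).flatten ≠ [] := by
            intro h0
            simp only [List.map_cons, List.flatten_cons, List.append_eq_nil_iff] at h0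
            simp [h0.1] at hy
          have hl := congrArg List.getLast? h
          rw [List.getLast?_append_of_ne_nil _ hne] at hl
          rw [hl]
          simp
      exact absurd rfl hS
    | cons e' t =>
      simp only [List.cons_prefix_cons] at hst
      obtain rfl : e = e' := by
        rcases hst with h | h
        · exact h.1
        · exact h.1.symm
      replace hst : s <+: t ∨ t <+: s := hst.imp And.right And.right
      have hs' : ∀ e ∈ s, e ∈ transformedInstance emb hash star P :=
        fun e he => hs e (List.mem_cons_of_mem _ he)
      have ht' : ∀ e ∈ t, e ∈ transformedInstance emb hash star P :=
        fun e he => ht e (List.mem_cons_of_mem _ he)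
      rcases mem_transformedInstance.1 (hs e (by simp)) with
        ⟨p, hp, rfl⟩ | ⟨p, hp, rfl⟩ | rfl
      · exact absurd h (starBefore_append_hash_ne hhash hns)
      · refine ih hs' ht' hst (c := c ++ [p]) (by simp) ?_ ?_
        · intro q hq
          rcases List.mem_append.1 hq with hq | hq
          · exact hcP q hq
          · exact List.mem_singleton.1 hq ▸ hp
        · simp only [List.map_cons, List.flatten_cons, wordU,
            star_cons_intersperse (hP p hp).1] at h
          rw [← List.cons_append, star_cons_wordV] at h
          simpa [starBefore_append] using h
      · exact ⟨c, hc, hcP, eq_of_starBefore_append_star_hash hemb hhash h⟩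

theorem starBefore_block (c : List (List 𝒜 × List 𝒜)) (hc : ∀ p ∈ c, p.1 ≠ []) :
    (c.map fun p => wordU emb star p.1).flatten = starBefore emb star (c.map Prod.fst).flatten := by
  induction c with
  | nil => rfl
  | cons p c ih =>
    simp only [List.forall_mem_cons] at hc
    simp only [List.map_cons, List.flatten_cons, starBefore_append, ih hc.2]
    rw [wordU, star_cons_intersperse hc.1]

theorem wordV_block (c : List (List 𝒜 × List 𝒜)) :
    (c.map fun p => wordV emb star p.2).flatten = wordV emb star (c.map Prod.snd).flatten := by
  induction c with
  | nil => rfl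
  | cons p c ih =>
    rw [List.map_cons, List.flatten_cons, ih]
    simp [wordV]

end Words

theorem exists_map_get_eq {α : Type*} {L s : List α} (hs : ∀ x ∈ s, x ∈ L) :
    ∃ i : List (Fin L.length), i.map L.get = s := by
  induction s with
  | nil => exact ⟨[], rfl⟩
  | cons x s ih =>
    simp only [List.forall_mem_cons] at hs
    obtain ⟨i, rfl⟩ := ih hs.2
    obtain ⟨k, rfl⟩ := List.mem_iff_get.1 hs.1
    exact ⟨k :: i, rfl⟩

theorem pcpSolvable_iff_exists_pairs {β : Type*} {L : List (List β × List β)} :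
    PCPSolvable L ↔ ∃ c : List (List β × List β), c ≠ [] ∧ (∀ p ∈ c, p ∈ L) ∧
      (c.map Prod.fst).flatten = (c.map Prod.snd).flatten := by
  constructor
  · rintro ⟨s, hs, h⟩
    exact ⟨s.map L.get, by simpa using hs, by simp, by simpa [Function.comp_def] using h⟩
  · rintro ⟨c, hc, hcL, h⟩
    obtain ⟨s, rfl⟩ := exists_map_get_eq hcL
    exact ⟨s, by simpa using hc, by simpa [Function.comp_def] using h⟩

theorem prefixPCPSolvable_iff_exists_pairs {β : Type*} {L : List (List β × List β)} :
    PrefixPCPSolvable L ↔ ∃ s t : List (List β × List β), s ≠ [] ∧ t ≠ [] ∧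
      (∀ p ∈ s, p ∈ L) ∧ (∀ p ∈ t, p ∈ L) ∧ (s <+: t ∨ t <+: s) ∧
      (s.map Prod.fst).flatten = (t.map Prod.snd).flatten := by
  constructor
  · rintro ⟨s, t, hs, ht, hst, h⟩
    exact ⟨s.map L.get, t.map L.get, by simpa using hs, by simpa using ht, by simp, by simp,
      hst.imp (fun h => h.map _) (fun h => h.map _), by simpa [Function.comp_def] using h⟩
  · rintro ⟨s, t, hs, ht, hsL, htL, ⟨r, rfl⟩ | ⟨r, rfl⟩, h⟩
    · obtain ⟨i, rfl⟩ := exists_map_get_eq hsL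
      obtain ⟨j, rfl⟩ := exists_map_get_eq fun x hx => htL x (List.mem_append_right _ hx)
      have hi : i ≠ [] := by simpa using hs
      exact ⟨i, i ++ j, hi, by simp [hi], .inl (List.prefix_append _ _),
        by simpa [Function.comp_def] using h⟩
    · obtain ⟨i, rfl⟩ := exists_map_get_eq htL
      obtain ⟨j, rfl⟩ := exists_map_get_eq fun x hx => hsL x (List.mem_append_right _ hx)
      have hi : i ≠ [] := by simpa using ht
      exact ⟨i ++ j, i, by simp [hi], hi, .inr (List.prefix_append _ _),
        by simpa [Function.comp_def] using h⟩

/-- The reduction from PCP to prefix-PCP: the transformed instance admits a prefix-PCP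
solution if and only if the original instance admits a PCP solution. -/
theorem prefixPCP_reduction {𝒜 ℬ : Type*} [Fintype 𝒜] (emb : 𝒜 → ℬ) (hash star : ℬ)
    (hemb : Function.Injective emb)
    (hhash : hash ∉ Set.range emb) (hstar : star ∉ Set.range emb)
    (hns : hash ≠ star)
    (P : List (List 𝒜 × List 𝒜)) (hP : ∀ p ∈ P, p.1 ≠ [] ∧ p.2 ≠ []) :
    PrefixPCPSolvable (transformedInstance emb hash star P) ↔ PCPSolvable P := by
  rw [prefixPCPSolvable_iff_exists_pairs, pcpSolvable_iff_exists_pairs]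
  constructor
  · rintro ⟨s, t, hs, ht, hsL, htL, hst, h⟩
    obtain ⟨e, s, rfl⟩ := List.exists_cons_of_ne_nil hs
    obtain ⟨e', t, rfl⟩ := List.exists_cons_of_ne_nil ht
    simp only [List.cons_prefix_cons] at hst
    obtain rfl : e = e' := by
      rcases hst with h | h
      · exact h.1
      · exact h.1.symm
    rcases mem_transformedInstance.1 (hsL e (by simp)) with
      ⟨p, hp, rfl⟩ | ⟨p, hp, rfl⟩ | rfl
    · refine exists_solution_of_block hemb hhash hstar hns hP
        (fun e he => hsL e (List.mem_cons_of_mem _ he))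
        (fun e he => htL e (List.mem_cons_of_mem _ he))
        (hst.imp And.right And.right) (c := [p]) (by simp) (by simpa using hp) ?_
      have h' : star :: List.intersperse star (p.1.map emb) ++ (s.map Prod.fst).flatten =
          star :: wordV emb star p.2 ++ (t.map Prod.snd).flatten := by
        simpa [wordA, wordB, wordV] using h
      rw [star_cons_intersperse (hP p hp).1, star_cons_wordV] at h'
      simpa using h'
    · obtain ⟨y, v, hv⟩ := List.exists_cons_of_ne_nil (hP p hp).2
      refine absurd ⟨y, ?_⟩ hstar
      simp only [List.map_cons, List.flatten_cons, wordU, wordV, hv, List.cons_append,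
        List.cons.injEq] at h
      exact h.1.symm
    · simp only [List.map_cons, List.flatten_cons, List.cons_append, List.cons.injEq] at h
      exact absurd h.1.symm hns
  · rintro ⟨c, hc, hcP, h⟩
    obtain ⟨p, c, rfl⟩ := List.exists_cons_of_ne_nil hc
    have hp : p ∈ P := hcP p (by simp)
    have hcP' : ∀ q ∈ c, q ∈ P := fun q hq => hcP q (List.mem_cons_of_mem _ hq)
    let s : List (List ℬ × List ℬ) :=
      (wordA emb hash star p.1, wordB emb hash star p.2) ::
        (c.map fun q => (wordU emb star q.1, wordV emb star q.2)) ++ [([star, hash], [hash])]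
    have hs : ∀ e ∈ s, e ∈ transformedInstance emb hash star P := by
      intro e he
      rw [mem_transformedInstance]
      simp only [s, List.cons_append, List.mem_cons, List.mem_append, List.mem_map,
        List.not_mem_nil, or_false] at he
      rcases he with rfl | ⟨q, hq, rfl⟩ | rfl
      · exact .inl ⟨p, hp, rfl⟩
      · exact .inr (.inl ⟨q, hcP' q hq, rfl⟩)
      · exact .inr (.inr rfl)
    refine ⟨s, s, by simp [s], by simp [s], hs, hs, .inl (List.prefix_refl _), ?_⟩
    have hU := starBefore_block (emb := emb) (star := star) (p :: c)
      fun q hq => (hP q (hcP q hq)).1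
    have hV := wordV_block (emb := emb) (star := star) (p :: c)
    have key : star :: (List.intersperse star (p.1.map emb) ++
        (c.map fun q => wordU emb star q.1).flatten ++ [star]) =
        star :: (wordV emb star p.2 ++ (c.map fun q => wordV emb star q.2).flatten) := by
      simp only [List.map_cons, List.flatten_cons] at hU hV h
      rw [hV, ← h, star_cons_wordV, ← hU]
      simp [wordU]
    have key' := (List.cons.inj key).2
    simp only [s, wordA, wordB, List.map_append, List.map_cons, List.map_map, List.map_nil,
      List.flatten_append, List.flatten_cons, List.flatten_nil, Function.comp_def,
      List.cons_append, List.append_nil, List.cons.injEq, true_and]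
    change _ = wordV emb star p.2 ++ (_ ++ _)
    rw [← List.append_assoc (wordV emb star p.2), ← key']
    simp
end
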